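/- Fix q > 1. For every tilde-epsilon > 0, delta > 0 and A > 0 there exist an axisymmetric function omega_0 in C_c^infty(R^3; R) vanishing on the axis {r_x = 0}, and smooth functions omega : R^3 x [0,infty) -> R and u : R^3 x [0,infty) -> R^3, such that: (i) ||omega_0||_{L^infty(R^3)} + ||omega_0||_{L^1(R^3)} + ||omega_0/r||_{L^{3,q}(R^3)} <= tilde-epsilon, where (omega_0/r)(x) := omega_0(x)/r_x; (ii) omega(.,0) = omega_0, for each t >= 0 the function omega(.,t) is axisymmetric with compact support, and u(.,t) is the Biot--Savart velocity of omega(.,t); (iii) the vector field Omega(x,t) := omega(x,t) e_theta(x) (extended by 0 on the axis) solves the three-dimensional vorticity equation d/dt Omega + (u . grad) Omega = (Omega . grad) u pointwise on R^3 x [0,infty); and (iv) sup_{0 <= t <= delta} ||omega(.,t)||_{L^infty(R^3)} >= A. -/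

import Mathlib

noncomputable section

open MeasureTheory Real Set Filter
open scoped ENNReal

/-- Euclidean three-space. -/
abbrev E3 : Type := EuclideanSpace ℝ (Fin 3)

/-- Distance from `x` to the vertical (third-coordinate) axis. -/
def rc (x : E3) : ℝ := Real.sqrt (x 0 ^ 2 + x 1 ^ 2)

/-- Vertical coordinate of `x`. -/
def zc (x : E3) : ℝ := x 2

/-- The point of `ℝ³` with coordinates `(a, b, c)`. -/
def mk3 (a b c : ℝ) : E3 := (WithLp.equiv 2 (Fin 3 → ℝ)).symm ![a, b, c]

/-- The azimuthal unit vector `e_θ(x)` (equal to `0` on the axis `{r_x = 0}`). -/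
def eTheta (x : E3) : E3 := mk3 (-(x 1) / rc x) (x 0 / rc x) 0

/-- A function on `ℝ³` is axisymmetric if it depends only on `(r_x, z_x)`. -/
def Axisym (f : E3 → ℝ) : Prop :=
  ∀ x y : E3, rc x = rc y → zc x = zc y → f x = f y

/-- Cross product of two vectors of `ℝ³`. -/
def cross3 (a b : E3) : E3 :=
  mk3 (a 1 * b 2 - a 2 * b 1) (a 2 * b 0 - a 0 * b 2) (a 0 * b 1 - a 1 * b 0)

/-- The Biot–Savart velocity of a bounded compactly supported axisymmetric scalar
vorticity `ω`:  `u(x) = (1/(4π)) ∫ (ω(y) e_θ(y)) × (x - y) |x - y|⁻³ dy`. -/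
def biotSavart (ω : E3 → ℝ) (x : E3) : E3 :=
  (1 / (4 * π)) • ∫ y : E3, (‖x - y‖ ^ (-(3 : ℝ))) • cross3 (ω y • eTheta y) (x - y)

/-- The Lorentz `L^{3,q}` quasinorm, via the layer-cake formula
`‖f‖_{L^{3,q}}^q = 3 ∫_0^∞ λ^{q-1} (vol {|f| > λ})^{q/3} dλ`. -/
def lorentz3q (q : ℝ) (f : E3 → ℝ) : ℝ≥0∞ :=
  (3 * ∫⁻ l in Ioi (0 : ℝ),
      ENNReal.ofReal (l ^ (q - 1)) * (volume {x : E3 | l < |f x|}) ^ (q / 3)) ^ (1 / q)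

/-- Smooth functions. -/
abbrev Sm {E F : Type*} [NormedAddCommGroup E] [NormedSpace ℝ E] [NormedAddCommGroup F]
    [NormedSpace ℝ F] (f : E → F) : Prop := ContDiff ℝ ((⊤ : ℕ∞) : WithTop ℕ∞) f

abbrev PP : Type := ℝ × E3

section Shortcuts
local instance : ContinuousSMul ℝ E3 := inferInstance
local instance : T2Space E3 := inferInstance
local instance : CompleteSpace E3 := inferInstance
local instance : ContinuousAdd E3 := inferInstance
local instance : IsTopologicalAddGroup E3 := inferInstance
local instance : ContinuousSMul ℝ PP := inferInstance
local instance : T2Space PP := inferInstance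
local instance : CompleteSpace PP := inferInstance
local instance : ContinuousAdd PP := inferInstance
local instance : IsTopologicalAddGroup PP := inferInstance
local instance : ContinuousSMul ℝ (E3 →L[ℝ] E3) := inferInstance
local instance : T2Space (E3 →L[ℝ] E3) := inferInstance
local instance : CompleteSpace (E3 →L[ℝ] E3) := inferInstance
local instance : ContinuousAdd (E3 →L[ℝ] E3) := inferInstance
local instance : IsTopologicalAddGroup (E3 →L[ℝ] E3) := inferInstance
local instance : ContinuousSMul ℝ (PP →L[ℝ] ℝ) := inferInstance
local instance : T2Space (PP →L[ℝ] ℝ) := inferInstance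
local instance : CompleteSpace (PP →L[ℝ] ℝ) := inferInstance
local instance : ContinuousAdd (PP →L[ℝ] ℝ) := inferInstance
local instance : IsTopologicalAddGroup (PP →L[ℝ] ℝ) := inferInstance
local instance : ContinuousSMul ℝ (PP →L[ℝ] E3) := inferInstance
local instance : T2Space (PP →L[ℝ] E3) := inferInstance
local instance : CompleteSpace (PP →L[ℝ] E3) := inferInstance
local instance : ContinuousAdd (PP →L[ℝ] E3) := inferInstance
local instance : IsTopologicalAddGroup (PP →L[ℝ] E3) := inferInstance
local instance : ContinuousSMul ℝ (E3 →L[ℝ] ℝ) := inferInstance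
local instance : T2Space (E3 →L[ℝ] ℝ) := inferInstance
local instance : CompleteSpace (E3 →L[ℝ] ℝ) := inferInstance
local instance : ContinuousAdd (E3 →L[ℝ] ℝ) := inferInstance
local instance : IsTopologicalAddGroup (E3 →L[ℝ] ℝ) := inferInstance

/-- bounded on time slabs -/
def LB {F : Type*} [NormedAddCommGroup F] (f : PP → F) : Prop :=
  ∀ T : ℝ, ∃ C : ℝ, ∀ p : PP, |p.1| ≤ T → ‖f p‖ ≤ C

structure Fld (U : PP → E3) : Prop where
  sm : Sm U
  bd : LB U
  bd1 : LB (fun p => fderiv ℝ U p)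

theorem Sm.diff {E F : Type*} [NormedAddCommGroup E] [NormedSpace ℝ E] [NormedAddCommGroup F]
    [NormedSpace ℝ F] {f : E → F} (h : Sm f) : Differentiable ℝ f :=
  ContDiff.differentiable h (by simp)

theorem Sm.fderiv {E F : Type*} [NormedAddCommGroup E] [NormedSpace ℝ E] [NormedAddCommGroup F]
    [NormedSpace ℝ F] {f : E → F} (h : Sm f) : Sm (fderiv ℝ f) :=
  ContDiff.fderiv_right (m := ((⊤ : ℕ∞) : WithTop ℕ∞)) h (by exact_mod_cast le_top)

theorem Fld.lip {U : PP → E3} (h : Fld U) (T : ℝ) : ∃ K : NNReal, ∀ t, |t| ≤ T →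
    LipschitzWith K (fun x => U (t, x)) := by
  obtain ⟨C, hC⟩ := h.bd1 T
  refine ⟨C.toNNReal, fun t ht => ?_⟩
  refine lipschitzWith_of_nnnorm_fderiv_le (𝕜 := ℝ)
    (h.sm.diff.comp (differentiable_const _ |>.prodMk differentiable_id)) (fun x => ?_)
  have h1 : HasFDerivAt (fun x => U (t, x)) ((fderiv ℝ U (t, x)).comp (.inr ℝ ℝ E3)) x :=
    (h.sm.diff (t, x)).hasFDerivAt.comp x (hasFDerivAt_prodMk_right t x)
  rw [h1.fderiv, ← NNReal.coe_le_coe, coe_nnnorm, Real.coe_toNNReal']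
  refine le_max_of_le_left (le_trans (ContinuousLinearMap.opNorm_comp_le _ _) ?_)
  calc _ ≤ ‖fderiv ℝ U (t, x)‖ * 1 := by
        gcongr; exact ContinuousLinearMap.norm_inr_le_one ℝ ℝ E3
    _ ≤ C := by simpa using hC (t, x) ht

/-- characteristics -/
def IsChar (U : PP → E3) (T : ℝ) (γ : ℝ → E3) : Prop :=
  ∀ s ∈ Ioo (-T) T, HasDerivAt γ (U (s, γ s)) s

theorem exists_char {U : PP → E3} (h : Fld U) {T t0 : ℝ} (ht : |t0| < T) (x0 : E3) :
    ∃ γ : ℝ → E3, γ t0 = x0 ∧ IsChar U T γ := by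
  obtain ⟨K, hK⟩ := h.lip T
  obtain ⟨C, hC⟩ := h.bd T
  have h0 := abs_lt.1 ht
  set L : NNReal := C.toNNReal
  have hL : ∀ t x, |t| ≤ T → ‖U (t, x)‖ ≤ L := fun t x htt =>
    le_trans (hC (t, x) htt) (Real.le_coe_toNNReal C)
  have hP : IsPicardLindelof (fun t x => U (t, x)) (tmin := -T) (tmax := T)
      ⟨t0, h0.1.le, h0.2.le⟩ x0 (L * (2 * T).toNNReal) 0 L K :=
    { lipschitzOnWith := fun t ht => (hK t (abs_le.2 ht)).lipschitzOnWith
      continuousOn := fun x _ => (h.sm.continuous.comp (by fun_prop)).continuousOn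
      norm_le := fun t ht x _ => hL t x (abs_le.2 ht)
      mul_max_le := by
        simp only [NNReal.coe_zero, sub_zero, NNReal.coe_mul]
        refine mul_le_mul_of_nonneg_left ?_ L.2
        refine le_trans (max_le ?_ ?_) (Real.le_coe_toNNReal _) <;> linarith }
  obtain ⟨γ, h1, h2⟩ := hP.exists_eq_forall_mem_Icc_hasDerivWithinAt₀
  exact ⟨γ, h1, fun s hs => (h2 s (Ioo_subset_Icc_self hs)).hasDerivAt (Icc_mem_nhds hs.1 hs.2)⟩

theorem char_unique {U : PP → E3} (h : Fld U) {T t0 : ℝ} (ht : |t0| < T) {γ η : ℝ → E3}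
    (h1 : IsChar U T γ) (h2 : IsChar U T η) (h0 : γ t0 = η t0) : EqOn γ η (Ioo (-T) T) := by
  obtain ⟨K, hK⟩ := h.lip T
  exact ODE_solution_unique_of_mem_Ioo (v := fun t x => U (t, x)) (s := fun _ => univ) (K := K)
    (fun t ht => (hK t (abs_le.2 ⟨ht.1.le, ht.2.le⟩)).lipschitzOnWith) (abs_lt.1 ht)
    (fun t ht => ⟨h1 t ht, trivial⟩) (fun t ht => ⟨h2 t ht, trivial⟩) h0

section
variable {F : Type*} [NormedAddCommGroup F] [NormedSpace ℝ F]

theorem char_deriv {U : PP → E3} {f : PP → F} {T : ℝ} {γ : ℝ → E3} (hγ : IsChar U T γ)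
    {s : ℝ} (hs : s ∈ Ioo (-T) T) (hf : DifferentiableAt ℝ f (s, γ s)) :
    HasDerivAt (fun s => f (s, γ s)) (fderiv ℝ f (s, γ s) (1, U (s, γ s))) s :=
  hf.hasFDerivAt.comp_hasDerivAt s ((hasDerivAt_id s).prodMk (hγ s hs))

/-- barrier along characteristics -/
theorem TE {U : PP → E3} (h : Fld U) {f : PP → F} (hf : Differentiable ℝ f) {T : ℝ}
    {B B' : ℝ → ℝ} (h0 : ∀ x, ‖f (0, x)‖ ≤ B 0) (hB : ∀ t, HasDerivAt B (B' t) t)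
    (hb : ∀ t x, 0 ≤ t → t < T → ‖f (t, x)‖ = B t → ‖fderiv ℝ f (t, x) (1, U (t, x))‖ < B' t)
    {t : ℝ} (ht0 : 0 ≤ t) (ht : t ≤ T) (x : E3) : ‖f (t, x)‖ ≤ B t := by
  obtain ⟨γ, h1, h2⟩ := exists_char h (T := t + 1) (t0 := t) (by rw [abs_of_nonneg ht0]; linarith) x
  have hm : ∀ s, 0 ≤ s → s ≤ t → s ∈ Ioo (-(t + 1)) (t + 1) := fun s a b =>
    ⟨by linarith, by linarith⟩
  have key := image_norm_le_of_norm_deriv_right_lt_deriv_boundary' (f := fun s => f (s, γ s))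
    (a := 0) (b := t) (f' := fun s => fderiv ℝ f (s, γ s) (1, U (s, γ s))) (B := B) (B' := B')
    (fun s hs => (char_deriv h2 (hm s hs.1 hs.2) (hf _)).continuousAt.continuousWithinAt)
    (fun s hs => (char_deriv h2 (hm s hs.1 hs.2.le) (hf _)).hasDerivWithinAt)
    (h0 _) (fun s _ => (hB s).continuousAt.continuousWithinAt)
    (fun s _ => (hB s).hasDerivWithinAt)
    (fun s hs he => hb s _ hs.1 (lt_of_lt_of_le hs.2 ht) he) (right_mem_Icc.2 ht0)
  simpa [h1] using key

/-- transported functions bounded by initial bound -/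
theorem TE_zero {U : PP → E3} (h : Fld U) {f : PP → F} (hf : Differentiable ℝ f) 
    (hb : ∀ t x, 0 ≤ t → fderiv ℝ f (t, x) (1, U (t, x)) = 0) {γ : ℝ → E3} {T : ℝ}
    (h2 : IsChar U T γ) {t : ℝ} (ht0 : 0 ≤ t) (ht : t < T) : f (t, γ t) = f (0, γ 0) := by
  have hm : ∀ s, 0 ≤ s → s ≤ t → s ∈ Ioo (-T) T := fun s a b =>
    ⟨by linarith, by linarith⟩
  refine constant_of_derivWithin_zero (f := fun s => f (s, γ s)) (a := 0) (b := t)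
    (fun s hs => (char_deriv h2 (hm s hs.1 hs.2) (hf _)).differentiableAt.differentiableWithinAt)
    (fun s hs => ?_) t (right_mem_Icc.2 ht0)
  have := (char_deriv h2 (hm s hs.1 hs.2.le) (hf _))
  rw [hb _ _ hs.1] at this
  exact this.hasDerivWithinAt.derivWithin (uniqueDiffOn_Icc (by linarith [hs.1, hs.2]) s
    ⟨hs.1, hs.2.le⟩)
end

section Nem
open ContinuousMap
variable {X : Type} [TopologicalSpace X] [CompactSpace X]
variable {E F : Type} [NormedAddCommGroup E] [NormedSpace ℝ E] [NormedAddCommGroup F]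
  [NormedSpace ℝ F]

def Nem (f : E → F) (hf : Continuous f) (γ : C(X, E)) : C(X, F) := (⟨f, hf⟩ : C(E, F)).comp γ

def evB : C(X, E →L[ℝ] F) →L[ℝ] C(X, E) →L[ℝ] C(X, F) :=
  LinearMap.mkContinuous₂ (LinearMap.mk₂ ℝ
    (fun (Φ : C(X, E →L[ℝ] F)) (h : C(X, E)) => (⟨fun s => Φ s (h s), by fun_prop⟩ : C(X, F)))
    (by intros; ext; simp) (by intros; ext; simp) (by intros; ext; simp) (by intros; ext; simp)) 1
    (by
      intro Φ h
      rw [one_mul]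
      refine (ContinuousMap.norm_le _ (by positivity)).2 fun s => ?_
      exact (ContinuousLinearMap.le_opNorm _ _).trans
        (mul_le_mul (Φ.norm_coe_le_norm s) (h.norm_coe_le_norm s) (norm_nonneg _) (norm_nonneg Φ)))

theorem Nem_hasFDerivAt {f : E → F} (hf : Sm f) (γ : C(X, E)) :
    HasFDerivAt (Nem f hf.continuous) (evB (Nem (fderiv ℝ f) hf.fderiv.continuous γ)) γ := by
  rw [hasFDerivAt_iff_isLittleO_nhds_zero, Asymptotics.isLittleO_iff]
  intro ε hε
  have hc : Continuous (Nem (X := X) (fderiv ℝ f) hf.fderiv.continuous) :=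
    ContinuousMap.continuous_postcomp _
  obtain ⟨δ, hδ, hd⟩ := Metric.continuousAt_iff.1 (hc.continuousAt (x := γ)) ε hε
  filter_upwards [Metric.ball_mem_nhds (0 : C(X, E)) hδ] with h hh
  refine (ContinuousMap.norm_le _ (by positivity)).2 fun s => ?_
  have hb : ∀ y ∈ Metric.ball (γ s) δ, ‖fderiv ℝ f y - fderiv ℝ f (γ s)‖ ≤ ε := by
    intro y hy
    have h1 : dist (γ + const X (y - γ s)) γ < δ := by
      rw [dist_eq_norm, add_sub_cancel_left]
      refine lt_of_le_of_lt (?_ : _ ≤ ‖y - γ s‖) (by rwa [← dist_eq_norm])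
      exact (ContinuousMap.norm_le _ (norm_nonneg _)).2 fun s => le_rfl
    have h2 := (hd h1).le
    rw [dist_eq_norm] at h2
    have h3 := (ContinuousMap.norm_coe_le_norm _ s).trans h2
    simpa [Nem] using h3
  have hhs : ‖h s‖ < δ := lt_of_le_of_lt (h.norm_coe_le_norm s) (by simpa using hh)
  have := (convex_ball (γ s) δ).norm_image_sub_le_of_norm_fderiv_le' (𝕜 := ℝ)
    (φ := fderiv ℝ f (γ s)) (f := f) (fun y _ => hf.diff y) hb
    (Metric.mem_ball_self hδ) (y := γ s + h s) (by simpa [dist_eq_norm] using hhs)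
  simp only [add_sub_cancel_left] at this
  exact this.trans (by gcongr; exact h.norm_coe_le_norm s)

theorem Nem_contDiff_nat (n : ℕ) : ∀ {F : Type} [NormedAddCommGroup F] [NormedSpace ℝ F] {f : E → F}
    (hf : Sm f), ContDiff ℝ n (Nem (X := X) f hf.continuous) := by
  induction n with
  | zero => 
    intro F _ _ f hf
    exact contDiff_zero.2 (ContinuousMap.continuous_postcomp _)
  | succ n ih =>
    intro F _ _ f hf
    refine (contDiff_succ_iff_hasFDerivAt (n := n)).2
      ⟨fun γ => evB (Nem (fderiv ℝ f) hf.fderiv.continuous γ), ?_, Nem_hasFDerivAt hf⟩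
    exact evB.contDiff.comp (ih hf.fderiv)

theorem Nem_contDiff {f : E → F} (hf : Sm f) : Sm (Nem (X := X) f hf.continuous) :=
  contDiff_infty.2 fun n => Nem_contDiff_nat n hf
end Nem

abbrev CI := C(unitInterval, E3)

def cext {F : Type} [TopologicalSpace F] (h : C(unitInterval, F)) (s : ℝ) : F :=
  h (projIcc 0 1 zero_le_one s)

theorem cext_cont {F : Type} [TopologicalSpace F] (h : C(unitInterval, F)) : Continuous (cext h) :=
  h.continuous.comp continuous_projIcc

theorem cext_of_mem {F : Type} [TopologicalSpace F] (h : C(unitInterval, F)) (s : unitInterval) :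
    cext h s = h s := by
  unfold cext; rw [projIcc_val]

def Iop : CI →L[ℝ] CI :=
  LinearMap.mkContinuous
    { toFun := fun h => ⟨fun s => ∫ σ in (s : ℝ)..1, cext h σ, by
        simp_rw [intervalIntegral.integral_symm 1]
        have := intervalIntegral.continuous_primitive (μ := volume) (f := cext h)
          (fun a b => (cext_cont h).intervalIntegrable a b) 1
        exact (this.comp continuous_subtype_val).neg⟩
      map_add' := fun h k => by
        ext1 s
        exact intervalIntegral.integral_add ((cext_cont h).intervalIntegrable _ _)
          ((cext_cont k).intervalIntegrable _ _)
      map_smul' := fun c h => by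
        ext1 s
        exact intervalIntegral.integral_smul c (cext h) } 1 (by
    intro h
    rw [one_mul]
    refine (ContinuousMap.norm_le _ (by positivity)).2 fun s => ?_
    have := intervalIntegral.norm_integral_le_of_norm_le_const (a := (s : ℝ)) (b := 1)
      (f := cext h) (C := ‖h‖) (fun x _ => h.norm_coe_le_norm _)
    refine this.trans (mul_le_of_le_one_right (norm_nonneg _) ?_)
    have := s.2.1
    have := s.2.2
    rw [abs_of_nonneg] <;> linarith)

theorem Iop_apply (h : CI) (s : unitInterval) : Iop h s = ∫ σ in (s : ℝ)..1, cext h σ := rfl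

theorem unit_of_pow {R : Type*} [NormedRing R] [CompleteSpace R] (W : R) (n : ℕ) (hn : ‖W ^ n‖ < 1) :
    IsUnit (1 + W) := by
  have h1 : IsUnit (1 - (-W) ^ n) := by
    refine isUnit_one_sub_of_norm_lt_one ?_
    rw [neg_pow]; rcases neg_one_pow_eq_or R n with h | h <;> rw [h] <;> simpa using hn
  have h2 : (1 - (-W) ^ n) = (1 - (-W)) * ∑ i ∈ Finset.range n, (-W) ^ i := by
    rw [mul_neg_geom_sum]
  have hcm : Commute (1 - (-W)) (∑ i ∈ Finset.range n, (-W) ^ i) := by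
    refine Commute.sum_right _ _ _ fun i _ => ?_
    exact Commute.pow_right (Commute.sub_left (Commute.one_left _) (Commute.refl _)) i
  rw [h2] at h1
  have := (hcm.isUnit_mul_iff.1 h1).1
  simpa using this

theorem Volterra (A : C(unitInterval, E3 →L[ℝ] E3)) (t : ℝ) :
    IsUnit (1 + t • (Iop.comp (evB A)) : CI →L[ℝ] CI) := by
  set W : CI →L[ℝ] CI := t • (Iop.comp (evB A)) with hW
  set c := |t| * ‖A‖
  have hc : 0 ≤ c := by positivity
  have key : ∀ n : ℕ, ∀ h : CI, ∀ s : unitInterval,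
      ‖(W ^ n) h s‖ ≤ ‖h‖ * (c ^ n * ((1 - s) ^ n / n.factorial)) := by
    intro n h
    induction n with
    | zero => intro s; simpa using h.norm_coe_le_norm s
    | succ n ih =>
      intro s
      have h01 := s.2.1
      have h02 := s.2.2
      rw [pow_succ', mul_apply_eq_comp]
      have e1 : W ((W ^ n) h) s = t • ∫ σ in (s : ℝ)..1, cext (evB A ((W ^ n) h)) σ := rfl
      rw [e1, norm_smul]
      have h1 : ‖∫ σ in (s : ℝ)..1, cext (evB A ((W ^ n) h)) σ‖ ≤
          ∫ σ in (s : ℝ)..1, ‖A‖ * ‖h‖ * c ^ n / n.factorial * (1 - σ) ^ n := by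
        refine intervalIntegral.norm_integral_le_of_norm_le h02 ?_
          (Continuous.intervalIntegrable (by fun_prop) _ _)
        filter_upwards with σ hσ
        have hσ' : σ ∈ Icc (0 : ℝ) 1 := ⟨by linarith [hσ.1], hσ.2⟩
        have e2 : cext (evB A ((W ^ n) h)) σ = A ⟨σ, hσ'⟩ ((W ^ n) h ⟨σ, hσ'⟩) := by
          unfold cext; rw [projIcc_of_mem _ hσ']; rfl
        rw [e2]
        refine (ContinuousLinearMap.le_opNorm _ _).trans ?_
        calc _ ≤ ‖A‖ * (‖h‖ * (c ^ n * ((1 - σ) ^ n / n.factorial))) :=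
              mul_le_mul (A.norm_coe_le_norm _) (ih ⟨σ, hσ'⟩) (norm_nonneg _) (norm_nonneg A)
          _ = _ := by ring
      have h2 : ∫ σ in (s : ℝ)..1, (1 - σ) ^ n = (1 - s) ^ (n + 1) / (n + 1) := by
        have := intervalIntegral.integral_comp_sub_left (fun x : ℝ => x ^ n) (a := (s : ℝ)) (b := 1) 1
        rw [this, integral_pow]; simp
      rw [intervalIntegral.integral_const_mul, h2] at h1
      calc _ ≤ |t| * _ := mul_le_mul_of_nonneg_left h1 (abs_nonneg t)
        _ = _ := by rw [Nat.factorial_succ]; push_cast; field_simp; simp only [c]; ring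
  have hn : ∃ n : ℕ, ‖W ^ n‖ < 1 := by
    have := (FloorSemiring.tendsto_pow_div_factorial_atTop c).eventually (gt_mem_nhds (zero_lt_one' ℝ))
    obtain ⟨n, hn⟩ := this.exists
    refine ⟨n, lt_of_le_of_lt (ContinuousLinearMap.opNorm_le_bound _ (by positivity) fun h => ?_) hn⟩
    refine (ContinuousMap.norm_le _ (by positivity)).2 fun s => (key n h s).trans ?_
    have h01 := s.2.1
    have h02 := s.2.2
    have : (1 - (s : ℝ)) ^ n ≤ 1 := pow_le_one₀ (by linarith) (by linarith)
    calc ‖h‖ * (c ^ n * ((1 - s) ^ n / n.factorial)) ≤ ‖h‖ * (c ^ n * (1 / n.factorial)) := by gcongr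
      _ = _ := by ring
  obtain ⟨n, hn⟩ := hn
  exact unit_of_pow W n hn

section Flow
variable {U : PP → E3}

/-- the curve `σ ↦ (tσ, γ σ)` -/
def tcurve (t : ℝ) (γ : CI) : C(unitInterval, PP) :=
  ⟨fun σ => (t * σ, γ σ), by fun_prop⟩

theorem tcurve_sm : Sm (fun q : PP × CI => tcurve q.1.1 q.2) := by
  have : (fun q : PP × CI => tcurve q.1.1 q.2) = fun q : PP × CI =>
      q.1.1 • (⟨fun σ => ((σ : ℝ), (0 : E3)), by fun_prop⟩ : C(unitInterval, PP)) +
        (ContinuousLinearMap.inr ℝ ℝ E3).compLeftContinuous ℝ unitInterval q.2 := by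
    funext q; ext1 σ; simp [tcurve]
  rw [this]
  refine ContDiff.add (ContDiff.smul (contDiff_fst.comp contDiff_fst) contDiff_const) ?_
  exact (ContinuousLinearMap.contDiff _).comp contDiff_snd

def Gf (h : Fld U) (q : PP × CI) : CI :=
  q.2 - ContinuousMap.const _ q.1.2 + q.1.1 • Iop (Nem U h.sm.continuous (tcurve q.1.1 q.2))

theorem Gf_sm (h : Fld U) : Sm (Gf h) := by
  unfold Gf
  refine ContDiff.add (ContDiff.sub contDiff_snd ?_) (ContDiff.smul (contDiff_fst.comp contDiff_fst) ?_)
  · have := (ContinuousLinearMap.contDiff (n := ((⊤ : ℕ∞) : WithTop ℕ∞)) (𝕜 := ℝ)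
      (E := E3) (F := CI) (ContinuousLinearMap.const ℝ unitInterval))
    exact this.comp (contDiff_snd.comp contDiff_fst)
  · exact Iop.contDiff.comp ((Nem_contDiff h.sm).comp tcurve_sm)

theorem Gf_fderiv (h : Fld U) (q : PP × CI) : ∃ A : C(unitInterval, E3 →L[ℝ] E3),
    (fderiv ℝ (Gf h) q).comp (.inr ℝ PP CI) = 1 + q.1.1 • (Iop.comp (evB A)) := by
  let A : C(unitInterval, E3 →L[ℝ] E3) :=
    ⟨fun σ => (fderiv ℝ U (q.1.1 * σ, q.2 σ)).comp (.inr ℝ ℝ E3),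
      by have := h.sm.fderiv.continuous; fun_prop⟩
  refine ⟨A, ?_⟩
  have h1 : HasFDerivAt (fun γ => Gf h (q.1, γ)) ((fderiv ℝ (Gf h) q).comp (.inr ℝ PP CI)) q.2 :=
    HasFDerivAt.comp (g := Gf h) (f := fun γ : CI => (q.1, γ)) q.2 ((Gf_sm h).diff q).hasFDerivAt
      (hasFDerivAt_prodMk_right q.1 q.2)
  have h2 : HasFDerivAt (fun γ => Gf h (q.1, γ)) (1 + q.1.1 • (Iop.comp (evB A))) q.2 := by
    unfold Gf
    have e0 : ∀ γ : CI, tcurve q.1.1 γ = tcurve q.1.1 0 +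
        (ContinuousLinearMap.inr ℝ ℝ E3).compLeftContinuous ℝ unitInterval γ := by
      intro γ; ext1 σ; simp [tcurve]
    have h3 : HasFDerivAt (fun γ : CI => tcurve q.1.1 γ)
        ((ContinuousLinearMap.inr ℝ ℝ E3).compLeftContinuous ℝ unitInterval) q.2 := by
      rw [funext e0]
      exact (ContinuousLinearMap.hasFDerivAt _).const_add _
    have h4 := (Nem_hasFDerivAt (X := unitInterval) h.sm (tcurve q.1.1 q.2)).comp q.2 h3
    have h5 := ((hasFDerivAt_id q.2).sub_const (ContinuousMap.const _ q.1.2)).add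
      ((Iop.hasFDerivAt.comp q.2 h4).const_smul q.1.1)
    refine h5.congr_fderiv ?_
    rfl
  exact h1.unique h2

theorem Gf_zero_of_char (h : Fld U) {t T : ℝ} (ht : |t| < T) {c : ℝ → E3} (hc : IsChar U T c) 
    (γ : CI) (hγ : ∀ s, γ s = c (t * s)) : Gf h ((t, c t), γ) = 0 := by
  have hm : ∀ s ∈ Icc (0 : ℝ) 1, t * s ∈ Ioo (-T) T := fun s hs => by
    refine abs_lt.1 (lt_of_le_of_lt ?_ ht)
    rw [abs_mul, abs_of_nonneg hs.1]
    exact mul_le_of_le_one_right (abs_nonneg t) hs.2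
  ext1 s
  have h1 : ∫ σ in (s : ℝ)..1, t • U (t * σ, c (t * σ)) = c (t * 1) - c (t * s) := by
    have hu : uIcc (s : ℝ) 1 ⊆ Icc 0 1 := by
      rw [uIcc_of_le s.2.2]; exact Icc_subset_Icc_left s.2.1
    have hd : ∀ σ ∈ uIcc (s : ℝ) 1, HasDerivAt (fun σ => c (t * σ)) (t • U (t * σ, c (t * σ))) σ :=
      fun σ hσ => by
        have := HasDerivAt.scomp σ (hc (t * σ) (hm σ (hu hσ))) ((hasDerivAt_id σ).const_mul t)
        simpa using! this
    refine intervalIntegral.integral_eq_sub_of_hasDerivAt hd (ContinuousOn.intervalIntegrable ?_)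
    have h5 : ContinuousOn (fun σ => c (t * σ)) (uIcc (s : ℝ) 1) :=
      fun σ hσ => (hd σ hσ).continuousAt.continuousWithinAt
    have h6 : ContinuousOn (fun σ : ℝ => t * σ) (uIcc (s : ℝ) 1) := by fun_prop
    have h4 : ContinuousOn (fun σ => U (t * σ, c (t * σ))) (uIcc (s : ℝ) 1) :=
      Continuous.comp_continuousOn (g := U) h.sm.continuous (h6.prodMk h5)
    exact h4.const_smul t
  have h2 : ∫ σ in (s : ℝ)..1, cext (Nem U h.sm.continuous (tcurve t γ)) σ =
      ∫ σ in (s : ℝ)..1, U (t * σ, c (t * σ)) := by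
    refine intervalIntegral.integral_congr fun σ hσ => ?_
    rw [uIcc_of_le s.2.2] at hσ
    have hσ' : σ ∈ Icc (0 : ℝ) 1 := ⟨s.2.1.trans hσ.1, hσ.2⟩
    simp only [cext]
    rw [projIcc_of_mem _ hσ']
    simp [Nem, tcurve, hγ]
  rw [intervalIntegral.integral_smul] at h1
  simp only [Gf, ContinuousMap.add_apply, ContinuousMap.sub_apply, ContinuousMap.smul_apply,
    ContinuousMap.const_apply, Iop_apply, h2, h1, hγ, ContinuousMap.zero_apply, mul_one]
  abel

theorem char_of_Gf_zero (h : Fld U) {t T : ℝ} (ht : |t| < T) {c : ℝ → E3} (hc : IsChar U T c) 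
    (γ : CI) (hγ : Gf h ((t, c t), γ) = 0) : γ 0 = c 0 := by
  have hm : ∀ s ∈ Icc (0 : ℝ) 1, t * s ∈ Ioo (-T) T := fun s hs => by
    refine abs_lt.1 (lt_of_le_of_lt ?_ ht)
    rw [abs_mul, abs_of_nonneg hs.1]
    exact mul_le_of_le_one_right (abs_nonneg t) hs.2
  set F := cext (Nem U h.sm.continuous (tcurve t γ)) with hF
  set g : ℝ → E3 := fun s => c t - t • ∫ σ in s..1, F σ with hg
  have hgγ : ∀ s : unitInterval, g s = γ s := by
    intro s
    have := DFunLike.congr_fun hγ s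
    simp only [Gf, ContinuousMap.add_apply, ContinuousMap.sub_apply, ContinuousMap.smul_apply,
      ContinuousMap.const_apply, Iop_apply, ContinuousMap.zero_apply] at this
    rw [hg]
    simp only
    rw [sub_add_eq_add_sub, sub_eq_zero] at this
    rw [← this]; abel
  have hgd : ∀ s, HasDerivAt g (t • F s) s := by
    intro s
    have h1 : HasDerivAt (fun s => ∫ σ in s..1, F σ) (-F s) s :=
      intervalIntegral.integral_hasDerivAt_left ((cext_cont _).intervalIntegrable _ _)
        (cext_cont _).stronglyMeasurable.stronglyMeasurableAtFilter (cext_cont _).continuousAt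
    simpa using! (h1.const_smul t).const_sub (c t)
  have hFv : ∀ s ∈ Icc (0 : ℝ) 1, F s = U (t * s, g s) := by
    intro s hs
    rw [hgγ ⟨s, hs⟩, hF]
    simp only [cext]
    rw [projIcc_of_mem _ hs]; rfl
  obtain ⟨K, hK⟩ := h.lip T
  have := ODE_solution_unique_of_mem_Icc_left (v := fun s y => t • U (t * s, y)) (s := fun _ => univ)
    (K := ‖t‖₊ * K) (a := 0) (b := 1) (f := g) (g := fun s => c (t * s))
    (fun s hs => by
      have h1 := hK (t * s) (abs_le.2 (Ioo_subset_Icc_self (hm s (Ioc_subset_Icc_self hs))))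
      exact ((lipschitzWith_smul t).comp h1).lipschitzOnWith)
    (fun s _ => (hgd s).continuousAt.continuousWithinAt)
    (fun s hs => by
      have := hgd s
      rw [hFv s (Ioc_subset_Icc_self hs)] at this
      exact this.hasDerivWithinAt) (fun _ _ => trivial)
    (fun s hs => by
      have : ContinuousAt c (t * s) := (hc (t * s) (hm s hs)).continuousAt
      exact (ContinuousAt.comp (f := fun s => t * s) this (by fun_prop)).continuousWithinAt)
    (fun s hs => by
      have := HasDerivAt.scomp s (hc (t * s) (hm s (Ioc_subset_Icc_self hs)))
        ((hasDerivAt_id s).const_mul t)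
      have h2 : HasDerivAt (fun s => c (t * s)) (t • U (t * s, c (t * s))) s := by simpa using! this
      exact h2.hasDerivWithinAt) (fun _ _ => trivial)
    (by simp [hg])
  have h0 := this (left_mem_Icc.2 zero_le_one)
  rw [← hgγ 0]
  simpa using h0

theorem exists_flow (h : Fld U) : ∃ Ψ : PP → E3, Sm Ψ ∧ (∀ x, Ψ (0, x) = x) ∧
    ∀ T c, IsChar U T c → ∀ t, |t| < T → Ψ (t, c t) = c 0 := by
  have hex : ∀ p : PP, ∃ γ : ℝ → E3, γ p.1 = p.2 ∧ IsChar U (|p.1| + 1) γ := fun p =>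
    exists_char h (by linarith) p.2
  choose c hc1 hc2 using hex
  have hch : ∀ T d, IsChar U T d → ∀ t, |t| < T → c (t, d t) 0 = d 0 := by
    intro T d hd t ht
    have hT : min T (|t| + 1) > |t| := lt_min ht (by linarith)
    have hs : ∀ T', min T (|t| + 1) ≤ T' → Ioo (-min T (|t| + 1)) (min T (|t| + 1)) ⊆ Ioo (-T') T' :=
      fun T' h => Ioo_subset_Ioo (by linarith) h
    refine char_unique h hT (fun s hs' => hc2 (t, d t) s (hs _ (min_le_right _ _) hs'))
      (fun s hs' => hd s (hs _ (min_le_left _ _) hs')) (hc1 (t, d t)) ?_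
    have := abs_nonneg t
    constructor <;> linarith
  refine ⟨fun p => c p 0, ?_, fun x => hc1 (0, x), hch⟩
  refine contDiff_iff_contDiffAt.2 fun p => ?_
  have hsub : ∀ s ∈ Icc (0 : ℝ) 1, p.1 * s ∈ Ioo (-(|p.1| + 1)) (|p.1| + 1) := fun s hs => by
    refine abs_lt.1 (lt_of_le_of_lt ?_ (lt_add_one |p.1|))
    rw [abs_mul, abs_of_nonneg hs.1]
    exact mul_le_of_le_one_right (abs_nonneg _) hs.2
  let γ0 : CI := ⟨fun s => c p (p.1 * s), by
    rw [continuous_iff_continuousAt]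
    intro s
    have : ContinuousAt (c p) (p.1 * s) := (hc2 p _ (hsub s s.2)).continuousAt
    exact ContinuousAt.comp (f := fun s : unitInterval => p.1 * (s : ℝ)) this (by fun_prop)⟩
  have hG0 : Gf h (p, γ0) = 0 := by
    have := Gf_zero_of_char h (lt_add_one |p.1|) (hc2 p) γ0 (fun s => rfl)
    rwa [hc1 p] at this
  obtain ⟨A, hA⟩ := Gf_fderiv h (p, γ0)
  have cdf := (Gf_sm h).contDiffAt (x := (p, γ0))
  have inv : ((fderiv ℝ (Gf h) (p, γ0)).comp (.inr ℝ PP CI)).IsInvertible := by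
    rw [hA]
    obtain ⟨u, hu⟩ := Volterra A p.1
    exact ⟨ContinuousLinearEquiv.ofUnit u, by rw [← hu]; rfl⟩
  have pn : ((⊤ : ℕ∞) : WithTop ℕ∞) ≠ 0 := by simp
  have h1 := cdf.contDiffAt_implicitFunction pn inv
  have h2 := cdf.eventually_apply_implicitFunction pn inv
  let ev : CI →L[ℝ] E3 := ContinuousMap.evalCLM ℝ (0 : unitInterval)
  have h3 : ContDiffAt ℝ ((⊤ : ℕ∞) : WithTop ℕ∞) (ev ∘ (cdf.implicitFunction pn inv)) p :=
    (ev.contDiff.contDiffAt).comp p h1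
  refine h3.congr_of_eventuallyEq ?_
  filter_upwards [h2] with q hq
  rw [hG0] at hq
  have hq' : Gf h ((q.1, c q q.1), cdf.implicitFunction pn inv q) = 0 := by rw [hc1 q]; exact hq
  exact (char_of_Gf_zero h (lt_add_one |q.1|) (hc2 q) _ hq').symm

theorem transport_exists (h : Fld U) {f0 : E3 → ℝ} (hf0 : Sm f0) : ∃ f : PP → ℝ, Sm f ∧
    (∀ x, f (0, x) = f0 x) ∧ ∀ p, fderiv ℝ f p (1, U p) = 0 := by
  obtain ⟨Ψ, h1, h2, h3⟩ := exists_flow h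
  refine ⟨fun p => f0 (Ψ p), hf0.comp h1, fun x => by simp only [h2], fun p => ?_⟩
  obtain ⟨γ, hγ1, hγ2⟩ := exists_char h (lt_add_one |p.1|) p.2
  have hp : p.1 ∈ Ioo (-(|p.1| + 1)) (|p.1| + 1) := abs_lt.1 (lt_add_one |p.1|)
  have hd := char_deriv hγ2 hp ((Sm.diff (hf0.comp h1)) _)
  simp only [hγ1] at hd
  have hc : HasDerivAt (fun s => f0 (Ψ (s, γ s))) 0 p.1 := by
    refine (hasDerivAt_const p.1 (f0 (γ 0))).congr_of_eventuallyEq ?_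
    filter_upwards [Ioo_mem_nhds hp.1 hp.2] with s hs
    rw [h3 _ γ hγ2 s (abs_lt.2 hs)]
  exact hd.unique hc
end Flow

theorem nle (n : ℕ) : (n : WithTop ℕ∞) ≤ ((⊤ : ℕ∞) : WithTop ℕ∞) := by
  have h : ((n : ℕ∞) : WithTop ℕ∞) ≤ ((⊤ : ℕ∞) : WithTop ℕ∞) := WithTop.coe_le_coe.2 le_top
  exact h

section Comm
variable {E F : Type*} [NormedAddCommGroup E] [NormedSpace ℝ E] [NormedAddCommGroup F]
  [NormedSpace ℝ F]

theorem Sm.itd {f : E → F} (h : Sm f) (k : ℕ) : Sm (iteratedFDeriv ℝ k f) :=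
  ContDiff.iteratedFDeriv_right (m := ((⊤ : ℕ∞) : WithTop ℕ∞)) h (by exact_mod_cast le_top)

theorem itd_dir {f : E → F} (h : Sm f) (k : ℕ) (v p : E) :
    iteratedFDeriv ℝ k (fun p => fderiv ℝ f p v) p = fderiv ℝ (iteratedFDeriv ℝ k f) p v := by
  induction k generalizing p with
  | zero =>
    ext m
    have : iteratedFDeriv ℝ 0 f = fun p => (continuousMultilinearCurryFin0 ℝ E F).symm (f p) := by
      funext p; rfl
    rw [this]
    have h2 := ((continuousMultilinearCurryFin0 ℝ E F).symm.toContinuousLinearEquiv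
      |>.toContinuousLinearMap.hasFDerivAt).comp p (h.diff p).hasFDerivAt
    have h3 : fderiv ℝ (fun p => (continuousMultilinearCurryFin0 ℝ E F).symm (f p)) p = _ := h2.fderiv
    rw [h3]
    simp
  | succ k ih =>
    have hk := h.itd k
    set g := iteratedFDeriv ℝ k f with hg
    have hs : IsSymmSndFDerivAt ℝ g p :=
      ContDiffAt.isSymmSndFDerivAt (n := ((⊤ : ℕ∞) : WithTop ℕ∞)) hk.contDiffAt (by simpa using nle 2)
    ext m
    rw [iteratedFDeriv_succ_apply_left, show iteratedFDeriv ℝ k (fun p => fderiv ℝ f p v) =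
      fun q => fderiv ℝ g q v from funext ih]
    have h1 : HasFDerivAt (fun q => fderiv ℝ g q v) ((fderiv ℝ (fderiv ℝ g) p).flip v) p := by
      have := (hk.fderiv.diff p).hasFDerivAt.clm_apply (hasFDerivAt_const v p)
      refine this.congr_fderiv ?_
      ext; simp
    rw [h1.fderiv, ContinuousLinearMap.flip_apply, hs.eq]
    have h2 : HasFDerivAt (fun q => iteratedFDeriv ℝ (k + 1) f q m)
        ((ContinuousMultilinearMap.apply ℝ (fun _ => E) F m).comp
          (fderiv ℝ (iteratedFDeriv ℝ (k + 1) f) p)) p :=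
      (ContinuousMultilinearMap.apply ℝ (fun _ => E) F m).hasFDerivAt.comp p
        ((h.itd (k + 1)).diff p).hasFDerivAt
    have h3 : HasFDerivAt (fun q => iteratedFDeriv ℝ (k + 1) f q m)
        ((ContinuousMultilinearMap.apply ℝ (fun _ => E) F (Fin.tail m)).comp
          ((fderiv ℝ (fderiv ℝ g) p).flip (m 0))) p := by
      have h4 : HasFDerivAt (fun q => fderiv ℝ g q (m 0)) ((fderiv ℝ (fderiv ℝ g) p).flip (m 0)) p := by
        have := (hk.fderiv.diff p).hasFDerivAt.clm_apply (hasFDerivAt_const (m 0) p)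
        refine this.congr_fderiv ?_
        ext; simp
      exact (ContinuousMultilinearMap.apply ℝ (fun _ => E) F (Fin.tail m)).hasFDerivAt.comp p h4
    have h5 := congrArg (fun φ => φ v) (h2.unique h3)
    simpa using h5.symm

theorem comm_est {f : PP → F} {U : PP → E3} (hf : Sm f) (hU : Sm U)
    (h : ∀ p, fderiv ℝ f p (1, U p) = 0) (k : ℕ) (p : PP) :
    ‖fderiv ℝ (iteratedFDeriv ℝ k f) p (1, U p)‖ ≤ ∑ i ∈ Finset.range k,
      (k.choose i : ℝ) * ‖iteratedFDeriv ℝ (i + 1) f p‖ * ‖iteratedFDeriv ℝ (k - i) U p‖ := by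
  rw [← itd_dir hf]
  have e : (fun q => fderiv ℝ f q (1, U p)) =
      fun q => (fderiv ℝ f q) (ContinuousLinearMap.inr ℝ ℝ E3 (U p - U q)) := by
    funext q
    have : ((1 : ℝ), U p) = (1, U q) + ContinuousLinearMap.inr ℝ ℝ E3 (U p - U q) := by simp
    rw [this, map_add, h q, zero_add]
  rw [e]
  have hg : Sm (fun q => ContinuousLinearMap.inr ℝ ℝ E3 (U p - U q)) :=
    (ContinuousLinearMap.contDiff _).comp (contDiff_const.sub hU)
  refine (norm_iteratedFDeriv_clm_apply hf.fderiv hg p (n := k) (nle k)).trans ?_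
  rw [Finset.sum_range_succ]
  have h0 : ‖iteratedFDeriv ℝ (k - k) (fun q => ContinuousLinearMap.inr ℝ ℝ E3 (U p - U q)) p‖ = 0 := by
    rw [Nat.sub_self, norm_iteratedFDeriv_zero, sub_self, map_zero, norm_zero]
  rw [h0, mul_zero, add_zero]
  refine Finset.sum_le_sum fun i hi => ?_
  rw [norm_iteratedFDeriv_fderiv]
  gcongr
  have hk : k - i ≠ 0 := by have := Finset.mem_range.1 hi; omega
  refine (ContinuousLinearMap.norm_iteratedFDeriv_comp_left (f := fun q => U p - U q) (n := k - i)
    (N := ((⊤ : ℕ∞) : WithTop ℕ∞))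
    (ContinuousLinearMap.inr ℝ ℝ E3) (contDiff_const.sub hU).contDiffAt
    (nle _)).trans ?_
  refine (mul_le_of_le_one_left (norm_nonneg _) (ContinuousLinearMap.norm_inr_le_one ℝ ℝ E3)).trans ?_
  obtain ⟨j, hj⟩ := Nat.exists_eq_succ_of_ne_zero hk
  rw [hj, ← norm_iteratedFDeriv_fderiv, ← norm_iteratedFDeriv_fderiv]
  have : fderiv ℝ (fun q => U p - U q) = -fderiv ℝ U := by
    funext q
    simp [fderiv_const_sub]
  rw [this, iteratedFDeriv_neg_apply, norm_neg]

/-- first order spatial version -/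
theorem comm_est1 {f : PP → F} {U : PP → E3} (hf : Sm f) (hU : Sm U)
    (h : ∀ p, fderiv ℝ f p (1, U p) = 0) (p : PP) :
    ‖fderiv ℝ (fun p => (fderiv ℝ f p).comp (.inr ℝ ℝ E3)) p (1, U p)‖ ≤
      ‖(fderiv ℝ f p).comp (.inr ℝ ℝ E3)‖ * ‖(fderiv ℝ U p).comp (.inr ℝ ℝ E3)‖ := by
  have h1 : HasFDerivAt (fun q => fderiv ℝ f q (1, U q)) 
      ((fderiv ℝ f p).comp ((ContinuousLinearMap.inr ℝ ℝ E3).comp (fderiv ℝ U p)) +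
        (fderiv ℝ (fderiv ℝ f) p).flip (1, U p)) p := by
    refine (hf.fderiv.diff p).hasFDerivAt.clm_apply ?_
    have := (hasFDerivAt_const (1 : ℝ) p).prodMk (hU.diff p).hasFDerivAt
    refine this.congr_fderiv ?_
    ext <;> simp
  have h2 : (fun q => fderiv ℝ f q (1, U q)) = fun _ => 0 := funext h
  rw [h2] at h1
  have h3 := h1.unique (hasFDerivAt_const 0 p)
  have h4 : HasFDerivAt (fun p => (fderiv ℝ f p).comp (.inr ℝ ℝ E3))
      (((ContinuousLinearMap.compL ℝ E3 PP F).flip (.inr ℝ ℝ E3)).comp (fderiv ℝ (fderiv ℝ f) p)) p :=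
    (((ContinuousLinearMap.compL ℝ E3 PP F).flip (.inr ℝ ℝ E3)).hasFDerivAt).comp p
      (hf.fderiv.diff p).hasFDerivAt
  rw [h4.fderiv]
  have hs : IsSymmSndFDerivAt ℝ f p :=
    ContDiffAt.isSymmSndFDerivAt (n := ((⊤ : ℕ∞) : WithTop ℕ∞)) hf.contDiffAt (by simpa using nle 2)
  have h5 : (((ContinuousLinearMap.compL ℝ E3 PP F).flip (.inr ℝ ℝ E3)).comp
      (fderiv ℝ (fderiv ℝ f) p)) (1, U p) =
      -(((fderiv ℝ f p).comp (.inr ℝ ℝ E3)).comp ((fderiv ℝ U p).comp (.inr ℝ ℝ E3))) := by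
    ext1 v
    have h6 := congrArg (fun φ => φ ((0 : ℝ), v)) h3
    simp only [add_apply, ContinuousLinearMap.comp_apply,
      ContinuousLinearMap.flip_apply, zero_apply] at h6
    rw [hs.eq] at h6
    simp only [ContinuousLinearMap.comp_apply, ContinuousLinearMap.flip_apply,
      ContinuousLinearMap.compL_apply, neg_apply,
      ContinuousLinearMap.inr_apply] at h6 ⊢
    exact eq_neg_of_add_eq_zero_right h6
  rw [h5, norm_neg]
  exact ContinuousLinearMap.opNorm_comp_le _ _
end Comm

section SmoothLimit

def UB {F : Type} [NormedAddCommGroup F] [NormedSpace ℝ F] (f : ℕ → PP → F) : Prop :=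
  ∀ (k : ℕ) (T : ℝ), ∃ C : ℝ, ∀ n (p : PP), |p.1| ≤ T → ‖iteratedFDeriv ℝ k (f n) p‖ ≤ C

def SCau {F : Type} [NormedAddCommGroup F] (f : ℕ → PP → F) : Prop :=
  ∀ (T ε : ℝ), 0 < ε → ∃ N, ∀ m ≥ N, ∀ n ≥ N, ∀ p : PP, |p.1| ≤ T → ‖f m p - f n p‖ ≤ ε

def SLim {F : Type} [NormedAddCommGroup F] (f : ℕ → PP → F) (g : PP → F) : Prop :=
  ∀ (T ε : ℝ), 0 < ε → ∃ N, ∀ n ≥ N, ∀ p : PP, |p.1| ≤ T → ‖f n p - g p‖ ≤ ε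

variable {F : Type} [NormedAddCommGroup F] [NormedSpace ℝ F]

theorem landau {f : PP → F} (hf : Sm f) {T a b h : ℝ} (h0 : 0 < h) (h1 : h ≤ 1)
    (ha : ∀ p : PP, |p.1| ≤ T + 1 → ‖f p‖ ≤ a)
    (hb : ∀ p : PP, |p.1| ≤ T + 1 → ‖iteratedFDeriv ℝ 2 f p‖ ≤ b) (p : PP) (hp : |p.1| ≤ T) :
    ‖fderiv ℝ f p‖ ≤ 2 * a / h + b * h := by
  have hsl : ∀ q ∈ Metric.closedBall p h, |q.1| ≤ T + 1 := fun q hq => by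
    have h2 : ‖q - p‖ ≤ h := by simpa [dist_eq_norm] using hq
    have h3 : |q.1 - p.1| ≤ ‖q - p‖ := norm_fst_le (q - p)
    have := abs_sub_abs_le_abs_sub q.1 p.1
    linarith
  have hb0 : 0 ≤ b := (norm_nonneg _).trans (hb p (by linarith))
  have ha0 : 0 ≤ a := (norm_nonneg _).trans (ha p (by linarith))
  have hD : ∀ q ∈ Metric.closedBall p h, ‖fderiv ℝ f q - fderiv ℝ f p‖ ≤ b * h := by
    intro q hq
    have := (convex_closedBall p h).norm_image_sub_le_of_norm_fderiv_le (𝕜 := ℝ) (f := fderiv ℝ f)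
      (C := b) (fun y _ => hf.fderiv.diff y) (fun y hy => by
        have := hb y (hsl y hy)
        rw [← norm_iteratedFDeriv_fderiv, ← norm_iteratedFDeriv_fderiv, norm_iteratedFDeriv_zero] at this
        exact this) (Metric.mem_closedBall_self h0.le) hq
    refine this.trans (by gcongr; simpa [dist_eq_norm] using hq)
  refine ContinuousLinearMap.opNorm_le_of_unit_norm (by positivity) fun v hv => ?_
  have hm : p + h • v ∈ Metric.closedBall p h := by
    simp [norm_smul, hv, abs_of_pos h0]
  have h3 := (convex_closedBall p h).norm_image_sub_le_of_norm_fderiv_le' (𝕜 := ℝ) (f := f)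
    (φ := fderiv ℝ f p) (fun y _ => hf.diff y) hD (Metric.mem_closedBall_self h0.le) hm
  rw [add_sub_cancel_left, map_smul, norm_smul, hv, Real.norm_of_nonneg h0.le] at h3
  have h4 : h * ‖fderiv ℝ f p v‖ ≤ 2 * a + b * h * (h * 1) := by
    have h5 : ‖h • fderiv ℝ f p v‖ = h * ‖fderiv ℝ f p v‖ := by
      rw [norm_smul, Real.norm_of_nonneg h0.le]
    rw [← h5]
    have e : h • fderiv ℝ f p v = f (p + h • v) - f p - (f (p + h • v) - f p - h • fderiv ℝ f p v) := by
      abel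
    rw [e]
    have h6 := ha _ (hsl _ hm)
    have h7 := ha p (by linarith)
    refine (norm_sub_le _ _).trans ?_
    have := norm_sub_le (f (p + h • v)) (f p)
    linarith
  rw [show 2 * a / h + b * h = (2 * a + b * h * (h * 1)) / h by field_simp, le_div_iff₀ h0]
  linarith

theorem UB.fderiv {f : ℕ → PP → F} (h : UB f) : UB (fun n => fderiv ℝ (f n)) := by
  intro k T
  obtain ⟨C, hC⟩ := h (k + 1) T
  exact ⟨C, fun n p hp => by rw [norm_iteratedFDeriv_fderiv]; exact hC n p hp⟩

theorem SCau.fderiv {f : ℕ → PP → F} (hs : ∀ n, Sm (f n)) (h : UB f) (hc : SCau f) :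
    SCau (fun n => fderiv ℝ (f n)) := by
  intro T ε hε
  obtain ⟨C, hC⟩ := h 2 (T + 1)
  set C' := max C 1
  have hC' : 0 < C' := lt_max_of_lt_right one_pos
  set h := min 1 (ε / (4 * C'))
  have hh0 : 0 < h := lt_min one_pos (by positivity)
  obtain ⟨N, hN⟩ := hc (T + 1) (ε * h / 4) (by positivity)
  refine ⟨N, fun m hm n hn p hp => ?_⟩
  have := landau (f := fun p => f m p - f n p) ((hs m).sub (hs n)) (T := T) (a := ε * h / 4)
    (b := 2 * C') hh0 (min_le_left _ _) (fun q hq => hN m hm n hn q hq) (fun q hq => by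
      have e := iteratedFDeriv_sub_apply (𝕜 := ℝ) (i := 2) (x := q) (f := f m) (g := f n)
        (((hs m).of_le (nle 2)).contDiffAt) (((hs n).of_le (nle 2)).contDiffAt)
      have e' : iteratedFDeriv ℝ 2 (fun p => f m p - f n p) q = _ := e
      rw [e']
      refine (norm_sub_le _ _).trans ?_
      have h1 := (hC m q hq).trans (le_max_left C 1)
      have h2 := (hC n q hq).trans (le_max_left C 1)
      linarith) p hp
  rw [fderiv_fun_sub ((hs m).diff p) ((hs n).diff p)] at this
  refine this.trans ?_
  have h1 : 2 * C' * h ≤ 2 * C' * (ε / (4 * C')) := by gcongr; exact min_le_right _ _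
  have h2 : 2 * C' * (ε / (4 * C')) = ε / 2 := by field_simp; ring
  have h3 : 2 * (ε * h / 4) / h = ε / 2 := by field_simp; ring
  rw [h3]; linarith

theorem SLim.cau {f : ℕ → PP → F} {g : PP → F} (h : SLim f g) : SCau f := by
  intro T ε hε
  obtain ⟨N, hN⟩ := h T (ε / 2) (by positivity)
  refine ⟨N, fun m hm n hn p hp => ?_⟩
  have := norm_sub_le (f m p - g p) (f n p - g p)
  rw [sub_sub_sub_cancel_right] at this
  linarith [hN m hm p hp, hN n hn p hp]

theorem SCau.lim [CompleteSpace F] {f : ℕ → PP → F} (h : SCau f) : ∃ g, SLim f g := by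
  have hp : ∀ p : PP, ∃ y, Tendsto (fun n => f n p) atTop (nhds y) := by
    intro p
    refine cauchySeq_tendsto_of_complete (Metric.cauchySeq_iff.2 fun ε hε => ?_)
    obtain ⟨N, hN⟩ := h |p.1| (ε / 2) (by positivity)
    refine ⟨N, fun m hm n hn => ?_⟩
    rw [dist_eq_norm]
    linarith [hN m hm n hn p le_rfl]
  choose g hg using hp
  refine ⟨g, fun T ε hε => ?_⟩
  obtain ⟨N, hN⟩ := h T ε hε
  refine ⟨N, fun n hn p hp => ?_⟩
  refine le_of_tendsto ((tendsto_const_nhds.sub (hg p)).norm) ?_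
  filter_upwards [eventually_ge_atTop N] with m hm
  exact hN n hn m hm p hp

theorem SLim.tendsto {f : ℕ → PP → F} {g : PP → F} (h : SLim f g) (p : PP) :
    Tendsto (fun n => f n p) atTop (nhds (g p)) := by
  refine Metric.tendsto_atTop.2 fun ε hε => ?_
  obtain ⟨N, hN⟩ := h |p.1| (ε / 2) (by positivity)
  refine ⟨N, fun n hn => ?_⟩
  rw [dist_eq_norm]
  linarith [hN n hn p le_rfl]

theorem SLim.hasFDerivAt {f : ℕ → PP → F} {g : PP → F} {g' : PP → PP →L[ℝ] F}
    (hs : ∀ n, Sm (f n)) (h : SLim f g) (h' : SLim (fun n => _root_.fderiv ℝ (f n)) g') (p : PP) :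
    HasFDerivAt g (g' p) p := by
  refine hasFDerivAt_of_tendstoLocallyUniformlyOn (s := {q : PP | |q.1| < |p.1| + 1}) (l := atTop)
    (f := f) (f' := fun n => _root_.fderiv ℝ (f n))
    (isOpen_lt (by fun_prop) (by fun_prop)) ?_ (fun n q _ => ((hs n).diff q).hasFDerivAt)
    (fun q _ => h.tendsto q) (by simp)
  refine TendstoUniformlyOn.tendstoLocallyUniformlyOn ?_
  refine Metric.tendstoUniformlyOn_iff.2 fun ε hε => ?_
  obtain ⟨N, hN⟩ := h' (|p.1| + 1) (ε / 2) (by positivity)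
  filter_upwards [eventually_ge_atTop N] with n hn q hq
  rw [dist_comm, dist_eq_norm]
  linarith [hN n hn q (le_of_lt hq)]

theorem SLim.cd (k : ℕ) : ∀ {F : Type} [NormedAddCommGroup F] [NormedSpace ℝ F] [CompleteSpace F]
    {f : ℕ → PP → F} {g : PP → F} (_ : ∀ n, Sm (f n)) (_ : UB f) (_ : SLim f g), ContDiff ℝ k g := by
  induction k with
  | zero =>
    intro F _ _ _ f g hs hu h
    obtain ⟨g', hg'⟩ := SCau.lim (SCau.fderiv hs hu h.cau)
    exact contDiff_zero.2 (continuous_iff_continuousAt.2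
      fun p => (h.hasFDerivAt hs hg' p).continuousAt)
  | succ k ih =>
    intro F _ _ _ f g hs hu h
    obtain ⟨g', hg'⟩ := SCau.lim (SCau.fderiv hs hu h.cau)
    exact (contDiff_succ_iff_hasFDerivAt (n := k)).2
      ⟨g', ih (fun n => (hs n).fderiv) hu.fderiv hg', h.hasFDerivAt hs hg'⟩

theorem SLim.sm [CompleteSpace F] {f : ℕ → PP → F} {g : PP → F} (hs : ∀ n, Sm (f n)) (hu : UB f)
    (h : SLim f g) : Sm g :=
  contDiff_infty.2 fun k => SLim.cd k hs hu h

theorem SLim.fderiv_tendsto [CompleteSpace F] {f : ℕ → PP → F} {g : PP → F} (hs : ∀ n, Sm (f n))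
    (hu : UB f) (h : SLim f g) (p : PP) :
    Tendsto (fun n => _root_.fderiv ℝ (f n) p) atTop (nhds (_root_.fderiv ℝ g p)) := by
  obtain ⟨g', hg'⟩ := SCau.lim (SCau.fderiv hs hu h.cau)
  rw [(h.hasFDerivAt hs hg' p).fderiv]
  exact hg'.tendsto p
end SmoothLimit

set_option linter.unusedSectionVars false
section Kernel

theorem mk3_0 (a b c : ℝ) : mk3 a b c 0 = a := rfl
theorem mk3_1 (a b c : ℝ) : mk3 a b c 1 = b := rfl
theorem mk3_2 (a b c : ℝ) : mk3 a b c 2 = c := rfl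

theorem ext3 {x y : E3} (h0 : x 0 = y 0) (h1 : x 1 = y 1) (h2 : x 2 = y 2) : x = y := by
  ext i; fin_cases i <;> assumption

theorem nsq (x : E3) : ‖x‖ ^ 2 = x 0 ^ 2 + x 1 ^ 2 + x 2 ^ 2 := by
  rw [EuclideanSpace.real_norm_sq_eq, Fin.sum_univ_three]

theorem cross_le (a b : E3) : ‖cross3 a b‖ ≤ ‖a‖ * ‖b‖ := by
  refine le_of_sq_le_sq ?_ (by positivity) |> fun h => h
  rw [mul_pow, nsq, nsq, nsq]
  simp only [cross3, mk3_0, mk3_1, mk3_2]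
  nlinarith [sq_nonneg (a 0 * b 0 + a 1 * b 1 + a 2 * b 2)]

def crossL : E3 →L[ℝ] E3 →L[ℝ] E3 :=
  LinearMap.mkContinuous₂ (LinearMap.mk₂ ℝ cross3
    (fun a b c => ext3 (by simp [cross3, mk3_0]; ring) (by simp [cross3, mk3_1]; ring)
      (by simp [cross3, mk3_2]; ring))
    (fun a b c => ext3 (by simp [cross3, mk3_0]; ring) (by simp [cross3, mk3_1]; ring)
      (by simp [cross3, mk3_2]; ring))
    (fun a b c => ext3 (by simp [cross3, mk3_0]; ring) (by simp [cross3, mk3_1]; ring)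
      (by simp [cross3, mk3_2]; ring))
    (fun a b c => ext3 (by simp [cross3, mk3_0]; ring) (by simp [cross3, mk3_1]; ring)
      (by simp [cross3, mk3_2]; ring))) 1 (fun a b => by simpa using cross_le a b)

theorem crossL_apply (a b : E3) : crossL a b = cross3 a b := rfl

def kk (ρ : ℝ) (z : E3) : E3 := ((‖z‖ ^ 2 + ρ ^ 2) ^ (-(3 / 2) : ℝ)) • z

/-- kernel acting on vectors -/
def BK : E3 →L[ℝ] (E3 →L[ℝ] E3) := (1 / (4 * π)) • crossL.flip

theorem BK_apply (z w : E3) : BK z w = (1 / (4 * π)) • cross3 w z := rfl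

theorem BK_le (z : E3) : ‖BK z‖ ≤ ‖z‖ := by
  refine ContinuousLinearMap.opNorm_le_bound _ (norm_nonneg _) fun w => ?_
  rw [BK_apply, norm_smul, mul_comm ‖z‖]
  refine le_trans ?_ (cross_le w z)
  have : ‖1 / (4 * π)‖ ≤ 1 := by
    rw [Real.norm_of_nonneg (by positivity), div_le_one (by positivity)]
    nlinarith [Real.pi_gt_three]
  exact mul_le_of_le_one_left (norm_nonneg _) this

theorem kk0_norm (z : E3) : ‖kk 0 z‖ = (‖z‖ ^ 2)⁻¹ := by
  rcases eq_or_ne z 0 with rfl | hz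
  · simp [kk]
  have h : 0 < ‖z‖ := norm_pos_iff.2 hz
  rw [kk, norm_smul, Real.norm_of_nonneg (by positivity)]
  rw [zero_pow two_ne_zero, add_zero, ← Real.rpow_natCast_mul h.le]
  norm_num
  field_simp

theorem kk_meas (ρ : ℝ) : Measurable (kk ρ) := by unfold kk; fun_prop


def κ : ℝ := 3 * volume.real (Metric.ball (0 : E3) 1)

theorem κ_nn : 0 ≤ κ := by unfold κ; positivity

theorem fr3 : Module.finrank ℝ E3 = 3 := by simp

theorem radial (f : ℝ → ℝ) : ∫ z : E3, f ‖z‖ = κ * ∫ s in Ioi (0 : ℝ), s ^ 2 * f s := by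
  have := integral_fun_norm_addHaar (volume : Measure E3) f
  rw [this, fr3, κ]; simp [mul_assoc]

theorem radial_int {f : ℝ → ℝ} (h : IntegrableOn (fun s => s ^ 2 * f s) (Ioi 0)) :
    Integrable (fun z : E3 => f ‖z‖) := by
  rw [integrable_fun_norm_addHaar, fr3]; simpa using h

def hh (ρ s : ℝ) : ℝ := ρ ^ 2 * (s ^ 2 * (s ^ 2 + ρ ^ 2))⁻¹

theorem hh_aux {ρ : ℝ} (hρ : 0 < ρ) : IntegrableOn (fun s => s ^ 2 * hh ρ s) (Ioi 0) ∧
    ∫ s in Ioi (0 : ℝ), s ^ 2 * hh ρ s = ρ * (π / 2) := by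
  have e : EqOn (fun s => s ^ 2 * hh ρ s) (fun s => (1 + (ρ⁻¹ * s) ^ 2)⁻¹) (Ioi 0) := by
    intro s hs
    have : 0 < s := hs
    simp only [hh]; field_simp; ring
  constructor
  · rw [integrableOn_congr_fun e measurableSet_Ioi]
    exact (integrable_inv_one_add_sq.comp_mul_left' (inv_ne_zero hρ.ne')).integrableOn
  · rw [setIntegral_congr_fun measurableSet_Ioi e,
      integral_comp_mul_left_Ioi (fun s => (1 + s ^ 2)⁻¹) 0 (inv_pos.2 hρ)]
    simp [integral_Ioi_inv_one_add_sq]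

theorem hh_int {ρ : ℝ} (hρ : 0 < ρ) : Integrable (fun z : E3 => hh ρ ‖z‖) :=
  radial_int (hh_aux hρ).1

theorem hh_val {ρ : ℝ} (hρ : 0 < ρ) : ∫ z : E3, hh ρ ‖z‖ = κ * (ρ * (π / 2)) := by
  rw [radial, (hh_aux hρ).2]

theorem hh_nn (ρ s : ℝ) : 0 ≤ hh ρ s := by unfold hh; positivity

theorem hh_split {ρ : ℝ} (hρ : 0 < ρ) (s : ℝ) :
    (s ^ 2)⁻¹ ≤ hh ρ s + (s ^ 2 + ρ ^ 2)⁻¹ := by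
  rcases eq_or_ne s 0 with rfl | hs
  · simp [hh]; positivity
  · unfold hh; apply le_of_eq; field_simp; ring

def dom (R : ℝ) (x z : E3) : ℝ := hh R ‖z‖ + (Metric.closedBall x R).indicator (fun _ => (R ^ 2)⁻¹) z

theorem dom_int {R : ℝ} (hR : 0 < R) (x : E3) : Integrable (dom R x) := by
  refine (hh_int hR).add ?_
  rw [integrable_indicator_iff Metric.isClosed_closedBall.measurableSet]
  exact integrableOn_const measure_closedBall_lt_top.ne

theorem vol_cball {R : ℝ} (hR : 0 < R) (x : E3) :
    volume.real (Metric.closedBall x R) = R ^ 3 * (κ / 3) := by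
  rw [Measure.real, Measure.addHaar_closedBall _ _ hR.le, ENNReal.toReal_mul, fr3,
    ENNReal.toReal_ofReal (by positivity), κ, Measure.real]; ring

theorem dom_val {R : ℝ} (hR : 0 < R) (x : E3) : ∫ z, dom R x z ≤ κ * 3 * R := by
  unfold dom
  rw [integral_add (hh_int hR), hh_val hR, integral_indicator Metric.isClosed_closedBall.measurableSet]
  · rw [setIntegral_const, vol_cball hR, smul_eq_mul]
    have : R ^ 3 * (κ / 3) * (R ^ 2)⁻¹ = R * κ / 3 := by field_simp
    rw [this]
    nlinarith [Real.pi_lt_d2, mul_nonneg κ_nn hR.le]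
  · rw [integrable_indicator_iff Metric.isClosed_closedBall.measurableSet]
    exact integrableOn_const measure_closedBall_lt_top.ne

theorem dom_nn (R : ℝ) (x z : E3) : 0 ≤ dom R x z :=
  add_nonneg (hh_nn _ _) (indicator_nonneg (fun _ _ => by positivity) _)

theorem dom_le {R : ℝ} (hR : 0 < R) {x z : E3} (h : ‖x - z‖ ≤ R) : (‖z‖ ^ 2)⁻¹ ≤ dom R x z := by
  refine (hh_split hR _).trans ?_
  unfold dom
  rw [indicator_of_mem (by simpa [dist_eq_norm, norm_sub_rev] using h)]
  gcongr
  nlinarith [sq_nonneg ‖z‖]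

variable {F F' : Type} [NormedAddCommGroup F] [NormedSpace ℝ F]
  [NormedAddCommGroup F'] [NormedSpace ℝ F']

theorem dom_bound {k : E3 → F' →L[ℝ] F} {c : ℝ} (hk : ∀ z, ‖k z‖ ≤ c * (‖z‖ ^ 2)⁻¹) (hc : 0 ≤ c) {R M : ℝ}
    (hR : 0 < R) {x z : E3} {w : F'} (hw : ‖w‖ ≤ M) (hw0 : R < ‖x - z‖ → w = 0) :
    ‖k z‖ * ‖w‖ ≤ c * M * dom R x z := by
  have hM : 0 ≤ M := (norm_nonneg _).trans hw
  have hd := dom_nn R x z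
  by_cases h : ‖x - z‖ ≤ R
  · have h1 : ‖k z‖ ≤ c * dom R x z := (hk z).trans (by gcongr; exact dom_le hR h)
    calc _ ≤ (c * dom R x z) * M := by gcongr
      _ = _ := by ring
  · rw [hw0 (not_le.1 h), norm_zero, mul_zero]
    positivity

/-- slab-compact support -/
def SC {F : Type} [NormedAddCommGroup F] (G : PP → F) : Prop :=
  ∀ T : ℝ, ∃ R : ℝ, 0 < R ∧ ∀ p : PP, |p.1| ≤ T → R < ‖p.2‖ → G p = 0

theorem SC.fderiv {G : PP → F} (h : SC G) : SC (fderiv ℝ G) := by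
  intro T
  obtain ⟨R, hR, h⟩ := h (T + 1)
  refine ⟨R, hR, fun p hp hp2 => ?_⟩
  have : G =ᶠ[nhds p] fun _ => 0 := by
    have h1 : ∀ᶠ q : PP in nhds p, |q.1| < T + 1 :=
      (continuous_fst.abs.tendsto p).eventually_lt_const (by linarith)
    have h2 : ∀ᶠ q : PP in nhds p, R < ‖q.2‖ :=
      (continuous_snd.norm.tendsto p).eventually_const_lt hp2
    filter_upwards [h1, h2] with q h1 h2 using h q h1.le h2
  rw [this.fderiv_eq]; simp

theorem SC.lb {G : PP → F} (h : SC G) (hc : Continuous G) : LB G := by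
  intro T
  obtain ⟨R, hR, h⟩ := h T
  obtain ⟨C, hC⟩ := ((isCompact_Icc (a := -T) (b := T)).prod
    (isCompact_closedBall (0 : E3) R)).exists_bound_of_continuousOn hc.continuousOn
  refine ⟨max C 0, fun p hp => ?_⟩
  by_cases h1 : ‖p.2‖ ≤ R
  · exact (hC p ⟨abs_le.1 hp, by simpa using h1⟩).trans (le_max_left _ _)
  · rw [h p hp (not_le.1 h1)]; simp

def Kop (k : E3 → F' →L[ℝ] F) (G : PP → F') (p : PP) : F := ∫ z, k z (G (p.1, p.2 - z))

theorem Kop_meas {k : E3 → F' →L[ℝ] F} (hk : AEStronglyMeasurable k) {g : E3 → F'} (hg : Continuous g) :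
    AEStronglyMeasurable (fun z => k z (g z)) :=
  (isBoundedBilinearMap_apply (𝕜 := ℝ) (E := F') (F := F)).continuous.comp_aestronglyMeasurable
    (hk.prodMk hg.aestronglyMeasurable)

theorem Kop_integrable {k : E3 → F' →L[ℝ] F} (hm : AEStronglyMeasurable k) {c : ℝ}
    (hk : ∀ z, ‖k z‖ ≤ c * (‖z‖ ^ 2)⁻¹) (hc : 0 ≤ c) {G : PP → F'} (hG : Continuous G) (hs : SC G) (p : PP) :
    Integrable (fun z => k z (G (p.1, p.2 - z))) := by
  obtain ⟨R, hR, h⟩ := hs |p.1|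
  obtain ⟨M, hM⟩ := hs.lb hG |p.1|
  refine ((dom_int hR p.2).const_mul (c * M)).mono' (Kop_meas hm (hG.comp (by fun_prop))) ?_
  refine ae_of_all _ fun z => ((k z).le_opNorm _).trans ?_
  exact dom_bound (M := M) (w := G (p.1, p.2 - z)) hk hc hR (hM (p.1, p.2 - z) (le_refl |p.1|))
    (h (p.1, p.2 - z) (le_refl |p.1|))

theorem Kop_le {k : E3 → F' →L[ℝ] F} {c : ℝ} (hk : ∀ z, ‖k z‖ ≤ c * (‖z‖ ^ 2)⁻¹) (hc : 0 ≤ c)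
    {G : PP → F'} {p : PP} {R M : ℝ} (hR : 0 < R) (hM : ∀ x, ‖G (p.1, x)‖ ≤ M)
    (h : ∀ x, R < ‖x‖ → G (p.1, x) = 0) : ‖Kop k G p‖ ≤ c * M * (κ * 3 * R) := by
  have hM0 := (norm_nonneg _).trans (hM 0)
  refine (norm_integral_le_of_norm_le ((dom_int hR p.2).const_mul (c * M)) (ae_of_all _ fun z =>
    ((k z).le_opNorm _).trans (dom_bound hk hc hR (hM _) (h _)))).trans ?_
  rw [integral_const_mul]
  exact mul_le_mul_of_nonneg_left (dom_val hR _) (by positivity)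

theorem compL_le {k : E3 → F' →L[ℝ] F} {c : ℝ} (hk : ∀ z, ‖k z‖ ≤ c * (‖z‖ ^ 2)⁻¹) (z : E3) :
    ‖ContinuousLinearMap.compL ℝ PP F' F (k z)‖ ≤ c * (‖z‖ ^ 2)⁻¹ :=
  (ContinuousLinearMap.opNorm_le_bound _ (norm_nonneg _)
      fun v => ContinuousLinearMap.opNorm_comp_le _ _).trans (hk z)

theorem Kop_hasFDerivAt {k : E3 → F' →L[ℝ] F} (hm : AEStronglyMeasurable k) {c : ℝ}
    (hk : ∀ z, ‖k z‖ ≤ c * (‖z‖ ^ 2)⁻¹) (hc : 0 ≤ c) {G : PP → F'} (hG : Sm G) (hs : SC G) (p : PP) :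
    HasFDerivAt (Kop k G) (Kop (fun z => ContinuousLinearMap.compL ℝ PP F' F (k z)) (fderiv ℝ G) p) p := by
  obtain ⟨R, hR, h⟩ := hs.fderiv (|p.1| + 1)
  obtain ⟨M, hM⟩ := hs.fderiv.lb hG.fderiv.continuous (|p.1| + 1)
  have hm' : AEStronglyMeasurable (fun z => ContinuousLinearMap.compL ℝ PP F' F (k z)) :=
    (ContinuousLinearMap.compL ℝ PP F' F).continuous.comp_aestronglyMeasurable hm
  refine hasFDerivAt_integral_of_dominated_of_fderiv_le (Metric.ball_mem_nhds p one_pos)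
    (F' := fun q z => ContinuousLinearMap.compL ℝ PP F' F (k z) (fderiv ℝ G (q.1, q.2 - z)))
    (bound := fun z => c * M * dom (R + 1) p.2 z) ?_ ?_ ?_ ?_ ?_ ?_
  · exact Eventually.of_forall fun q => Kop_meas hm (hG.continuous.comp (by fun_prop))
  · exact Kop_integrable hm hk hc hG.continuous hs p
  · exact Kop_meas hm' (hG.fderiv.continuous.comp (by fun_prop))
  · refine ae_of_all _ fun z q hq => ?_
    have hq1 : ‖q - p‖ < 1 := by simpa [dist_eq_norm] using hq
    have h1 : |q.1| ≤ |p.1| + 1 := by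
      have h3 : |q.1 - p.1| ≤ ‖q - p‖ := norm_fst_le (q - p)
      have := abs_sub_abs_le_abs_sub q.1 p.1
      linarith
    refine (ContinuousLinearMap.le_opNorm _ _).trans ?_
    refine dom_bound (k := fun z => ContinuousLinearMap.compL ℝ PP F' F (k z)) (R := R + 1) (x := p.2) (w := fderiv ℝ G (q.1, q.2 - z)) (compL_le hk) hc (by linarith) (hM (q.1, q.2 - z) h1) fun h2 => h (q.1, q.2 - z) h1 ?_
    have h3 : ‖q.2 - p.2‖ ≤ ‖q - p‖ := norm_snd_le (q - p)
    have h4 : ‖p.2 - z‖ ≤ ‖q.2 - z‖ + ‖q.2 - p.2‖ := by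
      rw [norm_sub_rev q.2 p.2]
      calc _ = ‖(q.2 - z) + (p.2 - q.2)‖ := by congr 1; abel
        _ ≤ _ := norm_add_le _ _
    change R < ‖q.2 - z‖
    linarith
  · exact (dom_int (by linarith) _).const_mul _
  · refine ae_of_all _ fun z q _ => ?_
    have h1 : HasFDerivAt (fun q : PP => ((q.1, q.2 - z) : PP)) (.id ℝ PP) q :=
      (hasFDerivAt_sub_const (𝕜 := ℝ) ((0, z) : PP) (x := q)).congr_of_eventuallyEq
        (Eventually.of_forall fun r => by ext <;> simp)
    have h2 := ((hG.diff (q.1, q.2 - z)).hasFDerivAt.comp q h1)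
    exact (k z).hasFDerivAt.comp q h2

theorem Kop_cd (n : ℕ) : ∀ {F F' : Type} [NormedAddCommGroup F] [NormedSpace ℝ F]
    [NormedAddCommGroup F'] [NormedSpace ℝ F'] {k : E3 → F' →L[ℝ] F} (_ : AEStronglyMeasurable k) {c : ℝ}
    (_ : ∀ z, ‖k z‖ ≤ c * (‖z‖ ^ 2)⁻¹) (_ : 0 ≤ c) {G : PP → F'} (_ : Sm G) (_ : SC G),
    ContDiff ℝ n (Kop k G) := by
  induction n with
  | zero => 
    intro F F' _ _ _ _ k hm c hk hc G hG hs
    exact contDiff_zero.2 (continuous_iff_continuousAt.2 fun p =>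
      (Kop_hasFDerivAt hm hk hc hG hs p).continuousAt)
  | succ n ih =>
    intro F F' _ _ _ _ k hm c hk hc G hG hs
    push_cast
    rw [contDiff_succ_iff_hasFDerivAt]
    refine ⟨_, ih ((ContinuousLinearMap.compL ℝ PP F' F).continuous.comp_aestronglyMeasurable hm)
      (compL_le hk) hc hG.fderiv hs.fderiv, fun p => Kop_hasFDerivAt hm hk hc hG hs p⟩

theorem Kop_sm {k : E3 → F' →L[ℝ] F} (hm : AEStronglyMeasurable k) {c : ℝ}
    (hk : ∀ z, ‖k z‖ ≤ c * (‖z‖ ^ 2)⁻¹) (hc : 0 ≤ c) {G : PP → F'} (hG : Sm G) (hs : SC G) : Sm (Kop k G) :=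
  contDiff_infty.2 fun n => Kop_cd n hm hk hc hG hs

theorem itd_supp {G : PP → F} (m : ℕ) {T R : ℝ} (hT : ∀ p : PP, |p.1| < T → R < ‖p.2‖ → G p = 0)
    (p : PP) (hp : |p.1| < T) (hp2 : R < ‖p.2‖) : iteratedFDeriv ℝ m G p = 0 := by
  have : G =ᶠ[nhds p] fun _ => 0 := by
    have h1 : ∀ᶠ q : PP in nhds p, |q.1| < T :=
      (continuous_fst.abs.tendsto p).eventually_lt_const hp
    have h2 : ∀ᶠ q : PP in nhds p, R < ‖q.2‖ :=
      (continuous_snd.norm.tendsto p).eventually_const_lt hp2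
    filter_upwards [h1, h2] with q h1 h2 using hT q h1 h2
  rw [(this.iteratedFDeriv ℝ m).eq_of_nhds]
  simp

theorem Kop_itd (m : ℕ) : ∀ {F F' : Type} [NormedAddCommGroup F] [NormedSpace ℝ F]
    [NormedAddCommGroup F'] [NormedSpace ℝ F'] {k : E3 → F' →L[ℝ] F} (_ : AEStronglyMeasurable k) {c : ℝ}
    (_ : ∀ z, ‖k z‖ ≤ c * (‖z‖ ^ 2)⁻¹) (_ : 0 ≤ c) {G : PP → F'} (_ : Sm G) (_ : SC G)
    {p : PP} {R M : ℝ} (_ : 0 < R) (_ : ∀ x, ‖iteratedFDeriv ℝ m G (p.1, x)‖ ≤ M)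
    (_ : ∀ x, R < ‖x‖ → iteratedFDeriv ℝ m G (p.1, x) = 0),
    ‖iteratedFDeriv ℝ m (Kop k G) p‖ ≤ c * M * (κ * 3 * R) := by
  induction m with
  | zero =>
    intro F F' _ _ _ _ k hm c hk hc G hG hs p R M hR hM h
    rw [norm_iteratedFDeriv_zero]
    refine Kop_le hk hc hR (fun x => by simpa using hM x) fun x hx => ?_
    have := h x hx
    rw [← norm_eq_zero, norm_iteratedFDeriv_zero, norm_eq_zero] at this
    exact this
  | succ n ih =>
    intro F F' _ _ _ _ k hm c hk hc G hG hs p R M hR hM h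
    rw [← norm_iteratedFDeriv_fderiv, show fderiv ℝ (Kop k G) = _ from
      funext fun p => (Kop_hasFDerivAt hm hk hc hG hs p).fderiv]
    refine ih ((ContinuousLinearMap.compL ℝ PP F' F).continuous.comp_aestronglyMeasurable hm)
      (compL_le hk) hc hG.fderiv hs.fderiv hR (fun x => ?_) (fun x hx => ?_)
    · rw [norm_iteratedFDeriv_fderiv]; exact hM x
    · rw [← norm_eq_zero, norm_iteratedFDeriv_fderiv, h x hx, norm_zero]

end Kernel

section Kernel2

def dkk (ρ : ℝ) (z : E3) : E3 →L[ℝ] E3 :=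
  ((‖z‖ ^ 2 + ρ ^ 2) ^ (-(3 / 2) : ℝ)) • ContinuousLinearMap.id ℝ E3 +
    ((-3) * (‖z‖ ^ 2 + ρ ^ 2) ^ (-(5 / 2) : ℝ)) • (innerSL ℝ z).smulRight z

theorem dkk_apply (ρ : ℝ) (z u : E3) : dkk ρ z u = ((‖z‖ ^ 2 + ρ ^ 2) ^ (-(3 / 2) : ℝ)) • u +
    ((-3) * (‖z‖ ^ 2 + ρ ^ 2) ^ (-(5 / 2) : ℝ)) • (inner ℝ z u • z) := by
  simp [dkk]

theorem sq_pos_aux {ρ : ℝ} (hρ : 0 < ρ) (z : E3) : 0 < ‖z‖ ^ 2 + ρ ^ 2 := by positivity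

theorem kk_hasFDerivAt {ρ : ℝ} (hρ : 0 < ρ) (z : E3) : HasFDerivAt (kk ρ) (dkk ρ z) z := by
  have h1 : HasFDerivAt (fun z : E3 => ‖z‖ ^ 2 + ρ ^ 2) (2 • (innerSL ℝ z)) z :=
    (hasStrictFDerivAt_norm_sq z).hasFDerivAt.add_const _
  have h2 := h1.rpow_const (p := (-(3 / 2) : ℝ)) (Or.inl (sq_pos_aux hρ z).ne')
  have h3 := h2.smul (hasFDerivAt_id z)
  refine h3.congr_fderiv ?_
  ext1 u
  rw [dkk_apply]
  simp
  rw [show (-(3 / 2) - 1 : ℝ) = -(5 / 2) by norm_num]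
  rw [smul_smul]; congr 1; ring

theorem dkk_le {ρ : ℝ} (hρ : 0 < ρ) (z : E3) : ‖dkk ρ z‖ ≤ 4 * (‖z‖ ^ 2 + ρ ^ 2) ^ (-(3 / 2) : ℝ) := by
  have hs := sq_pos_aux hρ z
  refine ContinuousLinearMap.opNorm_le_bound _ (by positivity) fun u => ?_
  rw [dkk_apply]
  refine (norm_add_le _ _).trans ?_
  rw [norm_smul, norm_smul, norm_smul, norm_mul, Real.norm_of_nonneg (by positivity),
    Real.norm_of_nonneg (r := (_ : ℝ) ^ (-(5 / 2) : ℝ)) (by positivity)]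
  have h1 : ‖inner ℝ z u‖ ≤ ‖z‖ * ‖u‖ := norm_inner_le_norm z u
  have h2 : (‖z‖ ^ 2 + ρ ^ 2) ^ (-(3 / 2) : ℝ) = (‖z‖ ^ 2 + ρ ^ 2) ^ (-(5 / 2) : ℝ) * (‖z‖ ^ 2 + ρ ^ 2) := by
    nth_rw 3 [← Real.rpow_one (‖z‖ ^ 2 + ρ ^ 2)]
    rw [← Real.rpow_add hs]; norm_num
  have h3 : 0 ≤ (‖z‖ ^ 2 + ρ ^ 2) ^ (-(5 / 2) : ℝ) := by positivity
  have h4 : ‖inner ℝ z u‖ * ‖z‖ ≤ (‖z‖ ^ 2 + ρ ^ 2) * ‖u‖ := by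
    have := mul_le_mul_of_nonneg_right h1 (norm_nonneg z)
    nlinarith [norm_nonneg u, sq_nonneg ρ, mul_nonneg (norm_nonneg u) (sq_nonneg ρ)]
  have h5 := mul_le_mul_of_nonneg_left h4 h3
  have e3 : ‖(-3:ℝ)‖ = 3 := by norm_num
  rw [e3, h2]
  nlinarith

theorem kk_sm {ρ : ℝ} (hρ : 0 < ρ) : Sm (kk ρ) := by
  have h1 : Sm (fun z : E3 => ‖z‖ ^ 2 + ρ ^ 2) := (contDiff_norm_sq ℝ).add contDiff_const
  exact (h1.rpow_const_of_ne fun z => (sq_pos_aux hρ z).ne').smul contDiff_id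

theorem p32 {a : ℝ} (ha : 0 ≤ a) : a ^ (-(3 / 2) : ℝ) = (√a ^ 3)⁻¹ := by
  rw [Real.rpow_neg ha, Real.sqrt_eq_rpow, ← Real.rpow_mul_natCast ha]; norm_num

theorem kk_diff {ρ : ℝ} (hρ : 0 < ρ) (z : E3) : ‖kk 0 z - kk ρ z‖ ≤ 3 * hh ρ ‖z‖ := by
  rcases eq_or_ne z 0 with rfl | hz
  · simpa [kk] using hh_nn ρ 0
  have h : 0 < ‖z‖ := norm_pos_iff.2 hz
  set s := ‖z‖
  unfold kk
  rw [← sub_smul, norm_smul, p32 (by positivity), p32 (by positivity)]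
  change |_| * s ≤ _
  rw [zero_pow two_ne_zero, add_zero, Real.sqrt_sq h.le]
  set m := √(s ^ 2 + ρ ^ 2) with hm
  have hmm : m ^ 2 = s ^ 2 + ρ ^ 2 := Real.sq_sqrt (by positivity)
  have hms : s ≤ m := Real.le_sqrt_of_sq_le (by nlinarith [sq_nonneg ρ])
  have hm0 : 0 < m := h.trans_le hms
  unfold hh
  rw [← hmm, show ρ ^ 2 = m ^ 2 - s ^ 2 by linarith]
  rw [abs_of_nonneg (by
    rw [sub_nonneg]; gcongr)]
  rw [show ((s ^ 3)⁻¹ - (m ^ 3)⁻¹) * s = (m ^ 3 - s ^ 3) / (s ^ 2 * m ^ 3) by field_simp,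
    show 3 * ((m ^ 2 - s ^ 2) * (s ^ 2 * m ^ 2)⁻¹) = (3 * (m ^ 2 - s ^ 2) * m) / (s ^ 2 * m ^ 3) by field_simp]
  gcongr
  nlinarith [mul_nonneg (sub_nonneg.2 hms) (mul_nonneg h.le hm0.le), mul_nonneg (sub_nonneg.2 hms) (sq_nonneg s),
    mul_nonneg (sub_nonneg.2 hms) (mul_nonneg hm0.le (sub_nonneg.2 hms)), mul_nonneg (sub_nonneg.2 hms) (mul_nonneg h.le (sub_nonneg.2 hms))]

theorem kk_le (ρ : ℝ) (z : E3) : ‖kk ρ z‖ ≤ 1 * (‖z‖ ^ 2)⁻¹ := by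
  rw [one_mul, ← kk0_norm]
  rcases eq_or_ne z 0 with rfl | hz
  · simp [kk]
  have h : 0 < ‖z‖ := norm_pos_iff.2 hz
  unfold kk
  rw [norm_smul, norm_smul]
  gcongr
  rw [Real.norm_of_nonneg (by positivity), Real.norm_of_nonneg (by positivity)]
  refine Real.rpow_le_rpow_of_nonpos (by positivity) ?_ (by norm_num)
  nlinarith [sq_nonneg ρ]

def BR (ρ : ℝ) (z : E3) : E3 →L[ℝ] E3 := BK (kk ρ z)

theorem BR_le (ρ : ℝ) (z : E3) : ‖BR ρ z‖ ≤ 1 * (‖z‖ ^ 2)⁻¹ := (BK_le _).trans (kk_le ρ z)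

theorem BR_meas (ρ : ℝ) : AEStronglyMeasurable (BR ρ) :=
  BK.continuous.comp_aestronglyMeasurable (kk_meas ρ).aestronglyMeasurable

theorem BR_diff {ρ : ℝ} (hρ : 0 < ρ) {G : PP → E3} (hG : Continuous G) (hs : SC G) {p : PP} {M : ℝ}
    (hM : ∀ x, ‖G (p.1, x)‖ ≤ M) : ‖Kop (BR 0) G p - Kop (BR ρ) G p‖ ≤ 3 * M * (κ * (ρ * (π / 2))) := by
  have hM0 := (norm_nonneg _).trans (hM 0)
  unfold Kop
  rw [← integral_sub (Kop_integrable (BR_meas 0) (BR_le 0) zero_le_one hG hs p)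
    (Kop_integrable (BR_meas ρ) (BR_le ρ) zero_le_one hG hs p)]
  refine (norm_integral_le_of_norm_le ((hh_int hρ).const_mul (3 * M)) (ae_of_all _ fun z => ?_)).trans ?_
  · rw [← sub_apply, BR, BR, ← map_sub]
    refine (ContinuousLinearMap.le_opNorm _ _).trans ?_
    calc _ ≤ (3 * hh ρ ‖z‖) * M := mul_le_mul ((BK_le _).trans (kk_diff hρ z)) (hM _)
          (norm_nonneg _) (by have := hh_nn ρ ‖z‖; positivity)
      _ = _ := by ring
  · rw [integral_const_mul, hh_val hρ]

theorem BR_parts {ρ : ℝ} (hρ : 0 < ρ) {G : PP → E3} (hG : Sm G) (hs : SC G) (p : PP) (u : E3) :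
    Kop (BR ρ) (fun q => fderiv ℝ G q (0, u)) p = ∫ z, BK (dkk ρ z u) (G (p.1, p.2 - z)) := by
  obtain ⟨R, hR, h⟩ := hs |p.1|
  set g : E3 → E3 := fun z => G (p.1, p.2 - z) with hg
  have hi : ∀ z, HasFDerivAt (fun z : E3 => ((p.1, p.2 - z) : PP)) (-.inr ℝ ℝ E3) z := fun z => by
    have := (hasFDerivAt_const (𝕜 := ℝ) p.1 z).prodMk ((hasFDerivAt_id (𝕜 := ℝ) z).const_sub p.2)
    refine this.congr_fderiv ?_
    ext1 v
    simp
  have hgs : Sm g := hG.comp (contDiff_const.prodMk (contDiff_const.sub contDiff_id))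
  have hgd : ∀ z u, fderiv ℝ g z u = - fderiv ℝ G (p.1, p.2 - z) (0, u) := fun z u => by
    have := (hG.diff (p.1, p.2 - z)).hasFDerivAt.comp z (hi z)
    change fderiv ℝ (G ∘ fun z => (p.1, p.2 - z)) z u = _
    rw [this.fderiv]
    simp
  have hgc : HasCompactSupport g := by
    refine HasCompactSupport.intro (isCompact_closedBall p.2 R) fun z hz => h _ le_rfl ?_
    simpa [dist_eq_norm, norm_sub_rev] using hz
  have hgc' : HasCompactSupport (fun z => fderiv ℝ g z u) := 
    (hgc.fderiv ℝ).comp_left (g := fun L : E3 →L[ℝ] E3 => L u) (by simp)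
  have hkd : ∀ z, fderiv ℝ (kk ρ) z = dkk ρ z := fun z => (kk_hasFDerivAt hρ z).fderiv
  have hbil : ∀ {a b : E3 → E3}, Continuous a → Continuous b → HasCompactSupport b →
      Integrable (fun z => BK (a z) (b z)) := fun {a b} ha hb hc =>
    ((BK.continuous.comp ha).clm_apply hb).integrable_of_hasCompactSupport
      (hc.mono' (by
        intro z hz
        by_contra h0
        apply hz
        have : b z = 0 := by
          by_contra h1; exact h0 (subset_tsupport _ h1)
        simp [this]))
  have key := integral_bilinear_fderiv_right_eq_neg_left_of_integrable (μ := (volume : Measure E3))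
    (f := kk ρ) (g := g) (v := u) (B := BK) ?_ ?_ ?_
    (fun x _ => (kk_sm hρ).diff x) (fun x _ => hgs.diff x)
  · unfold Kop
    rw [← neg_inj, ← integral_neg]
    simp only [hkd] at key
    rw [← key]
    congr 1
    funext z
    rw [hgd, map_neg]; rfl
  · exact hbil ((kk_sm hρ).fderiv.continuous.clm_apply continuous_const) hgs.continuous hgc
  · exact hbil (kk_sm hρ).continuous (hgs.fderiv.continuous.clm_apply continuous_const) hgc'
  · exact hbil (kk_sm hρ).continuous hgs.continuous hgc

def lg (R ρ : ℝ) : ℝ := log (R ^ 2 + ρ ^ 2) / 2 - log (ρ ^ 2) / 2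

theorem radial_log {R ρ : ℝ} (hR : 0 < R) (hρ : 0 < ρ) :
    Integrable (fun z : E3 => (Iio R).indicator (fun s => (s ^ 2 + ρ ^ 2) ^ (-(3 / 2) : ℝ)) ‖z‖) ∧
    ∫ z : E3, (Iio R).indicator (fun s => (s ^ 2 + ρ ^ 2) ^ (-(3 / 2) : ℝ)) ‖z‖ ≤ κ * lg R ρ := by
  have hc : Continuous (fun s : ℝ => s ^ 2 * (s ^ 2 + ρ ^ 2) ^ (-(3 / 2) : ℝ)) := by
    refine (continuous_pow 2).mul (Continuous.rpow_const (by fun_prop) fun s => Or.inl (by positivity))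
  have e : ∀ s, s ^ 2 * (Iio R).indicator (fun s => (s ^ 2 + ρ ^ 2) ^ (-(3 / 2) : ℝ)) s =
      (Iio R).indicator (fun s => s ^ 2 * (s ^ 2 + ρ ^ 2) ^ (-(3 / 2) : ℝ)) s := fun s => by
    by_cases h : s ∈ Iio R <;> simp [h]
  have hi : IntegrableOn (fun s : ℝ => s ^ 2 * (s ^ 2 + ρ ^ 2) ^ (-(3 / 2) : ℝ)) (Ioo 0 R) :=
    (hc.integrableOn_Icc (a := 0) (b := R)).mono_set Ioo_subset_Icc_self
  have hset : Iio R ∩ Ioi 0 = Ioo 0 R := by ext; simp [and_comm]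
  refine ⟨radial_int ?_, ?_⟩
  · simp_rw [e]
    rw [IntegrableOn, integrable_indicator_iff measurableSet_Iio, IntegrableOn,
      Measure.restrict_restrict measurableSet_Iio, hset]
    exact hi
  · rw [radial]
    refine mul_le_mul_of_nonneg_left ?_ κ_nn
    simp_rw [e]
    rw [integral_indicator measurableSet_Iio, Measure.restrict_restrict measurableSet_Iio, hset]
    have hd : ∀ s ∈ uIcc 0 R, HasDerivAt (fun s => log (s ^ 2 + ρ ^ 2) / 2) (s / (s ^ 2 + ρ ^ 2)) s := by
      intro s _
      have h1 : HasDerivAt (fun s : ℝ => s ^ 2 + ρ ^ 2) (2 * s) s := by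
        simpa using (hasDerivAt_pow 2 s).add_const (ρ ^ 2)
      have := (h1.log (by positivity)).div_const 2
      refine this.congr_deriv ?_
      field_simp
    have hc2 : Continuous (fun s : ℝ => s / (s ^ 2 + ρ ^ 2)) :=
      continuous_id.div (by fun_prop) fun s => by positivity
    have h3 := intervalIntegral.integral_eq_sub_of_hasDerivAt hd (hc2.intervalIntegrable _ _)
    simp only [ne_eq, OfNat.ofNat_ne_zero, not_false_eq_true, zero_pow, zero_add] at h3
    rw [lg, ← h3, intervalIntegral.integral_of_le hR.le, ← integral_Ioc_eq_integral_Ioo]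
    refine setIntegral_mono_on ((hc.integrableOn_Icc).mono_set Ioc_subset_Icc_self)
      ((hc2.integrableOn_Icc).mono_set Ioc_subset_Icc_self) measurableSet_Ioc fun s hs => ?_
    have h0 : 0 < s := hs.1
    rw [p32 (by positivity)]
    set m := √(s ^ 2 + ρ ^ 2) with hm
    have hmm : m ^ 2 = s ^ 2 + ρ ^ 2 := Real.sq_sqrt (by positivity)
    have hms : s ≤ m := Real.le_sqrt_of_sq_le (by nlinarith [sq_nonneg ρ])
    have hm0 : 0 < m := h0.trans_le hms
    rw [← hmm, ← div_eq_mul_inv, div_le_div_iff₀ (by positivity) (by positivity)]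
    nlinarith [mul_nonneg (mul_nonneg h0.le (sq_nonneg m)) (sub_nonneg.2 hms)]

theorem dkk_int {ρ R M : ℝ} (hρ : 0 < ρ) (hR : 0 < R) {g : E3 → E3} {x : E3} (hM : ∀ z, ‖g z‖ ≤ M)
    (h : ∀ z, R < ‖x - z‖ → g z = 0) (u : E3) : ‖∫ z, BK (dkk ρ z u) (g z)‖ ≤
      (4 * M * ‖u‖) * (κ * (lg R ρ + 1)) := by
  have hM0 := (norm_nonneg _).trans (hM 0)
  obtain ⟨hi, hv⟩ := radial_log hR hρ
  have hi2 : Integrable ((Metric.closedBall x R).indicator (fun _ => (R ^ 3)⁻¹)) := by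
    rw [integrable_indicator_iff Metric.isClosed_closedBall.measurableSet]
    exact integrableOn_const measure_closedBall_lt_top.ne
  refine (norm_integral_le_of_norm_le ((hi.add hi2).const_mul (4 * M * ‖u‖)) (ae_of_all _ fun z => ?_)).trans ?_
  · have hs := sq_pos_aux hρ z
    have hn1 : 0 ≤ (Iio R).indicator (fun s => (s ^ 2 + ρ ^ 2) ^ (-(3 / 2) : ℝ)) ‖z‖ :=
      indicator_nonneg (fun s _ => by positivity) _
    have hn2 : 0 ≤ (Metric.closedBall x R).indicator (fun _ => (R ^ 3)⁻¹) z :=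
      indicator_nonneg (fun s _ => by positivity) _
    by_cases hz : ‖x - z‖ ≤ R
    · have hb : (‖z‖ ^ 2 + ρ ^ 2) ^ (-(3 / 2) : ℝ) ≤ (Iio R).indicator (fun s => (s ^ 2 + ρ ^ 2) ^ (-(3 / 2) : ℝ)) ‖z‖
          + (Metric.closedBall x R).indicator (fun _ => (R ^ 3)⁻¹) z := by
        by_cases h1 : ‖z‖ < R
        · rw [indicator_of_mem (show ‖z‖ ∈ Iio R from h1)]; linarith
        · rw [indicator_of_mem (s := Metric.closedBall x R) (by simpa [dist_eq_norm, norm_sub_rev] using hz)]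
          refine le_add_of_nonneg_of_le hn1 ?_
          rw [p32 hs.le]
          gcongr
          exact Real.le_sqrt_of_sq_le (by nlinarith [sq_nonneg ρ, not_lt.1 h1])
      calc _ ≤ (‖dkk ρ z‖ * ‖u‖) * M := by
            refine (ContinuousLinearMap.le_opNorm _ _).trans (mul_le_mul ((BK_le _).trans
              (ContinuousLinearMap.le_opNorm _ _)) (hM _) (norm_nonneg _) (by positivity))
        _ ≤ ((4 * (‖z‖ ^ 2 + ρ ^ 2) ^ (-(3 / 2) : ℝ)) * ‖u‖) * M := by gcongr; exact dkk_le hρ z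
        _ = (4 * M * ‖u‖) * (‖z‖ ^ 2 + ρ ^ 2) ^ (-(3 / 2) : ℝ) := by ring
        _ ≤ _ := mul_le_mul_of_nonneg_left hb (by positivity)
    · rw [h z (not_le.1 hz), map_zero, norm_zero]
      exact mul_nonneg (by positivity) (add_nonneg hn1 hn2)
  · rw [integral_const_mul]
    refine mul_le_mul_of_nonneg_left ?_ (by positivity)
    have := integral_add hi hi2
    refine (le_of_eq this).trans ?_
    rw [integral_indicator Metric.isClosed_closedBall.measurableSet, setIntegral_const, vol_cball hR, smul_eq_mul,
      show R ^ 3 * (κ / 3) * (R ^ 3)⁻¹ = κ / 3 by field_simp]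
    nlinarith [κ_nn]

theorem Kop_fderiv_apply {F F' : Type} [NormedAddCommGroup F] [NormedSpace ℝ F] [CompleteSpace F]
    [NormedAddCommGroup F'] [NormedSpace ℝ F'] {k : E3 → F' →L[ℝ] F} (hm : AEStronglyMeasurable k) {c : ℝ}
    (hk : ∀ z, ‖k z‖ ≤ c * (‖z‖ ^ 2)⁻¹) (hc : 0 ≤ c) {G : PP → F'} (hG : Sm G) (hs : SC G) (p v : PP) :
    fderiv ℝ (Kop k G) p v = Kop k (fun q => fderiv ℝ G q v) p := by
  rw [(Kop_hasFDerivAt hm hk hc hG hs p).fderiv, Kop, ContinuousLinearMap.integral_apply]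
  · rfl
  · exact Kop_integrable (k := fun z => ContinuousLinearMap.compL ℝ PP F' F (k z))
      ((ContinuousLinearMap.compL ℝ PP F' F).continuous.comp_aestronglyMeasurable hm)
      (compL_le hk) hc hG.fderiv.continuous hs.fderiv p

theorem SCapp {F : Type} [NormedAddCommGroup F] [NormedSpace ℝ F] {G : PP → F} (hs : SC G) (v : PP) :
    SC (fun q => fderiv ℝ G q v) := fun T => by
  obtain ⟨R, hR, h⟩ := hs.fderiv T
  exact ⟨R, hR, fun p h1 h2 => by simp [h p h1 h2]⟩

theorem BR_D {ρ M1 : ℝ} (hρ : 0 < ρ) {G : PP → E3} (hG : Sm G) (hs : SC G) {p : PP}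
    (hM1 : ∀ x, ‖(fderiv ℝ G (p.1, x)).comp (.inr ℝ ℝ E3)‖ ≤ M1) (u : E3) :
    ‖fderiv ℝ (Kop (BR 0) G) p (0, u) - ∫ z, BK (dkk ρ z u) (G (p.1, p.2 - z))‖ ≤
      3 * (M1 * ‖u‖) * (κ * (ρ * (π / 2))) := by
  rw [Kop_fderiv_apply (BR_meas 0) (BR_le 0) zero_le_one hG hs, ← BR_parts hρ hG hs]
  refine BR_diff hρ (hG.fderiv.continuous.clm_apply continuous_const) (SCapp hs _) fun x => ?_
  exact (((fderiv ℝ G (p.1, x)).comp (.inr ℝ ℝ E3)).le_opNorm u).trans (by gcongr; exact hM1 x)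

/-- logarithmic estimate -/
theorem BR_log {ρ R M M1 : ℝ} (hρ : 0 < ρ) (hR : 0 < R) {G : PP → E3} (hG : Sm G) (hs : SC G) {p : PP}
    (hM : ∀ x, ‖G (p.1, x)‖ ≤ M) (hM1 : ∀ x, ‖(fderiv ℝ G (p.1, x)).comp (.inr ℝ ℝ E3)‖ ≤ M1)
    (h : ∀ x, R < ‖x‖ → G (p.1, x) = 0) :
    ‖(fderiv ℝ (Kop (BR 0) G) p).comp (.inr ℝ ℝ E3)‖ ≤
      3 * M1 * (κ * (ρ * (π / 2))) + (4 * M) * (κ * (lg R ρ + 1)) := by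
  have hM0 := (norm_nonneg _).trans (hM 0)
  have hM10 := (norm_nonneg _).trans (hM1 0)
  have hlg : 0 ≤ lg R ρ := by
    unfold lg
    have := Real.log_le_log (x := ρ ^ 2) (y := R ^ 2 + ρ ^ 2) (by positivity) (by nlinarith [sq_nonneg R])
    linarith
  have hκ := κ_nn
  refine ContinuousLinearMap.opNorm_le_bound _ (by positivity) fun u => ?_
  have h1 := BR_D hρ hG hs hM1 u
  have h2 := dkk_int hρ hR (g := fun z => G (p.1, p.2 - z)) (x := p.2) (fun z => hM _) (fun z hz => h _ hz) u
  have h3 := norm_add_le (fderiv ℝ (Kop (BR 0) G) p (0, u) - ∫ z, BK (dkk ρ z u) (G (p.1, p.2 - z)))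
    (∫ z, BK (dkk ρ z u) (G (p.1, p.2 - z)))
  rw [sub_add_cancel] at h3
  refine h3.trans ((add_le_add h1 h2).trans (le_of_eq (by ring)))

def e0 : E3 := mk3 1 0 0
def e1 : E3 := mk3 0 1 0
def e2 : E3 := mk3 0 0 1

def dv (U : PP → E3) (p : PP) : ℝ :=
  (fderiv ℝ U p (0, e0)) 0 + (fderiv ℝ U p (0, e1)) 1 + (fderiv ℝ U p (0, e2)) 2

theorem inner3 (x y : E3) : inner ℝ x y = x 0 * y 0 + x 1 * y 1 + x 2 * y 2 := by
  rw [PiLp.inner_apply, Fin.sum_univ_three]; simp; ring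

theorem coord_le (x : E3) (i : Fin 3) : |x i| ≤ ‖x‖ := by
  simpa using PiLp.norm_apply_le x i

theorem int_coord {f : E3 → E3} (hf : Integrable f) (i : Fin 3) : (∫ z, f z) i = ∫ z, f z i :=
  ((EuclideanSpace.proj (𝕜 := ℝ) i).integral_comp_comm hf).symm

theorem dv_zero {G : PP → E3} (hG : Sm G) (hs : SC G) (p : PP) : dv (Kop (BR 0) G) p = 0 := by
  obtain ⟨M1, hM1'⟩ := hs.fderiv.lb hG.fderiv.continuous |p.1|
  have hM1 : ∀ x, ‖(fderiv ℝ G (p.1, x)).comp (.inr ℝ ℝ E3)‖ ≤ M1 := fun x => by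
    refine (ContinuousLinearMap.opNorm_comp_le _ _).trans ?_
    refine le_trans ?_ (hM1' (p.1, x) le_rfl)
    exact mul_le_of_le_one_right (norm_nonneg _) (ContinuousLinearMap.norm_inr_le_one ℝ ℝ E3)
  have hM10 := (norm_nonneg _).trans (hM1 0)
  obtain ⟨R, hR, h⟩ := hs |p.1|
  set S := ‖e0‖ + ‖e1‖ + ‖e2‖
  have key : ∀ ρ, 0 < ρ → |dv (Kop (BR 0) G) p| ≤ ρ * (3 * M1 * κ * (π / 2) * S) := by
    intro ρ hρ
    have hgc : HasCompactSupport (fun z => G (p.1, p.2 - z)) := by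
      refine HasCompactSupport.intro (isCompact_closedBall p.2 R) fun z hz => h _ le_rfl ?_
      simpa [dist_eq_norm, norm_sub_rev] using hz
    have hdc : Continuous (dkk ρ) := by
      have := (kk_sm hρ).fderiv.continuous
      rwa [show fderiv ℝ (kk ρ) = dkk ρ from funext fun z => (kk_hasFDerivAt hρ z).fderiv] at this
    have hgcont : Continuous (fun z => G (p.1, p.2 - z)) := hG.continuous.comp (by fun_prop)
    have hi : ∀ u, Integrable (fun z => BK (dkk ρ z u) (G (p.1, p.2 - z))) := fun u =>
      ((BK.continuous.comp (hdc.clm_apply continuous_const)).clm_apply hgcont).integrable_of_hasCompactSupport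
        (hgc.mono' (fun z hz => subset_tsupport _ (fun h0 => hz (by simp [show G (p.1, p.2 - z) = 0 from h0]))))
    have hz : (∫ z, BK (dkk ρ z e0) (G (p.1, p.2 - z))) 0 + (∫ z, BK (dkk ρ z e1) (G (p.1, p.2 - z))) 1 +
        (∫ z, BK (dkk ρ z e2) (G (p.1, p.2 - z))) 2 = 0 := by
      rw [int_coord (hi _), int_coord (hi _), int_coord (hi _), ← integral_add, ← integral_add]
      · rw [← integral_zero E3 ℝ]
        congr 1
        funext z
        simp only [BK_apply, dkk_apply, cross3, inner3, PiLp.smul_apply, PiLp.add_apply, smul_eq_mul, mk3_0, mk3_1, mk3_2, e0, e1, e2]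
        ring
      · exact ((EuclideanSpace.proj (𝕜 := ℝ) (0 : Fin 3)).integrable_comp (hi _)).add
          ((EuclideanSpace.proj (𝕜 := ℝ) (1 : Fin 3)).integrable_comp (hi _))
      · exact (EuclideanSpace.proj (𝕜 := ℝ) (2 : Fin 3)).integrable_comp (hi _)
      · exact (EuclideanSpace.proj (𝕜 := ℝ) (0 : Fin 3)).integrable_comp (hi _)
      · exact (EuclideanSpace.proj (𝕜 := ℝ) (1 : Fin 3)).integrable_comp (hi _)
    have b := fun u i => (coord_le _ i).trans (BR_D hρ hG hs hM1 u)
    have b0 := b e0 0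
    have b1 := b e1 1
    have b2 := b e2 2
    simp only [PiLp.sub_apply] at b0 b1 b2
    rw [abs_le] at *
    unfold dv
    constructor <;> nlinarith
  by_contra hne
  have hpos := abs_pos.2 hne
  set C := 3 * M1 * κ * (π / 2) * S
  have hC : 0 ≤ C := by have := κ_nn; positivity
  have := key (|dv (Kop (BR 0) G) p| / (2 * (C + 1))) (by positivity)
  rw [div_mul_eq_mul_div, le_div_iff₀ (by positivity)] at this
  nlinarith

end Kernel2

section Vel

theorem JL_le (y : E3) : ‖mk3 (-(y 1)) (y 0) 0‖ ≤ 1 * ‖y‖ := by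
  rw [one_mul]
  refine le_of_sq_le_sq ?_ (by positivity) |> fun h => h
  rw [nsq, nsq]; simp only [mk3_0, mk3_1, mk3_2]; nlinarith [sq_nonneg (y 2)]

def JL : E3 →L[ℝ] E3 := LinearMap.mkContinuous
  { toFun := fun y => mk3 (-(y 1)) (y 0) 0
    map_add' := fun a b => ext3 (by simp [mk3_0]; ring) (by simp [mk3_1]) (by simp [mk3_2])
    map_smul' := fun a b => ext3 (by simp [mk3_0]) (by simp [mk3_1]) (by simp [mk3_2]) } 1 JL_le

theorem JL_apply (y : E3) : JL y = mk3 (-(y 1)) (y 0) 0 := rfl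

theorem JL_norm (y : E3) : ‖JL y‖ ≤ ‖y‖ := by
  have := JL_le y; rw [one_mul] at this; exact this

def Gx (ξ : PP → ℝ) (p : PP) : E3 := ξ p • JL p.2

def VV (ξ : PP → ℝ) : PP → E3 := Kop (BR 0) (Gx ξ)

theorem Gx_sm {ξ : PP → ℝ} (h : Sm ξ) : Sm (Gx ξ) := h.smul (JL.contDiff.comp contDiff_snd)

theorem Gx_SC {ξ : PP → ℝ} (h : SC ξ) : SC (Gx ξ) := fun T => by
  obtain ⟨R, hR, h⟩ := h T
  exact ⟨R, hR, fun p h1 h2 => by simp [Gx, h p h1 h2]⟩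

theorem VV_sm {ξ : PP → ℝ} (h : Sm ξ) (hs : SC ξ) : Sm (VV ξ) :=
  Kop_sm (BR_meas 0) (BR_le 0) zero_le_one (Gx_sm h) (Gx_SC hs)

theorem VV_dv {ξ : PP → ℝ} (h : Sm ξ) (hs : SC ξ) (p : PP) : dv (VV ξ) p = 0 :=
  dv_zero (Gx_sm h) (Gx_SC hs) p

theorem VV_lb {ξ : PP → ℝ} (h : Sm ξ) (hs : SC ξ) (m : ℕ) : LB (iteratedFDeriv ℝ m (VV ξ)) := by
  intro T
  obtain ⟨R, hR, hR'⟩ := Gx_SC hs (T + 1)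
  have h1 : ∀ p : PP, |p.1| ≤ T → R < ‖p.2‖ → iteratedFDeriv ℝ m (Gx ξ) p = 0 := fun p hp hp2 =>
    itd_supp m (T := T + 1) (fun q hq hq2 => hR' q hq.le hq2) p (by linarith) hp2
  have hsc : ∃ M, ∀ p : PP, |p.1| ≤ T → ‖iteratedFDeriv ℝ m (Gx ξ) p‖ ≤ M := by
    obtain ⟨C, hC⟩ := ((isCompact_Icc (a := -T) (b := T)).prod
      (isCompact_closedBall (0 : E3) R)).exists_bound_of_continuousOn
        ((Gx_sm h).itd m).continuous.continuousOn
    refine ⟨max C 0, fun p hp => ?_⟩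
    by_cases h2 : ‖p.2‖ ≤ R
    · exact (hC p ⟨abs_le.1 hp, by simpa using h2⟩).trans (le_max_left _ _)
    · rw [h1 p hp (not_le.1 h2)]; simp
  obtain ⟨M, hM⟩ := hsc
  refine ⟨_, fun p hp => Kop_itd m (BR_meas 0) (BR_le 0) zero_le_one (Gx_sm h) (Gx_SC hs) hR
    (fun x => hM (p.1, x) hp) (fun x hx => h1 (p.1, x) hp hx)⟩

theorem VV_fld {ξ : PP → ℝ} (h : Sm ξ) (hs : SC ξ) : Fld (VV ξ) where
  sm := VV_sm h hs
  bd := fun T => by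
    obtain ⟨C, hC⟩ := VV_lb h hs 0 T
    exact ⟨C, fun p hp => by simpa using hC p hp⟩
  bd1 := fun T => by
    obtain ⟨C, hC⟩ := VV_lb h hs 1 T
    exact ⟨C, fun p hp => by
      have := hC p hp
      rwa [← norm_iteratedFDeriv_fderiv, norm_iteratedFDeriv_zero] at this⟩

theorem eTheta_JL (y : E3) : rc y • eTheta y = JL y := by
  unfold eTheta
  rw [JL_apply]
  rcases eq_or_ne (rc y) 0 with h | h
  · have h2 : y 0 ^ 2 + y 1 ^ 2 = 0 := by
      rw [rc, Real.sqrt_eq_zero (by positivity)] at h; exact h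
    have h0 : y 0 = 0 := by nlinarith [sq_nonneg (y 0), sq_nonneg (y 1)]
    have h1 : y 1 = 0 := by nlinarith [sq_nonneg (y 0), sq_nonneg (y 1)]
    rw [h, h0, h1]
    exact ext3 (by simp [mk3_0]) (by simp [mk3_1]) (by simp [mk3_2])
  · exact ext3 (by simp [mk3_0]; field_simp) (by simp [mk3_1]; field_simp) (by simp [mk3_2])

theorem VV_bs (ξ : PP → ℝ) (t : ℝ) (x : E3) :
    VV ξ (t, x) = biotSavart (fun y => ξ (t, y) * rc y) x := by
  unfold VV Kop biotSavart
  rw [← integral_smul, ← integral_sub_left_eq_self _ _ x]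
  congr 1
  funext z
  simp only [sub_sub_cancel, BR, BK_apply, Gx, mul_smul, eTheta_JL]
  congr 1
  have : kk 0 (x - z) = (‖x - z‖ ^ (-(3 : ℝ))) • (x - z) := by
    unfold kk
    congr 1
    rw [zero_pow two_ne_zero, add_zero, ← Real.rpow_natCast_mul (norm_nonneg _)]
    norm_num
  rw [this, ← crossL_apply, ← crossL_apply, map_smul]

/-- L2 type velocity bound -/
theorem VV_le {ξ : PP → ℝ} {p : PP} {R M N : ℝ} (hR : 0 < R) (hc : Continuous ξ)
    (hM : ∀ x, |ξ (p.1, x)| ≤ M) (h : ∀ x, R < ‖x‖ → ξ (p.1, x) = 0)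
    (hN : ∫ x, ξ (p.1, x) ^ 2 ≤ N) : ‖VV ξ p‖ ≤ R * ((M + 1) * (κ * 2) + N) := by
  have hM0 := (abs_nonneg _).trans (hM 0)
  have hsq : Integrable (fun x => ξ (p.1, x) ^ 2) := by
    refine Continuous.integrable_of_hasCompactSupport (by fun_prop) ?_
    refine HasCompactSupport.intro (isCompact_closedBall (0 : E3) R) fun z hz => ?_
    rw [h z (by simpa using hz)]; simp
  have hsq' : Integrable (fun z => ξ (p.1, p.2 - z) ^ 2) := hsq.comp_sub_left p.2
  have hv : ∫ z, ξ (p.1, p.2 - z) ^ 2 = ∫ x, ξ (p.1, x) ^ 2 :=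
    integral_sub_left_eq_self (fun x => ξ (p.1, x) ^ 2) _ p.2
  have hi := (((hh_int one_pos).const_mul (M + 1)).add hsq').const_mul R
  refine (norm_integral_le_of_norm_le hi (ae_of_all _ fun z => ?_)).trans ?_
  · refine (ContinuousLinearMap.le_opNorm _ _).trans ?_
    refine (mul_le_mul_of_nonneg_right (BR_le 0 z) (norm_nonneg _)).trans ?_
    simp only [Gx, one_mul, Pi.add_apply]
    rw [norm_smul]
    rcases eq_or_ne z 0 with rfl | hz
    · have := hh_nn 1 ‖(0 : E3)‖
      simp only [norm_zero, ne_eq, OfNat.ofNat_ne_zero, not_false_eq_true, zero_pow, inv_zero, zero_mul] at this ⊢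
      positivity
    set a := ξ (p.1, p.2 - z) with ha
    have h1 : ‖a‖ * ‖JL (p.2 - z)‖ ≤ ‖a‖ * R := by
      by_cases h2 : ‖p.2 - z‖ ≤ R
      · gcongr; exact (JL_norm _).trans h2
      · rw [ha, h _ (not_le.1 h2)]; simp
    refine (mul_le_mul_of_nonneg_left h1 (by positivity)).trans ?_
    rw [← mul_assoc, mul_comm]
    refine mul_le_mul_of_nonneg_left ?_ hR.le
    have hs := hh_split one_pos ‖z‖
    have hn := hh_nn 1 ‖z‖
    have h3 : ‖a‖ ≤ M := hM _
    have h4 : (‖z‖ ^ 2 + 1 ^ 2)⁻¹ * ‖a‖ ≤ hh 1 ‖z‖ + a ^ 2 := by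
      have hz' : 0 < ‖z‖ := norm_pos_iff.2 hz
      have h5 : ((‖z‖ ^ 2 + 1 ^ 2)⁻¹) ^ 2 ≤ hh 1 ‖z‖ := by
        rw [hh, one_pow, one_mul, inv_pow]
        refine inv_anti₀ (by positivity) ?_
        nlinarith [sq_nonneg ‖z‖]
      rw [← sq_abs a, ← Real.norm_eq_abs]
      nlinarith [sq_nonneg ((‖z‖ ^ 2 + 1 ^ 2)⁻¹ - ‖a‖), sq_nonneg ((‖z‖ ^ 2 + 1 ^ 2)⁻¹ + ‖a‖), sq_nonneg ‖a‖, sq_nonneg ((‖z‖ ^ 2 + 1 ^ 2)⁻¹)]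
    have := mul_le_mul_of_nonneg_right hs (norm_nonneg a)
    nlinarith [mul_le_mul_of_nonneg_left h3 hn]
  · rw [integral_const_mul]
    refine mul_le_mul_of_nonneg_left ?_ hR.le
    have := integral_add ((hh_int one_pos).const_mul (M + 1)) hsq'
    refine (le_of_eq this).trans ?_
    rw [integral_const_mul, hh_val one_pos, hv]
    have : π / 2 ≤ 2 := by linarith [Real.pi_lt_d2]
    gcongr
    · exact κ_nn
    · linarith

theorem Kop_sub {k : E3 → E3 →L[ℝ] E3} (hm : AEStronglyMeasurable k) {c : ℝ}
    (hk : ∀ z, ‖k z‖ ≤ c * (‖z‖ ^ 2)⁻¹) (hc : 0 ≤ c) {G H : PP → E3} (hG : Continuous G) (hs : SC G)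
    (hH : Continuous H) (hs' : SC H) (p : PP) :
    Kop k G p - Kop k H p = Kop k (fun q => G q - H q) p := by
  unfold Kop
  rw [← integral_sub (Kop_integrable hm hk hc hG hs p) (Kop_integrable hm hk hc hH hs' p)]
  simp only [map_sub]

theorem VV_diff {ξ η : PP → ℝ} (hξ : Continuous ξ) (hsξ : SC ξ) (hη : Continuous η) (hsη : SC η) {p : PP}
    {R M : ℝ} (hR : 0 < R) (hM : ∀ x, |ξ (p.1, x) - η (p.1, x)| ≤ M)
    (h : ∀ x, R < ‖x‖ → ξ (p.1, x) = 0) (h' : ∀ x, R < ‖x‖ → η (p.1, x) = 0) :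
    ‖VV ξ p - VV η p‖ ≤ M * R * (κ * 3 * R) := by
  have hc : ∀ {ξ : PP → ℝ}, Continuous ξ → Continuous (Gx ξ) := fun h =>
    h.smul (JL.continuous.comp continuous_snd)
  have hM0 := (abs_nonneg _).trans (hM 0)
  rw [VV, VV, Kop_sub (BR_meas 0) (BR_le 0) zero_le_one (hc hξ) (Gx_SC hsξ) (hc hη) (Gx_SC hsη)]
  refine (Kop_le (BR_le 0) zero_le_one (M := M * R) hR (fun x => ?_) (fun x hx => ?_)).trans (by rw [one_mul])
  · simp only [Gx]
    rw [← sub_smul, norm_smul]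
    by_cases h2 : ‖x‖ ≤ R
    · exact mul_le_mul (hM x) ((JL_norm _).trans h2) (norm_nonneg _) hM0
    · rw [h _ (not_le.1 h2), h' _ (not_le.1 h2)]; simp; positivity
  · simp [Gx, h x hx, h' x hx]

theorem vec_dec (v : E3) : ((0, v) : PP) = v 0 • (0, e0) + v 1 • (0, e1) + v 2 • (0, e2) := by
  refine Prod.ext (by simp) (ext3 ?_ ?_ ?_) <;> simp [e0, e1, e2, mk3_0, mk3_1, mk3_2]

theorem slice_fderiv {F : Type} [NormedAddCommGroup F] [NormedSpace ℝ F] {f : PP → F} (hf : Sm f) (t : ℝ) (x v : E3) :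
    fderiv ℝ (fun x => f (t, x)) x v = fderiv ℝ f (t, x) (0, v) := by
  have h1 : HasFDerivAt (fun x => f (t, x)) ((fderiv ℝ f (t, x)).comp (.inr ℝ ℝ E3)) x :=
    (hf.diff (t, x)).hasFDerivAt.comp x (hasFDerivAt_prodMk_right t x)
  rw [h1.fderiv]; rfl

theorem slice_sm {F : Type} [NormedAddCommGroup F] [NormedSpace ℝ F] {f : PP → F} (hf : Sm f) (t : ℝ) :
    Sm (fun x => f (t, x)) := hf.comp (contDiff_const.prodMk contDiff_id)

theorem slice_cs {F : Type} [NormedAddCommGroup F] {f : PP → F} (hs : SC f) (t : ℝ) :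
    HasCompactSupport (fun x => f (t, x)) := by
  obtain ⟨R, hR, h⟩ := hs |t|
  refine HasCompactSupport.intro (isCompact_closedBall (0 : E3) R) fun z hz => ?_
  exact h (t, z) le_rfl (by simpa using hz)

theorem int_deriv {f : PP → ℝ} (hf : Sm f) (hs : SC f) (t : ℝ) :
    HasDerivAt (fun t => ∫ x, f (t, x)) (∫ x, fderiv ℝ f (t, x) (1, 0)) t := by
  obtain ⟨R, hR, h⟩ := hs.fderiv (|t| + 1)
  obtain ⟨M, hM⟩ := hs.fderiv.lb hf.fderiv.continuous (|t| + 1)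
  refine (hasDerivAt_integral_of_dominated_loc_of_deriv_le (Metric.ball_mem_nhds t one_pos)
    (F' := fun s x => fderiv ℝ f (s, x) (1, 0))
    (bound := (Metric.closedBall (0 : E3) R).indicator fun _ => M) ?_ ?_ ?_ ?_ ?_ ?_).2
  · exact Eventually.of_forall fun s => (slice_sm hf s).continuous.aestronglyMeasurable
  · exact (slice_sm hf t).continuous.integrable_of_hasCompactSupport (slice_cs hs t)
  · exact ((slice_sm hf.fderiv t).continuous.clm_apply continuous_const).aestronglyMeasurable
  · refine ae_of_all _ fun x s hs => ?_
    have h1 : |s| ≤ |t| + 1 := by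
      have h2 : |s - t| < 1 := by simpa [Real.dist_eq] using hs
      have := abs_sub_abs_le_abs_sub s t
      linarith
    by_cases hx : ‖x‖ ≤ R
    · rw [indicator_of_mem (by simpa using hx)]
      refine (ContinuousLinearMap.le_opNorm _ _).trans ?_
      have : ‖((1, 0) : PP)‖ = 1 := by simp [Prod.norm_def]
      rw [this, mul_one]
      exact hM _ h1
    · rw [h (s, x) h1 (not_le.1 hx)]
      simp [hx]
  · rw [integrable_indicator_iff Metric.isClosed_closedBall.measurableSet]
    exact integrableOn_const measure_closedBall_lt_top.ne
  · refine ae_of_all _ fun x s _ => ?_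
    exact (hf.diff (s, x)).hasFDerivAt.comp_hasDerivAt s ((hasDerivAt_id s).prodMk (hasDerivAt_const s x))

theorem int_conserved {f : PP → ℝ} {U : PP → E3} (hf : Sm f) (hs : SC f) (hU : Sm U) (hd : ∀ p, dv U p = 0)
    (h : ∀ p, fderiv ℝ f p (1, U p) = 0) (t : ℝ) : ∫ x, f (t, x) = ∫ x, f (0, x) := by
  have hz : ∀ t, ∫ x, fderiv ℝ f (t, x) (1, 0) = 0 := by
    intro t
    have hUi : ∀ i, Sm (fun p => U p i) := fun i => (EuclideanSpace.proj (𝕜 := ℝ) i).contDiff.comp hU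
    have hi : ∀ {a b : PP → ℝ}, Continuous a → Continuous b → SC b →
        Integrable (fun x => a (t, x) * b (t, x)) := fun {a b} ha hb hsb =>
      Continuous.integrable_of_hasCompactSupport (by fun_prop) (slice_cs hsb t).mul_left
    have hp : ∀ (i : Fin 3) (e : E3), ∫ x, U (t, x) i * fderiv ℝ f (t, x) (0, e) =
        - ∫ x, (fderiv ℝ U (t, x) (0, e)) i * f (t, x) := by
      intro i e
      have hc : ∀ q, fderiv ℝ (fun p => U p i) q (0, e) = (fderiv ℝ U q (0, e)) i := fun q => by
        have := ((EuclideanSpace.proj (𝕜 := ℝ) i).hasFDerivAt.comp q (hU.diff q).hasFDerivAt)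
        have e1 : fderiv ℝ (fun p => U p i) q = _ := this.fderiv
        rw [e1]; rfl
      have := integral_mul_fderiv_eq_neg_fderiv_mul_of_integrable (μ := (volume : Measure E3))
        (f := fun x => U (t, x) i) (g := fun x => f (t, x)) (v := e) ?_ ?_ ?_
        (fun x _ => (slice_sm (hUi i) t).diff x) (fun x _ => (slice_sm hf t).diff x)
      · simpa only [slice_fderiv hf, slice_fderiv (hUi i), hc] using this
      · simp only [slice_fderiv (hUi i)]
        exact hi ((hUi i).fderiv.continuous.clm_apply continuous_const) hf.continuous hs
      · simp only [slice_fderiv hf]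
        exact hi (hUi i).continuous (hf.fderiv.continuous.clm_apply continuous_const) (SCapp hs _)
      · exact hi (hUi i).continuous hf.continuous hs
    have he : ∀ x, fderiv ℝ f (t, x) (1, 0) = -(U (t, x) 0 * fderiv ℝ f (t, x) (0, e0) +
        U (t, x) 1 * fderiv ℝ f (t, x) (0, e1) + U (t, x) 2 * fderiv ℝ f (t, x) (0, e2)) := by
      intro x
      have h1 := h (t, x)
      have h2 : ((1, U (t, x)) : PP) = (1, 0) + (0, U (t, x)) := by simp
      rw [h2, map_add, vec_dec] at h1
      simp only [map_add, map_smul, smul_eq_mul] at h1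
      linarith
    have i1 : ∀ i e, Integrable fun x => U (t, x) i * fderiv ℝ f (t, x) (0, e) := fun i e =>
      hi (hUi i).continuous (hf.fderiv.continuous.clm_apply continuous_const) (SCapp hs _)
    have i2 : ∀ (i : Fin 3) e, Integrable fun x => (fderiv ℝ U (t, x) (0, e)) i * f (t, x) := fun i e =>
      hi (a := fun p => (fderiv ℝ U p (0, e)) i) ((EuclideanSpace.proj (𝕜 := ℝ) i).continuous.comp
        (hU.fderiv.continuous.clm_apply continuous_const)) hf.continuous hs
    simp only [he]
    rw [integral_neg, integral_add (by exact (i1 _ _).add (i1 _ _)) (i1 _ _), integral_add (i1 _ _) (i1 _ _), hp, hp, hp]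
    have : ∫ x, ((fderiv ℝ U (t, x) (0, e0)) 0 * f (t, x) + (fderiv ℝ U (t, x) (0, e1)) 1 * f (t, x)
        + (fderiv ℝ U (t, x) (0, e2)) 2 * f (t, x)) = 0 := by
      refine (integral_congr_ae (ae_of_all _ fun x => ?_)).trans (integral_zero E3 ℝ)
      simp only
      have := hd (t, x)
      rw [dv] at this
      rw [← add_mul, ← add_mul, this, zero_mul]
    rw [integral_add (by exact (i2 _ _).add (i2 _ _)) (i2 _ _), integral_add (i2 _ _) (i2 _ _)] at this
    linarith
  have hD := fun t => (int_deriv hf hs t)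
  exact is_const_of_deriv_eq_zero (fun t => (hD t).differentiableAt) (fun t => by rw [(hD t).deriv, hz]) t 0

end Vel

section P3a

theorem cpt_bd {F : Type} [NormedAddCommGroup F] {f : PP → F} (hf : Continuous f) (T R : ℝ) :
    ∃ C, 0 ≤ C ∧ ∀ p : PP, |p.1| ≤ T → ‖p.2‖ ≤ R → ‖f p‖ ≤ C := by
  obtain ⟨C, hC⟩ := ((isCompact_Icc (a := -T) (b := T)).prod
    (isCompact_closedBall (0 : E3) R)).exists_bound_of_continuousOn hf.continuousOn
  exact ⟨max C 0, le_max_right _ _, fun p hp h2 =>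
    (hC p ⟨abs_le.1 hp, by simpa using h2⟩).trans (le_max_left _ _)⟩

theorem VV_itd (m : ℕ) (T : ℝ) {R : ℝ} (hR : 0 < R) : ∃ C, 0 ≤ C ∧ ∀ ξ : PP → ℝ, Sm ξ → SC ξ →
    (∀ p : PP, |p.1| < T → R < ‖p.2‖ → ξ p = 0) → ∀ t, |t| < T → ∀ M,
    (∀ x i, i ≤ m → ‖iteratedFDeriv ℝ i ξ (t, x)‖ ≤ M) → ∀ x, ‖iteratedFDeriv ℝ m (VV ξ) (t, x)‖ ≤ C * M := by
  have hJ : Sm (fun p : PP => JL p.2) := JL.contDiff.comp contDiff_snd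
  choose c hc0 hc using fun j => cpt_bd (hJ.itd j).continuous T R
  set C := ∑ i ∈ Finset.range (m + 1), (m.choose i : ℝ) * c (m - i) with hC
  have hC0 : 0 ≤ C := Finset.sum_nonneg fun i _ => by have := hc0 (m - i); positivity
  have hκ := κ_nn
  refine ⟨C * (κ * 3 * R), by positivity, fun ξ h hs hsupp t ht M hM x => ?_⟩
  have hM0 := (norm_nonneg _).trans (hM 0 0 (Nat.zero_le m))
  have h0 : ∀ x, R < ‖x‖ → iteratedFDeriv ℝ m (Gx ξ) (t, x) = 0 := fun x hx =>
    itd_supp m (T := T) (fun q hq hq2 => by simp [Gx, hsupp q hq hq2]) _ ht hx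
  refine (Kop_itd m (BR_meas 0) (BR_le 0) zero_le_one (Gx_sm h) (Gx_SC hs) (p := (t, x)) (M := C * M) hR
    (fun y => ?_) h0).trans (le_of_eq (by ring))
  by_cases hy : ‖y‖ ≤ R
  · refine (norm_iteratedFDeriv_smul_le h hJ (t, y) (nle m)).trans ?_
    rw [hC, Finset.sum_mul]
    refine Finset.sum_le_sum fun i hi => ?_
    have h1 := hM y i (by simpa [Nat.lt_succ_iff] using hi)
    have h2 := hc (m - i) (t, y) ht.le hy
    calc _ ≤ (m.choose i : ℝ) * M * c (m - i) := by gcongr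
      _ = _ := by ring
  · rw [h0 y (not_le.1 hy), norm_zero]; positivity

theorem TE2 {F : Type*} [NormedAddCommGroup F] [NormedSpace ℝ F] {U : PP → E3} (h : Fld U) {f : PP → F}
    (hf : Differentiable ℝ f) {T : ℝ}
    {B B' : ℝ → ℝ} (h0 : ∀ x, ‖f (0, x)‖ ≤ B 0) (hB : ∀ t, HasDerivAt B (B' t) t)
    (hb : ∀ t x, |t| < T → ‖f (t, x)‖ = B |t| → ‖fderiv ℝ f (t, x) (1, U (t, x))‖ < B' |t|)
    {t : ℝ} (ht : |t| ≤ T) (x : E3) : ‖f (t, x)‖ ≤ B |t| := by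
  rcases le_total 0 t with h1 | h1
  · rw [abs_of_nonneg h1] at ht ⊢
    exact TE h hf h0 hB (fun s y hs hs' he => by
      have := hb s y (by rwa [abs_of_nonneg hs]) (by rwa [abs_of_nonneg hs])
      rwa [abs_of_nonneg hs] at this) h1 ht x
  · rw [abs_of_nonpos h1] at ht ⊢
    let S : PP →L[ℝ] PP := (-(ContinuousLinearMap.fst ℝ ℝ E3)).prod (ContinuousLinearMap.snd ℝ ℝ E3)
    have hS : ∀ p, S p = (-p.1, p.2) := fun p => rfl
    have hSf : ∀ p, fderiv ℝ (fun p => f (S p)) p = (fderiv ℝ f (S p)).comp S := fun p =>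
      ((hf (S p)).hasFDerivAt.comp p S.hasFDerivAt).fderiv
    have hF : Fld (fun p => -U (S p)) := by
      refine ⟨(h.sm.comp S.contDiff).neg, fun T => ?_, fun T => ?_⟩
      · obtain ⟨C, hC⟩ := h.bd T
        exact ⟨C, fun p hp => by rw [norm_neg]; exact hC _ (by simpa [hS] using hp)⟩
      · obtain ⟨C, hC⟩ := h.bd1 T
        refine ⟨C * ‖S‖, fun p hp => ?_⟩
        simp only
        rw [fderiv_fun_neg, norm_neg]
        have e : fderiv ℝ (fun p => U (S p)) p = _ := ((h.sm.diff (S p)).hasFDerivAt.comp p S.hasFDerivAt).fderiv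
        rw [e]
        refine (ContinuousLinearMap.opNorm_comp_le _ _).trans ?_
        gcongr; exact hC _ (by simpa [hS] using hp)
    have := TE hF (f := fun p => f (S p)) (hf.comp S.differentiable) (T := T) (B := B) (B' := B')
      (fun x => by simpa [hS] using h0 x) hB (fun s y hs hs' he => ?_) (t := -t) (by linarith) ht x
    · simpa [hS] using this
    · rw [hSf]
      have e : S (1, -U (S (s, y))) = -(1, U (S (s, y))) := by simp [hS]
      rw [ContinuousLinearMap.comp_apply, e, map_neg, norm_neg]
      have := hb (-s) y (by rwa [abs_neg, abs_of_nonneg hs]) (by rw [abs_neg, abs_of_nonneg hs]; exact he)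
      rwa [abs_neg, abs_of_nonneg hs] at this

/-- flatness at time zero -/
def Flat {F : Type} [NormedAddCommGroup F] [NormedSpace ℝ F] (k : ℕ) (h : PP → F) : Prop :=
  ∀ i < k, ∀ x, iteratedFDeriv ℝ i h (0, x) = 0

section
variable {F G H : Type} [NormedAddCommGroup F] [NormedSpace ℝ F] [NormedAddCommGroup G] [NormedSpace ℝ G]
  [NormedAddCommGroup H] [NormedSpace ℝ H]

theorem Flat.mono {k l : ℕ} {h : PP → F} (hh : Flat k h) (hl : l ≤ k) : Flat l h :=
  fun i hi x => hh i (hi.trans_le hl) x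

theorem Flat.bilR (B : F →L[ℝ] G →L[ℝ] H) {k : ℕ} {f : PP → F} {g : PP → G} (hf : Sm f) (hg : Sm g)
    (h : Flat k g) : Flat k (fun p => B (f p) (g p)) := fun i hi x => by
  refine norm_le_zero_iff.1 ((B.norm_iteratedFDeriv_le_of_bilinear hf hg (0, x) (nle i)).trans (le_of_eq ?_))
  rw [Finset.sum_eq_zero, mul_zero]
  intro j hj
  rw [h _ (by omega), norm_zero, mul_zero]

theorem Flat.bilL (B : F →L[ℝ] G →L[ℝ] H) {k : ℕ} {f : PP → F} {g : PP → G} (hf : Sm f) (hg : Sm g)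
    (h : Flat k f) : Flat k (fun p => B (f p) (g p)) := Flat.bilR B.flip hg hf h

theorem Flat.lin (L : F →L[ℝ] G) {k : ℕ} {f : PP → F} (hf : Sm f) (h : Flat k f) :
    Flat k (fun p => L (f p)) :=
  Flat.bilR (ContinuousLinearMap.id ℝ (F →L[ℝ] G)) (f := fun _ => L) contDiff_const hf h

theorem Flat.addf {k : ℕ} {f g : PP → F} (hf : Sm f) (hg : Sm g) (h : Flat k f) (h' : Flat k g) :
    Flat k (fun p => f p + g p) := fun i hi x => by
  have := iteratedFDeriv_add_apply (i := i) (x := ((0, x) : PP)) (hf.contDiffAt.of_le (nle i)) (hg.contDiffAt.of_le (nle i))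
  rw [h i hi, h' i hi, add_zero] at this; exact this

theorem Flat.dx {k : ℕ} {f : PP → F} (h : Flat (k + 1) f) : Flat k (fun p => fderiv ℝ f p) := fun i hi x => by
  rw [← norm_eq_zero]
  exact (norm_iteratedFDeriv_fderiv ..).trans (by rw [h (i + 1) (by omega), norm_zero])

theorem Flat.of_fd {k : ℕ} {f : PP → F} (h0 : ∀ x, f (0, x) = 0) (h : Flat k (fun p => fderiv ℝ f p)) : Flat (k + 1) f
  | 0, _, x => by rw [← norm_eq_zero, norm_iteratedFDeriv_zero, h0, norm_zero]
  | i + 1, hi, x => by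
    rw [← norm_eq_zero, ← norm_iteratedFDeriv_fderiv, h i (by omega), norm_zero]
end

def inrL (F : Type) [NormedAddCommGroup F] [NormedSpace ℝ F] : (PP →L[ℝ] F) →L[ℝ] (E3 →L[ℝ] F) :=
  (ContinuousLinearMap.compL ℝ E3 PP F).flip (.inr ℝ ℝ E3)

theorem flat_tr (k : ℕ) : ∀ {F : Type} [NormedAddCommGroup F] [NormedSpace ℝ F] {h g : PP → F} {U : PP → E3},
    Sm h → Sm g → Sm U → (∀ x, h (0, x) = 0) → (∀ p, fderiv ℝ h p (1, U p) = g p) → Flat k g → Flat (k + 1) h := by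
  induction k with
  | zero =>
    intro F _ _ h g U hh hg hU h0 he hf i hi x
    obtain rfl : i = 0 := by omega
    rw [← norm_eq_zero, norm_iteratedFDeriv_zero, h0, norm_zero]
  | succ k ih =>
    intro F _ _ h g U hh hg hU h0 he hf
    have h1 : Flat (k + 1) h := ih hh hg hU h0 he (hf.mono (Nat.le_succ k))
    set D : PP → E3 →L[ℝ] F := fun p => inrL F (fderiv ℝ h p) with hD
    have hDs : Sm D := (inrL F).contDiff.comp hh.fderiv
    have hUs : Sm (fun p => inrL E3 (fderiv ℝ U p)) := (inrL E3).contDiff.comp hU.fderiv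
    have hgs : Sm (fun p => inrL F (fderiv ℝ g p)) := (inrL F).contDiff.comp hg.fderiv
    have hDf : Flat k D := h1.dx.lin (inrL F) hh.fderiv
    have hcs : Sm (fun p => (-ContinuousLinearMap.compL ℝ E3 E3 F) (D p) (inrL E3 (fderiv ℝ U p))) :=
      ((-ContinuousLinearMap.compL ℝ E3 E3 F).contDiff.comp hDs).clm_apply hUs
    have hD1 : Flat (k + 1) D := by
      refine ih (g := fun p => inrL F (fderiv ℝ g p) +
        (-ContinuousLinearMap.compL ℝ E3 E3 F) (D p) (inrL E3 (fderiv ℝ U p))) hDs (hgs.add hcs) hU ?_ ?_ ?_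
      · intro x
        have : fderiv ℝ (fun x => h (0, x)) x = 0 := by
          have e : (fun x => h (0, x)) = fun _ => (0 : F) := funext h0
          rw [e]; simp
        ext v
        have h2 := slice_fderiv hh 0 x v
        rw [this] at h2
        exact h2.symm
      · intro p
        ext v
        have h1 : HasFDerivAt (fun q => fderiv ℝ h q (1, U q))
            ((fderiv ℝ h p).comp ((ContinuousLinearMap.inr ℝ ℝ E3).comp (fderiv ℝ U p)) +
              (fderiv ℝ (fderiv ℝ h) p).flip (1, U p)) p := by
          have hc : HasFDerivAt (fun q : PP => ((1 : ℝ), U q)) ((ContinuousLinearMap.inr ℝ ℝ E3).comp (fderiv ℝ U p)) p := by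
            exact (hasFDerivAt_const (1 : ℝ) p).prodMk (hU.diff p).hasFDerivAt
          exact (hh.fderiv.diff p).hasFDerivAt.clm_apply hc
        have e : (fun q => fderiv ℝ h q (1, U q)) = g := funext he
        rw [e] at h1
        have h2 : HasFDerivAt D ((inrL F).comp (fderiv ℝ (fderiv ℝ h) p)) p :=
          (inrL F).hasFDerivAt.comp p (hh.fderiv.diff p).hasFDerivAt
        have hsym : IsSymmSndFDerivAt ℝ h p := 
          ContDiffAt.isSymmSndFDerivAt (n := ((⊤ : ℕ∞) : WithTop ℕ∞)) hh.contDiffAt (by simpa using nle 2)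
        rw [h2.fderiv, h1.fderiv]
        simp [inrL, hD]
        exact hsym _ _
      · exact Flat.addf hgs hcs (hf.dx.lin _ hg.fderiv) (hDf.bilL _ hDs hUs)
    refine Flat.of_fd h0 ?_
    have e : (fun p => fderiv ℝ h p) = fun p =>
        (ContinuousLinearMap.smulRightL ℝ PP F (.fst ℝ ℝ E3)) (g p) +
        ((ContinuousLinearMap.compL ℝ PP E3 F) (D p) (ContinuousLinearMap.snd ℝ ℝ E3 -
          ContinuousLinearMap.smulRightL ℝ PP E3 (.fst ℝ ℝ E3) (U p))) := by
      funext p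
      refine ContinuousLinearMap.ext fun v => ?_
      have h3 : v = v.1 • (1, U p) + (0, v.2 - v.1 • U p) := by simp
      conv_lhs => rw [h3, map_add, map_smul, he]
      simp only [hD, inrL, add_apply, sub_apply, ContinuousLinearMap.compL_apply, ContinuousLinearMap.comp_apply,
        ContinuousLinearMap.smulRightL_apply_apply, ContinuousLinearMap.flip_apply, ContinuousLinearMap.inr_apply,
        ContinuousLinearMap.smulRight_apply, ContinuousLinearMap.coe_fst', ContinuousLinearMap.coe_snd']
    rw [e]
    have hP : Sm (fun p => ContinuousLinearMap.snd ℝ ℝ E3 -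
          ContinuousLinearMap.smulRightL ℝ PP E3 (.fst ℝ ℝ E3) (U p)) :=
      contDiff_const.sub ((ContinuousLinearMap.smulRightL ℝ PP E3 (.fst ℝ ℝ E3)).contDiff.comp hU)
    have a1 : Flat (k + 1) (fun p => (ContinuousLinearMap.smulRightL ℝ PP F (.fst ℝ ℝ E3)) (g p)) := hf.lin _ hg
    have a2 := hD1.bilL (ContinuousLinearMap.compL ℝ PP E3 F) hDs hP
    have a3 : Sm (fun p => (ContinuousLinearMap.smulRightL ℝ PP F (.fst ℝ ℝ E3)) (g p)) :=
      (ContinuousLinearMap.contDiff _).comp hg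
    have a4 : Sm (fun p => ContinuousLinearMap.compL ℝ PP E3 F (D p)) := (ContinuousLinearMap.contDiff _).comp hDs
    exact Flat.addf a3 (a4.clm_apply hP) a1 a2
end P3a

section P3b

theorem along {F : Type} [NormedAddCommGroup F] [NormedSpace ℝ F] {U : PP → E3} {f : PP → F}
    (hf : Differentiable ℝ f) (htr : ∀ p, fderiv ℝ f p (1, U p) = 0) {T : ℝ} {c : ℝ → E3} (hc : IsChar U T c)
    {t : ℝ} (ht : |t| < T) : f (t, c t) = f (0, c 0) := by
  have hT : 0 < T := (abs_nonneg t).trans_lt ht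
  have hd : ∀ s ∈ Ioo (-T) T, HasDerivAt (fun s => f (s, c s)) 0 s := fun s hs => by
    have := char_deriv hc hs (hf _)
    rwa [htr] at this
  exact isOpen_Ioo.is_const_of_deriv_eq_zero isPreconnected_Ioo
    (fun s hs => (hd s hs).differentiableAt.differentiableWithinAt) (fun s hs => (hd s hs).deriv)
    (abs_lt.1 ht) ⟨by linarith, hT⟩

theorem char_growth {U : PP → E3} {T : ℝ} {c : ℝ → E3} (hc : IsChar U T c) {t : ℝ} (ht : |t| < T)
    {B B' : ℝ → ℝ} (hB : ∀ t, HasDerivAt B (B' t) t) (hU : ∀ s, |s| ≤ |t| → ‖U (s, c s)‖ ≤ B' |s|)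
    (h0 : ‖c 0‖ ≤ B 0) : ‖c t‖ ≤ B |t| := by
  obtain ⟨e, he, hte⟩ : ∃ e : ℝ, |e| = 1 ∧ t = e * |t| := by
    rcases le_total 0 t with h | h
    · exact ⟨1, by simp, by rw [abs_of_nonneg h, one_mul]⟩
    · exact ⟨-1, by simp, by rw [abs_of_nonpos h]; ring⟩
  have hs : ∀ s, 0 ≤ s → |e * s| = s := fun s hs => by rw [abs_mul, he, one_mul, abs_of_nonneg hs]
  have hd : ∀ s, 0 ≤ s → s ≤ |t| → HasDerivAt (fun s => c (e * s)) (e • U (e * s, c (e * s))) s := fun s h1 h2 => by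
    have h3 : e * s ∈ Ioo (-T) T := abs_lt.1 (by rw [hs s h1]; linarith)
    exact (hc _ h3).scomp s (by simpa using (hasDerivAt_id s).const_mul e)
  have := image_norm_le_of_norm_deriv_right_le_deriv_boundary (f := fun s => c (e * s)) (a := 0) (b := |t|)
    (f' := fun s => e • U (e * s, c (e * s))) (B := B) (B' := B')
    (fun s hs => (hd s hs.1 hs.2).continuousAt.continuousWithinAt)
    (fun s hs => (hd s hs.1 hs.2.le).hasDerivWithinAt) (by simpa using h0) hB
    (fun s h => by
      rw [norm_smul, Real.norm_eq_abs, he, one_mul]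
      have := hU (e * s) (by rw [hs s h.1]; exact h.2.le)
      rwa [hs s h.1] at this) (x := |t|) ⟨abs_nonneg _, le_rfl⟩
  simpa only [← hte] using this

theorem supp_bar {U : PP → E3} (h : Fld U) {f : PP → ℝ} (hf : Differentiable ℝ f)
    (htr : ∀ p, fderiv ℝ f p (1, U p) = 0) {B B' : ℝ → ℝ} (hB : ∀ t, HasDerivAt B (B' t) t) {t : ℝ}
    (hU : ∀ s x, |s| ≤ |t| → ‖U (s, x)‖ ≤ B' |s|) (h0 : ∀ x, B 0 < ‖x‖ → f (0, x) = 0) (x : E3)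
    (hx : B |t| < ‖x‖) : f (t, x) = 0 := by
  obtain ⟨c, rfl, hc⟩ := exists_char h (lt_add_one |t|) x
  rw [along hf htr hc (lt_add_one _)]
  refine h0 _ ?_
  by_contra h1
  have := char_growth hc (lt_add_one |t|) hB (fun s hs => hU s _ hs) (not_lt.1 h1)
  linarith

theorem val_bd {F : Type} [NormedAddCommGroup F] [NormedSpace ℝ F] {U : PP → E3} (h : Fld U) {f : PP → F}
    (hf : Differentiable ℝ f) (htr : ∀ p, fderiv ℝ f p (1, U p) = 0) {M : ℝ} (h0 : ∀ x, ‖f (0, x)‖ ≤ M) (p : PP) :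
    ‖f p‖ ≤ M := by
  obtain ⟨c, h1, hc⟩ := exists_char h (lt_add_one |p.1|) p.2
  have := along hf htr hc (lt_add_one |p.1|)
  rw [h1] at this
  exact (congrArg norm this).le.trans (h0 _)

theorem supp_SC {U : PP → E3} (h : Fld U) {f : PP → ℝ} (hf : Differentiable ℝ f)
    (htr : ∀ p, fderiv ℝ f p (1, U p) = 0) {R : ℝ} (hR : 0 < R) (h0 : ∀ x, R < ‖x‖ → f (0, x) = 0) : SC f := by
  intro T
  obtain ⟨C, hC⟩ := h.bd T
  refine ⟨R + |C| * |T|, by positivity, fun p hp hx => ?_⟩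
  refine supp_bar h hf htr (B := fun t => R + |C| * t) (B' := fun _ => |C|)
    (fun t => by simpa using ((hasDerivAt_id t).const_mul |C|).const_add R)
    (fun s x hs => (hC (s, x) (hs.trans hp)).trans (le_abs_self _)) (by simpa using h0) _ (lt_of_le_of_lt ?_ hx)
  have : |p.1| ≤ |T| := hp.trans (le_abs_self _)
  gcongr

theorem tr_sq {f : PP → ℝ} {U : PP → E3} (hf : Sm f) (h : ∀ p, fderiv ℝ f p (1, U p) = 0) (p : PP) :
    fderiv ℝ (fun p => f p ^ 2) p (1, U p) = 0 := by
  rw [((hf.diff p).hasFDerivAt.pow 2).fderiv]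
  simp [h]

/-- Picard sequence -/
structure It (ξ0 : E3 → ℝ) (ξ : ℕ → PP → ℝ) : Prop where
  sm : ∀ n, Sm (ξ n)
  sc : ∀ n, SC (ξ n)
  zero : ∀ p, ξ 0 p = ξ0 p.2
  ini : ∀ n x, ξ n (0, x) = ξ0 x
  tr : ∀ n p, fderiv ℝ (ξ (n + 1)) p (1, VV (ξ n) p) = 0

theorem exists_It {ξ0 : E3 → ℝ} (h0 : Sm ξ0) {R : ℝ} (hR : 0 < R) (hs : ∀ x, R < ‖x‖ → ξ0 x = 0) :
    ∃ ξ, It ξ0 ξ := by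
  let S := {f : PP → ℝ // Sm f ∧ SC f ∧ ∀ x, f (0, x) = ξ0 x}
  have step : ∀ f : S, ∃ g : S, ∀ p, fderiv ℝ g.1 p (1, VV f.1 p) = 0 := by
    rintro ⟨f, hf, hsc, hi⟩
    obtain ⟨g, hg, hg0, hgt⟩ := transport_exists (VV_fld hf hsc) h0
    exact ⟨⟨g, hg, supp_SC (VV_fld hf hsc) hg.diff hgt hR (fun x hx => by rw [hg0, hs x hx]), hg0⟩, hgt⟩
  choose g hg using step
  let z : S := ⟨fun p => ξ0 p.2, h0.comp contDiff_snd, fun T => ⟨R, hR, fun p _ hp => hs _ hp⟩, fun x => rfl⟩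
  let s : ℕ → S := fun n => Nat.rec z (fun _ f => g f) n
  exact ⟨fun n => (s n).1, fun n => (s n).2.1, fun n => (s n).2.2.1, fun p => rfl, fun n => (s n).2.2.2,
    fun n p => hg (s n) p⟩

theorem slice_int {f : PP → ℝ} (hf : Continuous f) (hs : SC f) (t : ℝ) : Integrable (fun x => f (t, x)) :=
  Continuous.integrable_of_hasCompactSupport (by fun_prop) (slice_cs hs t)

theorem SC.sq {f : PP → ℝ} (h : SC f) : SC (fun p => f p ^ 2) := fun T => by
  obtain ⟨R, hR, h⟩ := h T
  exact ⟨R, hR, fun p h1 h2 => by simp [h p h1 h2]⟩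

theorem It.val {ξ0 ξ} (h : It ξ0 ξ) {M : ℝ} (hM : ∀ x, |ξ0 x| ≤ M) (n : ℕ) (p : PP) : |ξ n p| ≤ M := by
  cases n with
  | zero => rw [h.zero]; exact hM _
  | succ n => exact val_bd (VV_fld (h.sm n) (h.sc n)) (h.sm _).diff (h.tr n) (fun x => by rw [h.ini]; exact hM x) p

theorem It.l2 {ξ0 ξ} (h : It ξ0 ξ) (n : ℕ) (t : ℝ) : ∫ x, ξ n (t, x) ^ 2 = ∫ x, ξ0 x ^ 2 := by
  cases n with
  | zero => simp [h.zero]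
  | succ n =>
    rw [int_conserved (f := fun p => ξ (n + 1) p ^ 2) ((h.sm _).pow 2) (h.sc _).sq (VV_sm (h.sm n) (h.sc n))
      (VV_dv (h.sm n) (h.sc n)) (tr_sq (h.sm _) (h.tr n)) t]
    simp only [h.ini]

theorem It.supp {ξ0 ξ} (h : It ξ0 ξ) {R M : ℝ} (hR : 0 < R) (hs : ∀ x, R < ‖x‖ → ξ0 x = 0)
    (hM : ∀ x, |ξ0 x| ≤ M) : ∃ Λ, 0 ≤ Λ ∧ ∀ n t x, R * exp (Λ * |t|) < ‖x‖ → ξ n (t, x) = 0 := by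
  set N := ∫ x, ξ0 x ^ 2
  have hN : 0 ≤ N := integral_nonneg fun x => sq_nonneg _
  have hM0 := (abs_nonneg _).trans (hM 0)
  have hκ := κ_nn
  set Λ := (M + 1) * (κ * 2) + N
  have hΛ : 0 ≤ Λ := by positivity
  refine ⟨Λ, hΛ, fun n => ?_⟩
  induction n with
  | zero =>
    intro t x hx
    rw [h.zero]
    exact hs _ (lt_of_le_of_lt (le_mul_of_one_le_right hR.le (one_le_exp (by positivity))) hx)
  | succ n ih =>
    intro t x hx
    refine supp_bar (VV_fld (h.sm n) (h.sc n)) (h.sm _).diff (h.tr n) (B := fun t => R * exp (Λ * t))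
      (B' := fun t => R * exp (Λ * t) * Λ) (fun t => ?_) (fun s y _ => ?_) (fun y hy => ?_) x hx
    · have := (((hasDerivAt_id t).const_mul Λ).exp).const_mul R
      simpa [mul_assoc] using this
    · exact VV_le (p := (s, y)) (by positivity) (h.sm n).continuous (fun x => h.val hM n _)
        (fun x hx => ih s x hx) (h.l2 n s).le
    · rw [h.ini]; exact hs y (by simpa using hy)
end P3b

section P3c

/-- spatial gradient -/
def Dx {F : Type} [NormedAddCommGroup F] [NormedSpace ℝ F] (f : PP → F) (p : PP) : E3 →L[ℝ] F :=
  (fderiv ℝ f p).comp (.inr ℝ ℝ E3)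

theorem Dx_slice {F : Type} [NormedAddCommGroup F] [NormedSpace ℝ F] {f : PP → F} (hf : Sm f) (t : ℝ) (x : E3) :
    Dx f (t, x) = fderiv ℝ (fun x => f (t, x)) x := by
  ext1 v
  rw [slice_fderiv hf]; rfl

theorem Gx_grad {ξ : PP → ℝ} (h : Sm ξ) {t R M B : ℝ} (hR : 0 < R) (hB : ∀ x, ‖Dx ξ (t, x)‖ ≤ B)
    (hM : ∀ x, |ξ (t, x)| ≤ M) (hs : ∀ x, R < ‖x‖ → ξ (t, x) = 0) (x : E3) :
    ‖Dx (Gx ξ) (t, x)‖ ≤ R * B + M := by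
  have hM0 := (abs_nonneg _).trans (hM 0)
  have hB0 := (norm_nonneg _).trans (hB 0)
  refine ContinuousLinearMap.opNorm_le_bound _ (by positivity) fun v => ?_
  have h1 : Dx (Gx ξ) (t, x) v = ξ (t, x) • JL v + (Dx ξ (t, x) v) • JL x := by
    have h2 : HasFDerivAt (Gx ξ) _ (t, x) := (h.diff (t, x)).hasFDerivAt.smul
      ((JL.comp (ContinuousLinearMap.snd ℝ ℝ E3)).hasFDerivAt (x := (t, x)))
    rw [Dx, h2.fderiv]
    simp [Dx]
  have h3 : ‖Dx ξ (t, x)‖ * ‖x‖ ≤ R * B := by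
    by_cases hx : ‖x‖ ≤ R
    · rw [mul_comm]; exact mul_le_mul hx (hB x) (norm_nonneg _) hR.le
    · have : Dx ξ (t, x) = 0 := by
        rw [Dx_slice h]
        have : (fun x => ξ (t, x)) =ᶠ[nhds x] fun _ => 0 := by
          filter_upwards [(isOpen_lt continuous_const continuous_norm).mem_nhds (not_le.1 hx)] with y hy
          exact hs y hy
        rw [this.fderiv_eq]; simp
      rw [this, norm_zero, zero_mul]; positivity
  rw [h1]
  refine (norm_add_le _ _).trans ?_
  rw [norm_smul, norm_smul]
  have a1 : ‖ξ (t, x)‖ * ‖JL v‖ ≤ M * ‖v‖ := mul_le_mul (hM x) (JL_norm v) (norm_nonneg _) hM0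
  have a2 : ‖Dx ξ (t, x) v‖ * ‖JL x‖ ≤ (‖Dx ξ (t, x)‖ * ‖v‖) * ‖x‖ :=
    mul_le_mul (ContinuousLinearMap.le_opNorm _ _) (JL_norm x) (norm_nonneg _) (by positivity)
  have a3 := mul_le_mul_of_nonneg_right h3 (norm_nonneg v)
  nlinarith

theorem VV_grad {R M : ℝ} (hR : 0 < R) (hM : 0 ≤ M) : ∃ C, 0 ≤ C ∧ ∀ ξ : PP → ℝ, Sm ξ → SC ξ → ∀ t B : ℝ, 1 ≤ B →
    (∀ x, |ξ (t, x)| ≤ M) → (∀ x, R < ‖x‖ → ξ (t, x) = 0) → (∀ x, ‖Dx ξ (t, x)‖ ≤ B) →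
    ∀ x, ‖Dx (VV ξ) (t, x)‖ ≤ C * (1 + log B) := by
  have hκ := κ_nn
  refine ⟨6 * (R + M) * κ + 4 * (M * R) * κ * (R ^ 2 + 1), by positivity, fun ξ h hs t B hB1 hv hsup hB x => ?_⟩
  have hB0 : 0 < B := one_pos.trans_le hB1
  have hl : 0 ≤ log B := log_nonneg hB1
  refine (BR_log (ρ := B⁻¹) (M := M * R) (M1 := R * B + M) (by positivity) hR (Gx_sm h) (Gx_SC hs) (p := (t, x))
    (fun y => ?_) (Gx_grad h hR hB hv hsup) (fun y hy => by simp [Gx, hsup y hy])).trans ?_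
  · rw [Gx, norm_smul]
    by_cases hy : ‖y‖ ≤ R
    · exact mul_le_mul (hv y) ((JL_norm _).trans hy) (norm_nonneg _) hM
    · simp only [hsup y (not_le.1 hy), norm_zero, zero_mul]; positivity
  · have h1 : lg R B⁻¹ ≤ R ^ 2 + log B := by
      have hi : B⁻¹ ^ 2 ≤ 1 := pow_le_one₀ (by positivity) (inv_le_one_of_one_le₀ hB1)
      have a : log (R ^ 2 + B⁻¹ ^ 2) ≤ R ^ 2 := by
        have := log_le_sub_one_of_pos (x := R ^ 2 + B⁻¹ ^ 2) (by positivity)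
        linarith
      have b : log (B⁻¹ ^ 2) = -2 * log B := by rw [log_pow, log_inv]; push_cast; ring
      rw [lg, b]
      nlinarith [sq_nonneg R]
    have h2 : (R * B + M) * B⁻¹ ≤ R + M := by
      rw [add_mul, mul_assoc, mul_inv_cancel₀ hB0.ne', mul_one]
      have : M * B⁻¹ ≤ M * 1 := by gcongr; exact inv_le_one_of_one_le₀ hB1
      linarith
    have hpi : π / 2 ≤ 2 := by linarith [Real.pi_lt_d2]
    have h3 : 3 * (R * B + M) * (κ * (B⁻¹ * (π / 2))) ≤ 6 * (R + M) * κ := by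
      calc _ = 3 * κ * ((R * B + M) * B⁻¹) * (π / 2) := by ring
        _ ≤ 3 * κ * (R + M) * 2 := by gcongr
        _ = _ := by ring
    have h4 : 4 * (M * R) * (κ * (lg R B⁻¹ + 1)) ≤ 4 * (M * R) * κ * (R ^ 2 + 1) * (1 + log B) := by
      rw [← mul_assoc, mul_assoc _ (R ^ 2 + 1)]
      gcongr
      nlinarith [mul_nonneg (sq_nonneg R) hl]
    have h5 : 6 * (R + M) * κ ≤ 6 * (R + M) * κ * (1 + log B) := le_mul_of_one_le_right (by positivity) (by linarith)
    linarith

theorem bd_of_cs {F : Type} [NormedAddCommGroup F] {f : E3 → F} (hf : Continuous f) {R : ℝ}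
    (hs : ∀ x, R < ‖x‖ → f x = 0) : ∃ C, 0 ≤ C ∧ ∀ x, ‖f x‖ ≤ C := by
  obtain ⟨C, hC⟩ := (isCompact_closedBall (0 : E3) R).exists_bound_of_continuousOn hf.continuousOn
  refine ⟨max C 0, le_max_right _ _, fun x => ?_⟩
  by_cases h : ‖x‖ ≤ R
  · exact (hC x (by simpa using h)).trans (le_max_left _ _)
  · rw [hs x (not_le.1 h)]; simp

theorem supp_fd {f : E3 → ℝ} {R : ℝ} (hs : ∀ x, R < ‖x‖ → f x = 0) (x : E3) (hx : R < ‖x‖) : fderiv ℝ f x = 0 := by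
  have : f =ᶠ[nhds x] fun _ => 0 := by
    filter_upwards [(isOpen_lt continuous_const continuous_norm).mem_nhds hx] with y hy
    exact hs y hy
  rw [this.fderiv_eq]; simp

/-- data of a Picard sequence -/
structure ItB (ξ0 : E3 → ℝ) (ξ : ℕ → PP → ℝ) (R M Λ : ℝ) : Prop extends It ξ0 ξ where
  hR : 0 < R
  hs : ∀ x, R < ‖x‖ → ξ0 x = 0
  hM : ∀ x, |ξ0 x| ≤ M
  hΛ : 0 ≤ Λ
  hsup : ∀ n t x, R * exp (Λ * |t|) < ‖x‖ → ξ n (t, x) = 0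

variable {ξ0 : E3 → ℝ} {ξ : ℕ → PP → ℝ} {R M Λ : ℝ}

theorem ItB.rt (h : ItB ξ0 ξ R M Λ) (T : ℝ) : ∃ R', 0 < R' ∧ ∀ n (p : PP), |p.1| ≤ T → R' < ‖p.2‖ → ξ n p = 0 := by
  have := h.hR
  have := h.hΛ
  refine ⟨R * exp (Λ * T), by positivity, fun n p hp hx => h.hsup n p.1 p.2 (lt_of_le_of_lt ?_ hx)⟩
  gcongr

theorem ItB.grad (h : ItB ξ0 ξ R M Λ) (T : ℝ) : ∃ G, 0 ≤ G ∧ ∀ n (p : PP), |p.1| ≤ T → ‖Dx (ξ n) p‖ ≤ G := by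
  obtain ⟨R', hR', hs'⟩ := h.rt T
  have hM0 := (abs_nonneg _).trans (h.hM 0)
  obtain ⟨C, hC0, hC⟩ := VV_grad hR' hM0
  have hsm0 : Sm ξ0 := by
    have := slice_sm (h.sm 0) 0
    simpa only [h.zero] using this
  obtain ⟨g, hg0, hg⟩ := bd_of_cs hsm0.fderiv.continuous (supp_fd h.hs)
  set Y := g + 1
  have hY : 1 ≤ Y := by simp only [Y]; linarith
  set L := 2 * C + 1
  set B : ℝ → ℝ := fun t => exp (Y * exp (L * t))
  have hE : ∀ t, 0 ≤ t → 1 ≤ exp (L * t) := fun t ht => one_le_exp (by positivity)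
  have hB1 : ∀ t, 1 ≤ B t := fun t => one_le_exp (by positivity)
  have hgB : ∀ t, 0 ≤ t → g ≤ B t := fun t ht => by
    have h1 := add_one_le_exp (Y * exp (L * t))
    have h2 : Y * 1 ≤ Y * exp (L * t) := by gcongr; exact hE t ht
    simp only [B]; simp only [Y] at h1 h2 ⊢; linarith
  have key : ∀ n t x, |t| ≤ T → ‖Dx (ξ n) (t, x)‖ ≤ B |t| := by
    intro n
    induction n with
    | zero =>
      intro t x _
      rw [Dx_slice (h.sm 0)]
      simp only [h.zero]
      exact (hg x).trans (hgB _ (abs_nonneg t))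
    | succ n ih =>
      intro t x ht
      have hd' : Sm (Dx (ξ (n + 1))) :=
        ((ContinuousLinearMap.compL ℝ E3 PP ℝ).flip (.inr ℝ ℝ E3)).contDiff.comp (h.sm (n + 1)).fderiv
      have hd := hd'.diff
      refine TE2 (VV_fld (h.sm n) (h.sc n)) hd (T := T) (B := B) (B' := fun t => B t * (Y * (exp (L * t) * L)))
        (fun y => ?_) (fun s => ?_) (fun s y hs he => ?_) ht x
      · rw [Dx_slice (h.sm _)]
        simp only [h.ini]
        exact (hg y).trans (hgB 0 le_rfl)
      · have := ((((hasDerivAt_id s).const_mul L).exp).const_mul Y).exp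
        simpa using this
      · refine (comm_est1 (h.sm _) (VV_sm (h.sm n) (h.sc n)) (h.tr n) (s, y)).trans_lt ?_
        have h1 := hC (ξ n) (h.sm n) (h.sc n) s (B |s|) (hB1 _) (fun x => h.val h.hM n _)
          (fun x hx => hs' n _ hs.le hx) (fun x => ih s x hs.le) y
        change ‖Dx (ξ (n + 1)) (s, y)‖ * ‖Dx (VV (ξ n)) (s, y)‖ < _
        rw [he]
        have hBp : 0 < B |s| := one_pos.trans_le (hB1 _)
        refine mul_lt_mul_of_pos_left (h1.trans_lt ?_) hBp
        have h2 := hE |s| (abs_nonneg s)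
        have h3 : log (B |s|) = Y * exp (L * |s|) := log_exp _
        rw [h3]
        have h4 : 1 ≤ Y * exp (L * |s|) := by nlinarith
        simp only [L] at *
        nlinarith
  refine ⟨B |T|, (one_pos.trans_le (hB1 _)).le, fun n p hp => (key n p.1 p.2 hp).trans ?_⟩
  have : |p.1| ≤ |T| := hp.trans (le_abs_self _)
  simp only [B, L]
  gcongr

theorem VV_flat {h : PP → ℝ} (hh : Sm h) (hs : SC h) {k : ℕ} (hf : Flat k h) : Flat k (VV h) := by
  intro i hi x
  have h1 : Flat k (Gx h) :=
    Flat.bilL (ContinuousLinearMap.lsmul ℝ ℝ : ℝ →L[ℝ] E3 →L[ℝ] E3) (g := fun p : PP => JL p.2) hh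
      (JL.contDiff.comp contDiff_snd) hf
  have := Kop_itd i (BR_meas 0) (BR_le 0) zero_le_one (Gx_sm hh) (Gx_SC hs) (p := (0, x)) (R := 1) (M := 0) one_pos
    (fun y => by rw [h1 i hi, norm_zero]) (fun y _ => h1 i hi y)
  exact norm_le_zero_iff.1 (this.trans (by simp))

theorem SC.sub {f g : PP → ℝ} (hf : SC f) (hg : SC g) : SC (fun p => f p - g p) := fun T => by
  obtain ⟨R, hR, h⟩ := hf T
  obtain ⟨R', hR', h'⟩ := hg T
  exact ⟨max R R', lt_max_of_lt_left hR, fun p h1 h2 => by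
    change f p - g p = 0
    rw [h p h1 ((le_max_left _ _).trans_lt h2), h' p h1 ((le_max_right _ _).trans_lt h2), sub_zero]⟩

theorem VV_sub {f g : PP → ℝ} (hf : Continuous f) (hsf : SC f) (hg : Continuous g) (hsg : SC g) (p : PP) :
    VV f p - VV g p = VV (fun p => f p - g p) p := by
  have hc : ∀ {ξ : PP → ℝ}, Continuous ξ → Continuous (Gx ξ) := fun h =>
    h.smul (JL.continuous.comp continuous_snd)
  rw [VV, VV, Kop_sub (BR_meas 0) (BR_le 0) zero_le_one (hc hf) (Gx_SC hsf) (hc hg) (Gx_SC hsg), VV]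
  congr 1
  funext q
  simp [Gx, sub_smul]

theorem tr_diff {f g : PP → ℝ} {U V : PP → E3} (hf : Sm f) (hg : Sm g) (h : ∀ p, fderiv ℝ f p (1, U p) = 0)
    (h' : ∀ p, fderiv ℝ g p (1, V p) = 0) (p : PP) :
    fderiv ℝ (fun p => f p - g p) p (1, U p) = -(Dx g p (U p - V p)) := by
  have e : ((1, U p) : PP) = (1, V p) + (0, U p - V p) := by simp
  rw [fderiv_fun_sub (hf.diff p) (hg.diff p), sub_apply, h, e, map_add, h']
  simp [Dx]

theorem It.flat (h : It ξ0 ξ) (n : ℕ) : Flat (n + 1) (fun p => ξ (n + 1) p - ξ n p) := by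
  induction n with
  | zero =>
    intro i hi x
    obtain rfl : i = 0 := by omega
    rw [← norm_eq_zero, norm_iteratedFDeriv_zero]
    simp [h.ini]
  | succ n ih =>
    have s1 : Sm (fun p => ξ (n + 1) p - ξ n p) := (h.sm _).sub (h.sm _)
    have s2 : SC (fun p => ξ (n + 1) p - ξ n p) := (h.sc _).sub (h.sc _)
    have s3 : Sm (fun p => (-inrL ℝ) (fderiv ℝ (ξ (n + 1)) p)) := (ContinuousLinearMap.contDiff _).comp (h.sm _).fderiv
    refine flat_tr (n + 1) (g := fun p => (-inrL ℝ) (fderiv ℝ (ξ (n + 1)) p) (VV (fun p => ξ (n + 1) p - ξ n p) p))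
      ((h.sm _).sub (h.sm _)) (s3.clm_apply (VV_sm s1 s2)) (VV_sm (h.sm (n + 1)) (h.sc (n + 1)))
      (fun x => by simp [h.ini]) (fun p => ?_) ?_
    · rw [tr_diff (h.sm _) (h.sm _) (h.tr (n + 1)) (h.tr n),
        VV_sub (h.sm _).continuous (h.sc _) (h.sm _).continuous (h.sc _)]
      rfl
    · exact Flat.bilR (ContinuousLinearMap.id ℝ (E3 →L[ℝ] ℝ)) s3 (VV_sm s1 s2) (VV_flat s1 s2 ih)

end P3c

section P3d
variable {ξ0 : E3 → ℝ} {ξ : ℕ → PP → ℝ} {R M Λ : ℝ}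

theorem itd_lb {f : PP → ℝ} (hf : Sm f) (hs : SC f) (k : ℕ) : LB (iteratedFDeriv ℝ k f) := by
  intro T
  obtain ⟨R, hR, hR'⟩ := hs (T + 1)
  obtain ⟨C, hC0, hC⟩ := cpt_bd (hf.itd k).continuous T R
  refine ⟨C, fun p hp => ?_⟩
  by_cases h2 : ‖p.2‖ ≤ R
  · exact hC p hp h2
  · rw [itd_supp k (T := T + 1) (fun q hq hq2 => hR' q hq.le hq2) p (by linarith) (not_le.1 h2), norm_zero]
    exact hC0

theorem It.init (h : It ξ0 ξ) (k : ℕ) : ∃ C, 0 ≤ C ∧ ∀ n x, ‖iteratedFDeriv ℝ k (ξ n) (0, x)‖ ≤ C := by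
  choose c hc using fun n => itd_lb (h.sm n) (h.sc n) k 0
  have hc' : ∀ n x, ‖iteratedFDeriv ℝ k (ξ n) (0, x)‖ ≤ c n := fun n x => hc n (0, x) (by simp)
  have hc0 : ∀ n, 0 ≤ c n := fun n => (norm_nonneg _).trans (hc' n 0)
  have hst : ∀ n, k ≤ n → ∀ x, iteratedFDeriv ℝ k (ξ n) (0, x) = iteratedFDeriv ℝ k (ξ k) (0, x) := by
    intro n hn
    induction n, hn using Nat.le_induction with
    | base => intro x; rfl
    | succ n hn ih =>
      intro x
      have h1 := h.flat n k (by omega) x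
      have h2 := iteratedFDeriv_sub_apply (i := k) (x := ((0, x) : PP)) ((h.sm (n + 1)).contDiffAt.of_le (nle k))
        ((h.sm n).contDiffAt.of_le (nle k))
      have h3 : iteratedFDeriv ℝ k (ξ (n + 1) - ξ n) (0, x) = 0 := h1
      rw [h3] at h2
      rw [← ih, ← sub_eq_zero, ← h2]
  refine ⟨∑ n ∈ Finset.range (k + 1), c n, Finset.sum_nonneg fun n _ => hc0 n, fun n x => ?_⟩
  have hle : ∀ n ≤ k, c n ≤ ∑ n ∈ Finset.range (k + 1), c n := fun n hn =>
    Finset.single_le_sum (f := c) (fun n _ => hc0 n) (Finset.mem_range.2 (by omega))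
  rcases le_total k n with hn | hn
  · rw [hst n hn]; exact (hc' k x).trans (hle k le_rfl)
  · exact (hc' n x).trans (hle n hn)

theorem ItB.ub (h : ItB ξ0 ξ R M Λ) : UB ξ := by
  have hM0 := (abs_nonneg _).trans (h.hM 0)
  intro k
  induction k using Nat.strong_induction_on with
  | _ k ih =>
  intro T
  obtain ⟨R', hR', hs'⟩ := h.rt (T + 1)
  have hlt : ∀ {t : ℝ}, |t| ≤ T → |t| < T + 1 := fun h => by linarith
  choose C hC0 hC using fun m => VV_itd m (T + 1) hR'
  have hVV : ∀ n m (p : PP), |p.1| ≤ T → ∀ M, (∀ x i, i ≤ m → ‖iteratedFDeriv ℝ i (ξ n) (p.1, x)‖ ≤ M) →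
      ‖iteratedFDeriv ℝ m (VV (ξ n)) p‖ ≤ C m * M := fun n m p hp M hM =>
    hC m (ξ n) (h.sm n) (h.sc n) (fun q hq hq2 => hs' n q hq.le hq2) p.1 (hlt hp) M hM p.2
  obtain ⟨c0, hc0⟩ := itd_lb (h.sm 0) (h.sc 0) k T
  match k, ih, hc0 with
  | 0, _, _ => exact ⟨M, fun n p _ => by rw [norm_iteratedFDeriv_zero]; exact h.val h.hM n p⟩
  | 1, _, hc0 =>
    obtain ⟨G, hG0, hG⟩ := h.grad T
    refine ⟨max c0 (G * (1 + C 0 * M)), fun n p hp => ?_⟩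
    cases n with
    | zero => exact (hc0 p hp).trans (le_max_left _ _)
    | succ n =>
      refine le_trans ?_ (le_max_right _ _)
      rw [← norm_iteratedFDeriv_fderiv, norm_iteratedFDeriv_zero]
      have hU : ‖VV (ξ n) p‖ ≤ C 0 * M := by
        have := hVV n 0 p hp M (fun x i hi => by
          obtain rfl : i = 0 := by omega
          rw [norm_iteratedFDeriv_zero]; exact h.val h.hM n _)
        rwa [norm_iteratedFDeriv_zero] at this
      have hCM : 0 ≤ C 0 * M := (norm_nonneg _).trans hU
      refine ContinuousLinearMap.opNorm_le_bound _ (by positivity) fun v => ?_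
      have h3 : v = v.1 • (1, VV (ξ n) p) + (0, v.2 - v.1 • VV (ξ n) p) := by simp
      have h4 : fderiv ℝ (ξ (n + 1)) p v = Dx (ξ (n + 1)) p (v.2 - v.1 • VV (ξ n) p) := by
        conv_lhs => rw [h3, map_add, map_smul, h.tr n, smul_zero, zero_add]
        rfl
      rw [h4]
      refine (ContinuousLinearMap.le_opNorm _ _).trans ?_
      rw [mul_assoc]
      refine mul_le_mul (hG _ p hp) ?_ (norm_nonneg _) hG0
      refine (norm_sub_le _ _).trans ?_
      rw [norm_smul]
      have h5 : ‖v.1‖ * ‖VV (ξ n) p‖ ≤ ‖v‖ * (C 0 * M) := mul_le_mul (norm_fst_le v) hU (norm_nonneg _) (norm_nonneg _)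
      linarith [norm_snd_le v]
  | k + 2, ih, hc0 =>
    choose! P hP using fun j (hj : j < k + 2) => ih j hj T
    obtain ⟨c1, hc10, hc1⟩ := h.toIt.init (k + 2)
    set Q := 1 + ∑ j ∈ Finset.range (k + 2), |P j| with hQ
    have hQ1 : 1 ≤ Q := by
      have : 0 ≤ ∑ j ∈ Finset.range (k + 2), |P j| := Finset.sum_nonneg fun j _ => abs_nonneg _
      linarith
    have hPQ : ∀ j < k + 2, ∀ n (p : PP), |p.1| ≤ T → ‖iteratedFDeriv ℝ j (ξ n) p‖ ≤ Q := fun j hj n p hp => by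
      have h1 := Finset.single_le_sum (f := fun j => |P j|) (fun n _ => abs_nonneg _) (Finset.mem_range.2 hj)
      have h2 := hP j hj n p hp
      have := le_abs_self (P j)
      linarith
    set K := ∑ j ∈ Finset.range (k + 3), C j with hK
    have hK0 : 0 ≤ K := Finset.sum_nonneg fun j _ => hC0 j
    have hCK : ∀ j ≤ k + 2, C j ≤ K := fun j hj =>
      Finset.single_le_sum (f := C) (fun n _ => hC0 n) (Finset.mem_range.2 (by omega))
    set Y := Q + c1 + |c0| with hY
    set L := 2 ^ (k + 2) * (Q * K) + 1 with hL
    have hL0 : 0 ≤ L := by positivity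
    set B : ℝ → ℝ := fun t => Y * exp (L * t) with hB
    have hY0 : 0 < Y := by positivity
    have hYB : ∀ t, 0 ≤ t → Y ≤ B t := fun t ht => le_mul_of_one_le_right hY0.le (one_le_exp (by positivity))
    have key : ∀ n t x, |t| ≤ T → ‖iteratedFDeriv ℝ (k + 2) (ξ n) (t, x)‖ ≤ B |t| := by
      intro n
      induction n with
      | zero =>
        intro t x ht
        refine (hc0 (t, x) ht).trans (le_trans ?_ (hYB _ (abs_nonneg _)))
        have := le_abs_self c0
        rw [hY]; linarith
      | succ n ihn =>
        intro t x ht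
        refine TE2 (VV_fld (h.sm n) (h.sc n)) ((h.sm (n + 1)).itd (k + 2)).diff (T := T) (B := B)
          (B' := fun t => Y * (exp (L * t) * L)) (fun y => ?_) (fun s => ?_) (fun s y hs he => ?_) ht x
        · refine (hc1 _ y).trans (le_trans ?_ (hYB _ le_rfl))
          have := abs_nonneg c0
          rw [hY]; linarith
        · simpa using (((hasDerivAt_id s).const_mul L).exp).const_mul Y
        · have hBp : 0 < B |s| := hY0.trans_le (hYB _ (abs_nonneg _))
          have hQB : Q ≤ B |s| := le_trans (by rw [hY]; have := abs_nonneg c0; linarith) (hYB _ (abs_nonneg _))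
          have hall : ∀ x i, i ≤ k + 2 → ‖iteratedFDeriv ℝ i (ξ n) (s, x)‖ ≤ B |s| := fun x i hi => by
            rcases hi.lt_or_eq with hi | rfl
            · exact (hPQ i hi n (s, x) hs.le).trans hQB
            · exact ihn s x hs.le
          have hterm : ∀ i ∈ Finset.range (k + 2), ((k + 2).choose i : ℝ) * ‖iteratedFDeriv ℝ (i + 1) (ξ (n + 1)) (s, y)‖ *
              ‖iteratedFDeriv ℝ (k + 2 - i) (VV (ξ n)) (s, y)‖ ≤ ((k + 2).choose i : ℝ) * (Q * K * B |s|) := by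
            intro i hi
            rw [mul_assoc]
            refine mul_le_mul_of_nonneg_left ?_ (by positivity)
            have hi' : i < k + 2 := Finset.mem_range.1 hi
            rcases Nat.eq_zero_or_pos i with rfl | hi0
            · have a1 := hPQ 1 (by omega) (n + 1) (s, y) hs.le
              have a2 := hVV n (k + 2) (s, y) hs.le (B |s|) hall
              calc _ ≤ Q * (C (k + 2) * B |s|) := mul_le_mul a1 a2 (norm_nonneg _) (by positivity)
                _ ≤ Q * (K * B |s|) := by gcongr; exact hCK _ le_rfl
                _ = _ := by ring
            · have a1 : ‖iteratedFDeriv ℝ (i + 1) (ξ (n + 1)) (s, y)‖ ≤ B |s| := by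
                rcases (Nat.succ_le_of_lt hi').lt_or_eq with hj | hj
                · exact (hPQ _ hj (n + 1) (s, y) hs.le).trans hQB
                · rw [← he, ← hj]
              have a2 := hVV n (k + 2 - i) (s, y) hs.le Q (fun x j hj => hPQ j (by omega) n (s, x) hs.le)
              calc _ ≤ B |s| * (C (k + 2 - i) * Q) := mul_le_mul a1 a2 (norm_nonneg _) (by positivity)
                _ ≤ B |s| * (K * Q) := by gcongr; exact hCK _ (by omega)
                _ = _ := by ring
          refine (comm_est (h.sm _) (VV_sm (h.sm n) (h.sc n)) (h.tr n) (k + 2) (s, y)).trans_lt ?_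
          refine (Finset.sum_le_sum hterm).trans_lt ?_
          rw [← Finset.sum_mul]
          have hch : (∑ i ∈ Finset.range (k + 2), ((k + 2).choose i : ℝ)) ≤ 2 ^ (k + 2) := by
            have h1 := Nat.sum_range_choose (k + 2)
            rw [Finset.sum_range_succ] at h1
            have h2 : ∑ i ∈ Finset.range (k + 2), (k + 2).choose i ≤ 2 ^ (k + 2) := by omega
            exact_mod_cast h2
          have h3 := mul_le_mul_of_nonneg_right hch (by positivity : 0 ≤ Q * K * B |s|)
          have h4 : Y * (exp (L * |s|) * L) = B |s| * L := by rw [hB]; ring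
          rw [h4, hL]
          nlinarith
    refine ⟨B |T|, fun n p hp => (key n p.1 p.2 hp).trans ?_⟩
    have : |p.1| ≤ |T| := hp.trans (le_abs_self _)
    simp only [hB]
    gcongr

theorem diff_step {R G T b : ℝ} (hR : 0 < R) (hG0 : 0 ≤ G) (hb : 0 < b) {ξ η f g : PP → ℝ} (hξ : Sm ξ) (sξ : SC ξ)
    (hη : Sm η) (sη : SC η) (hf : Sm f) (hg : Sm g) (tf : ∀ p, fderiv ℝ f p (1, VV ξ p) = 0)
    (tg : ∀ p, fderiv ℝ g p (1, VV η p) = 0) (h0 : ∀ x, f (0, x) = g (0, x))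
    (bξ : ∀ p : PP, |p.1| ≤ T → R < ‖p.2‖ → ξ p = 0) (bη : ∀ p : PP, |p.1| ≤ T → R < ‖p.2‖ → η p = 0)
    (hG : ∀ p : PP, |p.1| ≤ T → ‖Dx g p‖ ≤ G)
    (hd : ∀ p : PP, |p.1| ≤ T → |ξ p - η p| ≤ b * exp ((2 * G * R * (κ * 3 * R) + 1) * |p.1|)) :
    ∀ p : PP, |p.1| ≤ T → |f p - g p| ≤ b / 2 * exp ((2 * G * R * (κ * 3 * R) + 1) * |p.1|) := by
  set L := 2 * G * R * (κ * 3 * R) + 1 with hL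
  intro p hp
  have hfg : Sm (fun p => f p - g p) := hf.sub hg
  refine TE2 (VV_fld hξ sξ) hfg.diff (T := T) (B := fun t => b / 2 * exp (L * t))
    (B' := fun t => b / 2 * (exp (L * t) * L)) (fun y => ?_) (fun s => ?_) (fun s y hs he => ?_) hp p.2
  · rw [h0, sub_self, norm_zero]; positivity
  · simpa using (((hasDerivAt_id s).const_mul L).exp).const_mul (b / 2)
  · rw [tr_diff hf hg tf tg, norm_neg]
    refine (ContinuousLinearMap.le_opNorm _ _).trans_lt ?_
    have h1 := VV_diff hξ.continuous sξ hη.continuous sη (p := (s, y)) (M := b * exp (L * |s|)) hR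
      (fun x => hd (s, x) hs.le) (fun x hx => bξ (s, x) hs.le hx) (fun x hx => bη (s, x) hs.le hx)
    refine (mul_le_mul (hG (s, y) hs.le) h1 (norm_nonneg _) hG0).trans_lt ?_
    have h2 : 0 < b * exp (L * |s|) := by positivity
    have h3 : b / 2 * (exp (L * |s|) * L) = (b * exp (L * |s|)) * (G * R * (κ * 3 * R)) + b * exp (L * |s|) / 2 := by
      conv_lhs => rw [hL]
      rw [← hL]; ring
    rw [h3]
    nlinarith

theorem ItB.cau (h : ItB ξ0 ξ R M Λ) : SCau ξ := by
  have hM0 := (abs_nonneg _).trans (h.hM 0)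
  have hM := h.hM
  intro T ε hε
  obtain ⟨R', hR', hs'⟩ := h.rt T
  obtain ⟨G, hG0, hG⟩ := h.grad T
  set L := 2 * G * R' * (κ * 3 * R') + 1 with hL
  have hκ := κ_nn
  have hL0 : 0 ≤ L := by positivity
  have key : ∀ n (p : PP), |p.1| ≤ T → |ξ (n + 1) p - ξ n p| ≤ (2 * M + 1) / 2 ^ n * exp (L * |p.1|) := by
    intro n
    induction n with
    | zero =>
      intro p _
      have h1 := h.val hM 1 p
      have h2 := h.val hM 0 p
      have h3 : 1 ≤ exp (L * |p.1|) := one_le_exp (by positivity)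
      have := abs_sub (ξ 1 p) (ξ 0 p)
      simp only [zero_add, pow_zero, div_one]
      nlinarith
    | succ n ih =>
      have := diff_step hR' hG0 (b := (2 * M + 1) / 2 ^ n) (by positivity) (h.sm (n + 1)) (h.sc _) (h.sm n) (h.sc n)
        (h.sm (n + 2)) (h.sm (n + 1)) (h.tr _) (h.tr _) (fun x => by rw [h.ini, h.ini]) (hs' _) (hs' _) (hG _) ih
      rw [pow_succ, ← div_div]
      exact this
  set K := (2 * M + 1) * exp (L * |T|) with hK
  have key2 : ∀ n j (p : PP), |p.1| ≤ T → |ξ (n + j) p - ξ n p| ≤ 2 * K / 2 ^ n - 2 * K / 2 ^ (n + j) := by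
    intro n j p hp
    induction j with
    | zero => simp
    | succ j ih =>
      have h1 := key (n + j) p hp
      have h2 : (2 * M + 1) / 2 ^ (n + j) * exp (L * |p.1|) ≤ K / 2 ^ (n + j) := by
        rw [hK, div_mul_eq_mul_div]
        have : |p.1| ≤ |T| := hp.trans (le_abs_self _)
        gcongr
      have h3 := abs_sub_le (ξ (n + j + 1) p) (ξ (n + j) p) (ξ n p)
      have h4 : 2 * K / 2 ^ (n + (j + 1)) = K / 2 ^ (n + j) := by
        rw [← add_assoc, pow_succ]; field_simp
      rw [h4, ← add_assoc]
      have h5 : 2 * K / 2 ^ (n + j) = K / 2 ^ (n + j) + K / 2 ^ (n + j) := by ring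
      linarith
  have hK0 : 0 < K := by positivity
  obtain ⟨N, hN⟩ := exists_pow_lt_of_lt_one (show 0 < ε / (4 * K) by positivity) (show (1 / 2 : ℝ) < 1 by norm_num)
  have hsm : ∀ n ≥ N, ∀ p : PP, |p.1| ≤ T → |ξ n p - ξ N p| ≤ ε / 2 := fun n hn p hp => by
    obtain ⟨j, rfl⟩ := Nat.exists_eq_add_of_le hn
    refine (key2 N j p hp).trans ?_
    have : 0 ≤ 2 * K / 2 ^ (N + j) := by positivity
    rw [lt_div_iff₀ (by positivity), one_div, inv_pow] at hN
    have h2 : 2 * K / 2 ^ N = ((2 ^ N)⁻¹ * (4 * K)) / 2 := by ring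
    rw [h2]; linarith
  refine ⟨N, fun m hm n hn p hp => ?_⟩
  have h1 := hsm m hm p hp
  have h2 := hsm n hn p hp
  rw [Real.norm_eq_abs]
  have := abs_sub_le (ξ m p) (ξ N p) (ξ n p)
  rw [abs_sub_comm (ξ N p)] at this
  linarith

/-- smooth global solution in the variable xi -/
structure Sol (ξ0 : E3 → ℝ) (ξ : PP → ℝ) : Prop where
  sm : Sm ξ
  sc : SC ξ
  ini : ∀ x, ξ (0, x) = ξ0 x
  tr : ∀ p, fderiv ℝ ξ p (1, VV ξ p) = 0

theorem exists_Sol {ξ0 : E3 → ℝ} (h0 : Sm ξ0) {R : ℝ} (hR : 0 < R) (hs : ∀ x, R < ‖x‖ → ξ0 x = 0) :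
    ∃ ξ, Sol ξ0 ξ := by
  obtain ⟨ξ, hξ⟩ := exists_It h0 hR hs
  obtain ⟨M, hM0, hM⟩ := bd_of_cs h0.continuous hs
  obtain ⟨Λ, hΛ, hsup⟩ := hξ.supp hR hs hM
  have h : ItB ξ0 ξ R M Λ := { hξ with hR := hR, hs := hs, hM := hM, hΛ := hΛ, hsup := hsup }
  obtain ⟨g, hg⟩ := h.cau.lim
  have hgs : Sm g := hg.sm h.sm h.ub
  have hgT : ∀ T, ∃ R', 0 < R' ∧ (∀ n (p : PP), |p.1| ≤ T → R' < ‖p.2‖ → ξ n p = 0) ∧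
      ∀ p : PP, |p.1| ≤ T → R' < ‖p.2‖ → g p = 0 := fun T => by
    obtain ⟨R', hR', h'⟩ := h.rt T
    refine ⟨R', hR', h', fun p hp hx => tendsto_nhds_unique (hg.tendsto p) ?_⟩
    simp only [h' _ p hp hx]
    exact tendsto_const_nhds
  have hgc : SC g := fun T => by
    obtain ⟨R', hR', _, h'⟩ := hgT T
    exact ⟨R', hR', h'⟩
  refine ⟨g, hgs, hgc, fun x => tendsto_nhds_unique (hg.tendsto (0, x)) ?_, fun p => ?_⟩
  · simp only [h.ini]; exact tendsto_const_nhds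
  · have hV : Tendsto (fun n => VV (ξ n) p) atTop (nhds (VV g p)) := by
      obtain ⟨R', hR', h1, h2⟩ := hgT |p.1|
      have hκ := κ_nn
      refine Metric.tendsto_atTop.2 fun ε hε => ?_
      set K := R' * (κ * 3 * R') + 1
      have hK : 0 < K := by positivity
      obtain ⟨N, hN⟩ := hg |p.1| (ε / (2 * K)) (by positivity)
      refine ⟨N, fun n hn => ?_⟩
      rw [dist_eq_norm]
      refine (VV_diff (h.sm n).continuous (h.sc n) hgs.continuous hgc hR' (fun x => hN n hn (p.1, x) le_rfl)
        (fun x hx => h1 n (p.1, x) le_rfl hx) (fun x hx => h2 (p.1, x) le_rfl hx)).trans_lt ?_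
      have : ε / (2 * K) * R' * (κ * 3 * R') ≤ ε / (2 * K) * K := by
        rw [mul_assoc]; gcongr; simp only [K]; linarith
      have h5 : ε / (2 * K) * K = ε / 2 := by field_simp
      linarith
    have h1 := (hg.fderiv_tendsto h.sm h.ub p).comp (tendsto_add_atTop_nat 1)
    have h2 : Tendsto (fun n => ((1, VV (ξ n) p) : PP)) atTop (nhds (1, VV g p)) := tendsto_const_nhds.prodMk_nhds hV
    have h3 := ((isBoundedBilinearMap_apply (𝕜 := ℝ) (E := PP) (F := ℝ)).continuous.tendsto (fderiv ℝ g p, (1, VV g p))).comp (h1.prodMk_nhds h2)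
    exact tendsto_nhds_unique h3 (tendsto_const_nhds.congr fun n => (h.tr n p).symm)

theorem Dx_lb {f : PP → ℝ} (hf : Sm f) (hs : SC f) : LB (Dx f) := fun T => by
  obtain ⟨C, hC⟩ := itd_lb hf hs 1 T
  refine ⟨C, fun p hp => ?_⟩
  have h1 := hC p hp
  rw [← norm_iteratedFDeriv_fderiv, norm_iteratedFDeriv_zero] at h1
  refine ((ContinuousLinearMap.opNorm_comp_le _ _).trans ?_).trans h1
  exact mul_le_of_le_one_right (norm_nonneg _) (ContinuousLinearMap.norm_inr_le_one ℝ ℝ E3)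

theorem Sol.unique {ξ0 : E3 → ℝ} {f g : PP → ℝ} (hf : Sol ξ0 f) (hg : Sol ξ0 g) : f = g := by
  funext p
  obtain ⟨R1, hR1, h1⟩ := hf.sc |p.1|
  obtain ⟨R2, hR2, h2⟩ := hg.sc |p.1|
  obtain ⟨G, hG⟩ := Dx_lb hg.sm hg.sc |p.1|
  obtain ⟨M1, hM1⟩ := hf.sc.lb hf.sm.continuous |p.1|
  obtain ⟨M2, hM2⟩ := hg.sc.lb hg.sm.continuous |p.1|
  have hG0 := (norm_nonneg _).trans (hG p le_rfl)
  have m1 := (norm_nonneg _).trans (hM1 p le_rfl)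
  have m2 := (norm_nonneg _).trans (hM2 p le_rfl)
  set R := max R1 R2
  have hR : 0 < R := lt_max_of_lt_left hR1
  set L := 2 * G * R * (κ * 3 * R) + 1 with hL
  have hκ := κ_nn
  have hL0 : 0 ≤ L := by positivity
  have key : ∀ n : ℕ, ∀ q : PP, |q.1| ≤ |p.1| → |f q - g q| ≤ (M1 + M2 + 1) / 2 ^ n * exp (L * |q.1|) := by
    intro n
    induction n with
    | zero =>
      intro q hq
      have a1 := hM1 q hq
      have a2 := hM2 q hq
      have h3 : 1 ≤ exp (L * |q.1|) := one_le_exp (by positivity)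
      have := abs_sub (f q) (g q)
      rw [Real.norm_eq_abs] at a1 a2
      simp only [pow_zero, div_one]
      nlinarith
    | succ n ih =>
      rw [pow_succ, ← div_div]
      exact diff_step hR hG0 (by positivity) hf.sm hf.sc hg.sm hg.sc hf.sm hg.sm hf.tr hg.tr
        (fun x => by rw [hf.ini, hg.ini]) (fun q hq hx => h1 q hq ((le_max_left _ _).trans_lt hx))
        (fun q hq hx => h2 q hq ((le_max_right _ _).trans_lt hx)) (fun q hq => hG q hq) ih
  have hlim : Tendsto (fun n : ℕ => (M1 + M2 + 1) / 2 ^ n * exp (L * |p.1|)) atTop (nhds 0) := by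
    have := ((tendsto_pow_atTop_nhds_zero_of_lt_one (r := (1 / 2 : ℝ)) (by norm_num) (by norm_num)).const_mul
      (M1 + M2 + 1)).mul_const (exp (L * |p.1|))
    simp only [mul_zero, zero_mul] at this
    refine this.congr fun n => ?_
    rw [one_div, inv_pow]; ring
  have := ge_of_tendsto' hlim fun n => key n p le_rfl
  exact sub_eq_zero.1 (abs_nonpos_iff.1 this)
end P3d

section Equiv

def At (c s e : ℝ) (h1 : c ^ 2 + s ^ 2 = 1) (h2 : e ^ 2 = 1) : E3 ≃ₗᵢ[ℝ] E3 :=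
  LinearIsometry.toLinearIsometryEquiv
    { toFun := fun x => mk3 (c * x 0 - s * x 1) (s * x 0 + c * x 1) (e * x 2)
      map_add' := fun a b => ext3 (by simp [mk3_0]; ring) (by simp [mk3_1]; ring) (by simp [mk3_2]; ring)
      map_smul' := fun a b => ext3 (by simp [mk3_0]; ring) (by simp [mk3_1]; ring) (by simp [mk3_2]; ring)
      norm_map' := fun x => by
        refine (sq_eq_sq₀ (norm_nonneg _) (norm_nonneg _)).1 ?_
        rw [nsq, nsq]
        simp only [LinearMap.coe_mk, AddHom.coe_mk, mk3_0, mk3_1, mk3_2]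
        linear_combination (x 0 ^ 2 + x 1 ^ 2) * h1 + x 2 ^ 2 * h2 } rfl

theorem At_apply {c s e : ℝ} (h1 : c ^ 2 + s ^ 2 = 1) (h2 : e ^ 2 = 1) (x : E3) :
    At c s e h1 h2 x = mk3 (c * x 0 - s * x 1) (s * x 0 + c * x 1) (e * x 2) := rfl

structure Sy (A : E3 ≃ₗᵢ[ℝ] E3) (d : ℝ) : Prop where
  J : ∀ y, JL (A y) = A (JL y)
  X : ∀ a b, cross3 (A a) (A b) = d • A (cross3 a b)
  d2 : d ^ 2 = 1

theorem At_Sy {c s e : ℝ} (h1 : c ^ 2 + s ^ 2 = 1) (h2 : e ^ 2 = 1) : Sy (At c s e h1 h2) e where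
  d2 := h2
  J := fun y => by
    apply ext3 <;> simp only [At_apply, JL_apply, mk3_0, mk3_1, mk3_2] <;> ring
  X := fun a b => by
    apply ext3 <;> simp only [At_apply, cross3, PiLp.smul_apply, smul_eq_mul, mk3_0, mk3_1, mk3_2]
    · ring
    · ring
    · linear_combination (a 0 * b 1 - a 1 * b 0) * h1 - (a 0 * b 1 - a 1 * b 0) * h2

theorem Sy.VVe {A : E3 ≃ₗᵢ[ℝ] E3} {d : ℝ} (h : Sy A d) (f : PP → ℝ) (t : ℝ) (x : E3) :
    A (VV (fun p => f (p.1, A p.2)) (t, x)) = d • VV f (t, A x) := by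
  have e := A.measurePreserving.integral_comp A.toHomeomorph.measurableEmbedding
    (fun z => BR 0 z (Gx f (t, A x - z)))
  unfold VV Kop
  simp only
  rw [← e, ← integral_smul]
  refine (A.toContinuousLinearEquiv.integral_comp_comm _).symm.trans ?_
  congr 1
  funext z
  simp only [BR, BK_apply, Gx, kk]
  rw [← map_sub, A.norm_map, h.J, ← A.map_smul, ← A.map_smul, h.X, smul_comm d, smul_smul d d, ← pow_two, h.d2, one_smul]
  exact A.map_smul _ _

theorem VV_smul (c : ℝ) (f : PP → ℝ) (p : PP) : VV (fun p => c * f p) p = c • VV f p := by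
  unfold VV Kop
  rw [← integral_smul]
  simp only [Gx, mul_smul, map_smul]

theorem fd_A {A : E3 ≃ₗᵢ[ℝ] E3} {f : PP → ℝ} (hf : Sm f) (t : ℝ) (x : E3) (v : E3) (d : ℝ) :
    fderiv ℝ (fun p : PP => d * f (p.1, A p.2)) (t, x) (1, v) = d * fderiv ℝ f (t, A x) (1, A v) := by
  have h1 : HasFDerivAt (fun p : PP => (p.1, A p.2))
      ((ContinuousLinearMap.fst ℝ ℝ E3).prod (A.toContinuousLinearEquiv.toContinuousLinearMap.comp (.snd ℝ ℝ E3))) (t, x) :=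
    hasFDerivAt_fst.prodMk (A.toContinuousLinearEquiv.toContinuousLinearMap.hasFDerivAt.comp (t, x) hasFDerivAt_snd)
  have h2 := (HasFDerivAt.comp (t, x) (hf.diff (t, A x)).hasFDerivAt h1).const_mul d
  have e : fderiv ℝ (fun p : PP => d * f (p.1, A p.2)) (t, x) = _ := h2.fderiv
  rw [e]; rfl

theorem Sm.compA {A : E3 ≃ₗᵢ[ℝ] E3} {f : PP → ℝ} (hf : Sm f) (d : ℝ) : Sm (fun p : PP => d * f (p.1, A p.2)) :=
  contDiff_const.mul (hf.comp (contDiff_fst.prodMk (A.contDiff.comp contDiff_snd)))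

theorem SC.compA {A : E3 ≃ₗᵢ[ℝ] E3} {f : PP → ℝ} (hf : SC f) (d : ℝ) : SC (fun p : PP => d * f (p.1, A p.2)) := fun T => by
  obtain ⟨R, hR, h⟩ := hf T
  exact ⟨R, hR, fun p h1 h2 => by simp only [h (p.1, A p.2) h1 (by simpa using h2), mul_zero]⟩

theorem Sy.VVd {A : E3 ≃ₗᵢ[ℝ] E3} {d : ℝ} (h : Sy A d) (f : PP → ℝ) (t : ℝ) (x : E3) :
    A (VV (fun p => d * f (p.1, A p.2)) (t, x)) = VV f (t, A x) := by
  rw [VV_smul d (fun p : PP => f (p.1, A p.2)), A.map_smul, h.VVe, smul_smul, ← pow_two, h.d2, one_smul]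

theorem Sol.sym {ξ0 : E3 → ℝ} {ξ : PP → ℝ} (hξ : Sol ξ0 ξ) {A : E3 ≃ₗᵢ[ℝ] E3} {d : ℝ} (h : Sy A d)
    (h0 : ∀ x, d * ξ0 (A x) = ξ0 x) : (fun p : PP => d * ξ (p.1, A p.2)) = ξ := by
  refine Sol.unique (ξ0 := ξ0) ⟨hξ.sm.compA d, hξ.sc.compA d, fun x => ?_, fun p => ?_⟩ hξ
  · simp only [hξ.ini, h0]
  · rw [fd_A hξ.sm p.1 p.2, h.VVd, hξ.tr, mul_zero]

theorem Sol.symU {ξ0 : E3 → ℝ} {ξ : PP → ℝ} (hξ : Sol ξ0 ξ) {A : E3 ≃ₗᵢ[ℝ] E3} {d : ℝ} (h : Sy A d)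
    (h0 : ∀ x, d * ξ0 (A x) = ξ0 x) (t : ℝ) (x : E3) : A (VV ξ (t, x)) = VV ξ (t, A x) := by
  rw [← h.VVd ξ, hξ.sym h h0]

theorem tr_unique {U : PP → E3} (h : Fld U) {f g : PP → ℝ} (hf : Sm f) (hg : Sm g) (h0 : ∀ x, f (0, x) = g (0, x))
    (tf : ∀ p, fderiv ℝ f p (1, U p) = 0) (tg : ∀ p, fderiv ℝ g p (1, U p) = 0) (p : PP) : f p = g p := by
  have hs : Sm (fun p => f p - g p) := hf.sub hg
  have := val_bd h (M := 0) hs.diff (fun p => by rw [tr_diff hf hg tf tg]; simp) (fun x => by simp [h0]) p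
  exact sub_eq_zero.1 (norm_le_zero_iff.1 this)

theorem rc_JL (x : E3) : rc x = ‖JL x‖ := by
  rw [rc, ← Real.sqrt_sq (norm_nonneg (JL x)), nsq, JL_apply]
  simp only [mk3_0, mk3_1, mk3_2]; congr 1; ring

theorem rc_sq (x : E3) : rc x ^ 2 = x 0 ^ 2 + x 1 ^ 2 := Real.sq_sqrt (by positivity)

theorem rc_nn (x : E3) : 0 ≤ rc x := Real.sqrt_nonneg _

theorem rc_le (x : E3) : rc x ≤ ‖x‖ := by rw [rc_JL]; exact JL_norm x

theorem rc_sub (x y : E3) : |rc x - rc y| ≤ ‖x - y‖ := by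
  rw [rc_JL, rc_JL]
  refine (abs_norm_sub_norm_le _ _).trans ?_
  rw [← map_sub]; exact JL_norm _

theorem rot_exists {x y : E3} (h : rc x = rc y) (hz : zc x = zc y) : ∃ c s, ∃ h1 : c ^ 2 + s ^ 2 = 1,
    y = At c s 1 h1 (by norm_num) x := by
  have hx := rc_sq x
  have hy := rc_sq y
  rw [← h] at hy
  by_cases h0 : rc x = 0
  · have e : x 0 = 0 ∧ x 1 = 0 ∧ y 0 = 0 ∧ y 1 = 0 := by
      rw [h0] at hx hy
      refine ⟨?_, ?_, ?_, ?_⟩ <;> nlinarith [sq_nonneg (x 0), sq_nonneg (x 1), sq_nonneg (y 0), sq_nonneg (y 1)]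
    refine ⟨1, 0, by norm_num, ext3 ?_ ?_ ?_⟩ <;> simp only [At_apply, mk3_0, mk3_1, mk3_2]
    · simp [e]
    · simp [e]
    · rw [one_mul]; exact hz.symm
  · have h2 : rc x ^ 2 ≠ 0 := pow_ne_zero 2 h0
    refine ⟨(x 0 * y 0 + x 1 * y 1) / rc x ^ 2, (x 0 * y 1 - x 1 * y 0) / rc x ^ 2, ?_, ext3 ?_ ?_ ?_⟩
    · field_simp
      rw [show rc x ^ 4 = (x 0 ^ 2 + x 1 ^ 2) * (y 0 ^ 2 + y 1 ^ 2) by rw [← hx, ← hy]; ring]; ring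
    all_goals simp only [At_apply, mk3_0, mk3_1, mk3_2]
    · field_simp; rw [hx]; ring
    · field_simp; rw [hx]; ring
    · rw [one_mul]; exact hz.symm

theorem axis_zero {x : E3} (h : rc x = 0) : x 0 = 0 ∧ x 1 = 0 := by
  have hx := rc_sq x
  rw [h] at hx
  constructor <;> nlinarith [sq_nonneg (x 0), sq_nonneg (x 1)]

/-- infinitesimal rotation -/
theorem Du_J {U : E3 → E3} (hU : Differentiable ℝ U)
    (h : ∀ c s (h1 : c ^ 2 + s ^ 2 = 1) x, At c s 1 h1 (by norm_num) (U x) = U (At c s 1 h1 (by norm_num) x)) (x : E3) :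
    fderiv ℝ U x (JL x) = JL (U x) := by
  have hr : ∀ w : E3, HasDerivAt (fun θ => At (cos θ) (sin θ) 1 (cos_sq_add_sin_sq θ) (by norm_num) w) (JL w) 0 := fun w => by
    have e : (fun θ => At (cos θ) (sin θ) 1 (cos_sq_add_sin_sq θ) (by norm_num) w) =
        fun θ => cos θ • (w - w 2 • e2) + sin θ • JL w + w 2 • e2 := by
      funext θ
      apply ext3 <;> simp [At_apply, JL_apply, e2, mk3_0, mk3_1, mk3_2]
      · ring
      · ring
    rw [e]
    have := (((hasDerivAt_cos 0).smul_const (w - w 2 • e2)).add ((hasDerivAt_sin 0).smul_const (JL w))).add_const (w 2 • e2)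
    simpa using this
  have h1 := hr (U x)
  have h2 := hr x
  have e0 : At (cos 0) (sin 0) 1 (cos_sq_add_sin_sq 0) (by norm_num) x = x := by
    apply ext3 <;> simp [At_apply, mk3_0, mk3_1, mk3_2]
  have h3 : HasDerivAt (fun θ => U (At (cos θ) (sin θ) 1 (cos_sq_add_sin_sq θ) (by norm_num) x)) (fderiv ℝ U x (JL x)) 0 :=
    HasFDerivAt.comp_hasDerivAt (f := fun θ => At (cos θ) (sin θ) 1 (cos_sq_add_sin_sq θ) (by norm_num) x) 0
      (by rw [e0]; exact (hU x).hasFDerivAt) h2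
  simp only [← h] at h3
  exact h3.unique h1

end Equiv

section Eu

theorem axis_inv {U : PP → E3} (hU : Fld U) (h : ∀ t x, At (-1) 0 1 (by norm_num) (by norm_num) (U (t, x)) =
    U (t, At (-1) 0 1 (by norm_num) (by norm_num) x)) {T t : ℝ} (ht : |t| < T) {γ : ℝ → E3} (hγ : IsChar U T γ)
    (h0 : rc (γ t) = 0) : rc (γ 0) = 0 := by
  set A := At (-1) 0 1 (by norm_num) (by norm_num) with hA
  have hT : 0 < T := (abs_nonneg t).trans_lt ht
  have h2 : IsChar U T (fun s => A (γ s)) := fun s hs => by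
    have := A.toContinuousLinearEquiv.toContinuousLinearMap.hasFDerivAt.comp_hasDerivAt s (hγ s hs)
    rw [← h]; exact this
  obtain ⟨e0, e1⟩ := axis_zero h0
  have h3 := char_unique hU ht hγ h2 (ext3 (by simp [hA, At_apply, mk3_0, e0]) (by simp [hA, At_apply, mk3_1, e1])
    (by simp [hA, At_apply, mk3_2]))
  have h4 : γ 0 = A (γ 0) := h3 ⟨by linarith, hT⟩
  have a0 := congrArg (fun x : E3 => x 0) h4
  have a1 := congrArg (fun x : E3 => x 1) h4
  simp only [hA, At_apply, mk3_0, mk3_1] at a0 a1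
  rw [rc, show γ 0 0 = 0 by linarith, show γ 0 1 = 0 by linarith]; simp

variable {ξ0 : E3 → ℝ} {ξ : PP → ℝ}

theorem Sol.rotU (hξ : Sol ξ0 ξ) (hr : ∀ c s (h1 : c ^ 2 + s ^ 2 = 1) x, ξ0 (At c s 1 h1 (by norm_num) x) = ξ0 x)
    {c s : ℝ} (h1 : c ^ 2 + s ^ 2 = 1) (t : ℝ) (x : E3) :
    At c s 1 h1 (by norm_num) (VV ξ (t, x)) = VV ξ (t, At c s 1 h1 (by norm_num) x) :=
  hξ.symU (At_Sy h1 (by norm_num)) (fun x => by rw [hr, one_mul]) t x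

theorem Sol.near_axis (hξ : Sol ξ0 ξ) (hr : ∀ c s (h1 : c ^ 2 + s ^ 2 = 1) x, ξ0 (At c s 1 h1 (by norm_num) x) = ξ0 x)
    {r0 : ℝ} (h0 : 0 < r0) (hax : ∀ x, rc x < r0 → ξ0 x = 0) {p : PP} (hp : rc p.2 = 0) : ∀ᶠ q in nhds p, ξ q = 0 := by
  have hU := VV_fld hξ.sm hξ.sc
  have hs0 : Sm (fun x : E3 => x 0 ^ 2 + x 1 ^ 2) := by unfold Sm; fun_prop
  obtain ⟨f, hf, hf0, hft⟩ := transport_exists hU hs0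
  have hfp : f p = 0 := by
    obtain ⟨γ, h1, h2⟩ := exists_char hU (lt_add_one |p.1|) p.2
    have h3 := along hf.diff hft h2 (lt_add_one |p.1|)
    have h4 := axis_inv hU (fun t x => hξ.rotU hr _ t x) (lt_add_one |p.1|) h2 (by rw [h1, hp])
    rw [h1, hf0, ← rc_sq, h4] at h3
    exact h3.trans (by norm_num)
  have h5 : ∀ᶠ q in nhds p, f q < r0 ^ 2 := hf.continuous.continuousAt.eventually_lt continuousAt_const
    (by rw [hfp]; positivity)
  filter_upwards [h5] with q hq
  obtain ⟨γ, h1, h2⟩ := exists_char hU (lt_add_one |q.1|) q.2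
  have h3 := along hf.diff hft h2 (lt_add_one |q.1|)
  have h4 := along hξ.sm.diff hξ.tr h2 (lt_add_one |q.1|)
  rw [h1] at h3 h4
  have e : (q.1, q.2) = q := rfl
  rw [e] at h3 h4
  rw [h3, hf0, ← rc_sq] at hq
  rw [h4, hξ.ini, hax]
  exact lt_of_pow_lt_pow_left₀ 2 h0.le hq

theorem Sol.om_sm (hξ : Sol ξ0 ξ) (hr : ∀ c s (h1 : c ^ 2 + s ^ 2 = 1) x, ξ0 (At c s 1 h1 (by norm_num) x) = ξ0 x)
    {r0 : ℝ} (h0 : 0 < r0) (hax : ∀ x, rc x < r0 → ξ0 x = 0) : Sm (fun p : PP => rc p.2 * ξ p) := by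
  refine contDiff_iff_contDiffAt.2 fun p => ?_
  by_cases hp : rc p.2 = 0
  · refine (contDiffAt_const (c := (0 : ℝ))).congr_of_eventuallyEq ?_
    filter_upwards [hξ.near_axis hr h0 hax hp] with q hq
    rw [hq, mul_zero]
  · refine ContDiffAt.mul ?_ hξ.sm.contDiffAt
    unfold rc
    refine ContDiffAt.sqrt (by fun_prop) fun h => hp ?_
    rw [rc, h, Real.sqrt_zero]

theorem om_e (f : ℝ) (x : E3) : (rc x * f) • eTheta x = f • JL x := by
  rw [mul_comm, mul_smul, eTheta_JL]

theorem Sol.axisym (hξ : Sol ξ0 ξ) (hr : ∀ c s (h1 : c ^ 2 + s ^ 2 = 1) x, ξ0 (At c s 1 h1 (by norm_num) x) = ξ0 x)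
    (t : ℝ) : Axisym (fun x => rc x * ξ (t, x)) := fun x y h hz => by
  obtain ⟨c, s, h1, rfl⟩ := rot_exists h hz
  have := hξ.sym (At_Sy h1 (one_pow 2)) (fun x => by rw [hr, one_mul])
  have e := congrFun this (t, x)
  simp only [one_mul] at e
  simp only [← h, e]

theorem Sol.eqn (hξ : Sol ξ0 ξ) (hr : ∀ c s (h1 : c ^ 2 + s ^ 2 = 1) x, ξ0 (At c s 1 h1 (by norm_num) x) = ξ0 x)
    (x : E3) (t : ℝ) :
    HasDerivWithinAt (fun s => (rc x * ξ (s, x)) • eTheta x) (fderiv ℝ ξ (t, x) (1, 0) • JL x) (Ici (0 : ℝ)) t ∧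
    DifferentiableAt ℝ (fun y => (rc y * ξ (t, y)) • eTheta y) x ∧
    DifferentiableAt ℝ (fun y => VV ξ (t, y)) x ∧
    fderiv ℝ ξ (t, x) (1, 0) • JL x + fderiv ℝ (fun y => (rc y * ξ (t, y)) • eTheta y) x (VV ξ (t, x))
      = fderiv ℝ (fun y => VV ξ (t, y)) x ((rc x * ξ (t, x)) • eTheta x) := by
  have hV := VV_sm hξ.sm hξ.sc
  have hs : Differentiable ℝ (fun y => VV ξ (t, y)) := (slice_sm hV t).diff
  have hx : Differentiable ℝ (fun y => ξ (t, y)) := (slice_sm hξ.sm t).diff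
  simp only [om_e]
  have hd := (hx x).hasFDerivAt.smul JL.hasFDerivAt
  refine ⟨?_, hd.differentiableAt, hs x, ?_⟩
  · have : HasDerivAt (fun s => ξ (s, x)) (fderiv ℝ ξ (t, x) (1, 0)) t :=
      HasFDerivAt.comp_hasDerivAt (f := fun s => ((s, x) : PP)) t (hξ.sm.diff (t, x)).hasFDerivAt
        ((hasDerivAt_id t).prodMk (hasDerivAt_const t x))
    exact (this.smul_const (JL x)).hasDerivWithinAt
  · have e : fderiv ℝ (fun y => ξ (t, y) • JL y) x = _ := hd.fderiv
    rw [e, map_smul, Du_J hs (fun c s h1 x => hξ.rotU hr h1 t x)]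
    simp only [add_apply, smul_apply, ContinuousLinearMap.smulRight_apply]
    rw [slice_fderiv hξ.sm]
    have h1 : fderiv ℝ ξ (t, x) (1, 0) + fderiv ℝ ξ (t, x) (0, VV ξ (t, x)) = 0 := by
      rw [← map_add, Prod.mk_add_mk, add_zero, zero_add]; exact hξ.tr _
    rw [add_left_comm, ← add_smul, h1, zero_smul, add_zero]

end Eu

section Far

theorem ker1 {d b m : ℝ} (hb : 0 < b) (h1 : |d - b| ≤ m) (h2 : 2 * m ≤ b) :
    |(d ^ 3)⁻¹ - (b ^ 3)⁻¹| ≤ 40 * m * (b ^ 4)⁻¹ := by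
  obtain ⟨h3, h4⟩ := abs_le.1 h1
  have hm : 0 ≤ m := (abs_nonneg _).trans h1
  have hd : b / 2 ≤ d := by linarith
  have hd0 : 0 < d := by linarith
  have e : (d ^ 3)⁻¹ - (b ^ 3)⁻¹ = -((d - b) * (d ^ 2 + d * b + b ^ 2)) / (d ^ 3 * b ^ 3) := by
    field_simp; ring
  have hd3 : b ^ 3 / 8 ≤ d ^ 3 := by
    have := pow_le_pow_left₀ (by positivity) hd 3
    calc b ^ 3 / 8 = (b / 2) ^ 3 := by ring
      _ ≤ _ := this
  rw [e, abs_div, abs_neg, abs_mul, abs_of_pos (show 0 < d ^ 3 * b ^ 3 by positivity),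
    abs_of_pos (show 0 < d ^ 2 + d * b + b ^ 2 by positivity), div_le_iff₀ (by positivity)]
  have h5 : d ^ 2 + d * b + b ^ 2 ≤ 5 * b ^ 2 := by nlinarith
  calc |d - b| * (d ^ 2 + d * b + b ^ 2) ≤ m * (5 * b ^ 2) := by gcongr
    _ = 40 * m * (b ^ 4)⁻¹ * (b ^ 3 / 8 * b ^ 3) := by field_simp; ring
    _ ≤ _ := by gcongr

theorem ker2 {d b m p : ℝ} (hb : 0 < b) (h1 : |d - b| ≤ m) (h2 : 2 * m ≤ b) (hp : d ^ 2 = b ^ 2 - 2 * p + m ^ 2) :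
    |(d ^ 3)⁻¹ - (b ^ 3)⁻¹ - 3 * p * (b ^ 5)⁻¹| ≤ 130 * m ^ 2 * (b ^ 5)⁻¹ := by
  obtain ⟨h3, h4⟩ := abs_le.1 h1
  have hm : 0 ≤ m := (abs_nonneg _).trans h1
  have hd : b / 2 ≤ d := by linarith
  have hd0 : 0 < d := by linarith
  have hd3 : b ^ 3 / 8 ≤ d ^ 3 := by
    have := pow_le_pow_left₀ (by positivity) hd 3
    calc b ^ 3 / 8 = (b / 2) ^ 3 := by ring
      _ ≤ _ := this
  have hp' : p = (b ^ 2 + m ^ 2 - d ^ 2) / 2 := by linarith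
  have e : (d ^ 3)⁻¹ - (b ^ 3)⁻¹ - 3 * p * (b ^ 5)⁻¹ =
      (d - b) ^ 2 * (3 * d ^ 3 + 6 * d ^ 2 * b + 4 * d * b ^ 2 + 2 * b ^ 3) / (2 * d ^ 3 * b ^ 5) - 3 / 2 * m ^ 2 * (b ^ 5)⁻¹ := by
    rw [hp']; field_simp; ring
  have hq : (d - b) ^ 2 ≤ m ^ 2 := sq_le_sq' (by linarith) (by linarith)
  have hd2 : d ≤ 3 / 2 * b := by linarith
  have hP : 3 * d ^ 3 + 6 * d ^ 2 * b + 4 * d * b ^ 2 + 2 * b ^ 3 ≤ 32 * b ^ 3 := by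
    calc _ ≤ 3 * (3 / 2 * b) ^ 3 + 6 * (3 / 2 * b) ^ 2 * b + 4 * (3 / 2 * b) * b ^ 2 + 2 * b ^ 3 := by gcongr
      _ ≤ _ := by nlinarith [pow_pos hb 3]
  have h6 : (d - b) ^ 2 * (3 * d ^ 3 + 6 * d ^ 2 * b + 4 * d * b ^ 2 + 2 * b ^ 3) / (2 * d ^ 3 * b ^ 5) ≤ 128 * m ^ 2 * (b ^ 5)⁻¹ := by
    rw [div_le_iff₀ (by positivity)]
    calc _ ≤ m ^ 2 * (32 * b ^ 3) := by gcongr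
      _ = 128 * m ^ 2 * (b ^ 5)⁻¹ * (2 * (b ^ 3 / 8) * b ^ 5) := by field_simp; ring
      _ ≤ _ := by gcongr
  have h7 : 0 ≤ (d - b) ^ 2 * (3 * d ^ 3 + 6 * d ^ 2 * b + 4 * d * b ^ 2 + 2 * b ^ 3) / (2 * d ^ 3 * b ^ 5) := by positivity
  have h8 : 0 ≤ m ^ 2 * (b ^ 5)⁻¹ := by positivity
  rw [e, abs_le]
  constructor <;> nlinarith

theorem kk0 (w : E3) : kk 0 w = (‖w‖ ^ 3)⁻¹ • w := by
  unfold kk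
  congr 1
  rw [zero_pow two_ne_zero, add_zero, ← Real.rpow_natCast_mul (norm_nonneg _), ← Real.rpow_natCast, ← Real.rpow_neg (norm_nonneg _)]
  norm_num

def ip (x y : E3) : ℝ := x 0 * y 0 + x 1 * y 1 + x 2 * y 2

/-- Taylor polynomial of the kernel -/
def PK (n : ℝ) (x y : E3) : E3 :=
  (1 / (4 * π)) • (n ^ 3 • (cross3 (JL y) x - cross3 (JL y) y) - (3 * ip x y * n ^ 5) • cross3 (JL y) y)

theorem pi4 : |1 / (4 * π)| ≤ 1 := by
  rw [abs_of_pos (by positivity), div_le_one (by positivity)]; nlinarith [Real.pi_gt_three]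

theorem PK_le {x y : E3} (hy : 0 < ‖y‖) (hx : 2 * ‖x‖ ≤ ‖y‖) :
    ‖BR 0 (x - y) (JL y) - PK ‖y‖⁻¹ x y‖ ≤ 170 * ‖x‖ ^ 2 * (‖y‖ ^ 3)⁻¹ := by
  have h1 : |‖x - y‖ - ‖y‖| ≤ ‖x‖ := by
    have := abs_norm_sub_norm_le (x - y) (-y)
    simpa using this
  have hp : ‖x - y‖ ^ 2 = ‖y‖ ^ 2 - 2 * ip x y + ‖x‖ ^ 2 := by
    rw [nsq, nsq, nsq, ip]; simp only [PiLp.sub_apply]; ring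
  have k1 := ker1 hy h1 hx
  have k2 := ker2 hy h1 hx hp
  have e : BR 0 (x - y) (JL y) - PK ‖y‖⁻¹ x y = (1 / (4 * π)) • (((‖x - y‖ ^ 3)⁻¹ - (‖y‖ ^ 3)⁻¹) • cross3 (JL y) x
      - ((‖x - y‖ ^ 3)⁻¹ - (‖y‖ ^ 3)⁻¹ - 3 * ip x y * (‖y‖ ^ 5)⁻¹) • cross3 (JL y) y) := by
    rw [BR, BK_apply, kk0, PK, ← smul_sub]
    congr 1
    apply ext3 <;> simp only [cross3, PiLp.sub_apply, PiLp.smul_apply, smul_eq_mul, mk3_0, mk3_1, mk3_2, inv_pow] <;> ring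
  rw [e, norm_smul, Real.norm_eq_abs]
  refine (mul_le_of_le_one_left (norm_nonneg _) pi4).trans ((norm_sub_le _ _).trans ?_)
  rw [norm_smul, norm_smul, Real.norm_eq_abs, Real.norm_eq_abs]
  have c1 := (cross_le (JL y) x).trans (mul_le_mul_of_nonneg_right (JL_norm y) (norm_nonneg _))
  have c2 := (cross_le (JL y) y).trans (mul_le_mul_of_nonneg_right (JL_norm y) (norm_nonneg _))
  calc _ ≤ 40 * ‖x‖ * (‖y‖ ^ 4)⁻¹ * (‖y‖ * ‖x‖) + 130 * ‖x‖ ^ 2 * (‖y‖ ^ 5)⁻¹ * (‖y‖ * ‖y‖) := by gcongr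
    _ = _ := by field_simp; ring

def A4 : E3 ≃ₗᵢ[ℝ] E3 := At 0 1 1 (by norm_num) (by norm_num)

theorem A4_apply (x : E3) : A4 x = mk3 (-(x 1)) (x 0) (x 2) := by
  rw [A4, At_apply]; apply ext3 <;> simp [mk3_0, mk3_1, mk3_2]

theorem avg4 {f φ : E3 → ℝ} (hf : Continuous f) (hc : HasCompactSupport f) (hφ : Continuous φ)
    (hr : ∀ y, f (A4 y) = f y) :
    ∫ y, f y * φ y = ∫ y, f y * ((φ y + φ (A4 y) + φ (A4 (A4 y)) + φ (A4 (A4 (A4 y)))) / 4) := by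
  have hA := A4.continuous
  have m : ∀ {ψ : E3 → ℝ}, ∫ y, f y * ψ (A4 y) = ∫ y, f y * ψ y := fun {ψ} => by
    rw [← A4.measurePreserving.integral_comp A4.toHomeomorph.measurableEmbedding (fun y => f y * ψ y)]
    simp only [hr]
  have hi : ∀ {ψ : E3 → ℝ}, Continuous ψ → Integrable (fun y => f y * ψ y) := fun h =>
    (hf.mul h).integrable_of_hasCompactSupport hc.mul_right
  have e : ∀ y, f y * ((φ y + φ (A4 y) + φ (A4 (A4 y)) + φ (A4 (A4 (A4 y)))) / 4) =
    (1 / 4) * (f y * φ y + f y * φ (A4 y) + f y * φ (A4 (A4 y)) + f y * φ (A4 (A4 (A4 y)))) := fun y => by ring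
  simp only [e]
  have i2 : Integrable (fun y => f y * φ (A4 y)) := hi (hφ.comp hA)
  have i3 : Integrable (fun y => f y * φ (A4 (A4 y))) := hi (hφ.comp (hA.comp hA))
  have i4 : Integrable (fun y => f y * φ (A4 (A4 (A4 y)))) := hi (hφ.comp (hA.comp (hA.comp hA)))
  have j2 : Integrable (fun y => f y * φ y + f y * φ (A4 y)) := (hi hφ).add i2
  have j3 : Integrable (fun y => f y * φ y + f y * φ (A4 y) + f y * φ (A4 (A4 y))) := j2.add i3
  rw [integral_const_mul, integral_add j3 i4, integral_add j2 i3, integral_add (hi hφ) i2,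
    m (ψ := φ), m (ψ := fun y => φ (A4 y)), m (ψ := φ), m (ψ := fun y => φ (A4 (A4 y))), m (ψ := fun y => φ (A4 y)), m (ψ := φ)]
  ring

def nl (l : ℝ) (y : E3) : ℝ := (max ‖y‖ l)⁻¹

def stn (l : ℝ) (f : E3 → ℝ) : ℝ := 3 / (4 * π) * ∫ y, f y * ((y 0 ^ 2 + y 1 ^ 2) * y 2 * nl l y ^ 5)

theorem nl_cont {l : ℝ} (hl : 0 < l) : Continuous (nl l) :=
  (continuous_norm.max continuous_const).inv₀ fun _ => (hl.trans_le (le_max_right _ _)).ne'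

theorem far {f : PP → ℝ} {t h l L : ℝ} (hf : Continuous f) (hs : SC f) (hr : ∀ y, f (t, A4 y) = f (t, y))
    (hl : 0 < l) (hL : 0 < L) (hh : ∀ y, |f (t, y)| ≤ h) (hsup : ∀ y, f (t, y) ≠ 0 → l ≤ ‖y‖ ∧ ‖y‖ ≤ L) :
    ∃ c0 : ℝ, ∀ x : E3, 2 * ‖x‖ ≤ l → ‖VV f (t, x) - mk3 (-(stn l (fun y => f (t, y)) / 2 * x 0))
      (-(stn l (fun y => f (t, y)) / 2 * x 1)) (c0 + stn l (fun y => f (t, y)) * x 2)‖ ≤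
        h * (170 * ‖x‖ ^ 2 * (l ^ 3)⁻¹) * (L ^ 3 * (κ / 3)) := by
  set g : E3 → ℝ := fun y => f (t, y) with hg
  have hgc : Continuous g := hf.comp (by fun_prop)
  have hcs : HasCompactSupport g := slice_cs hs t
  have hn := nl_cont hl
  have hni : ∀ y, nl l (A4 y) = nl l y := fun y => by simp [nl]
  have h0 : 0 ≤ h := (abs_nonneg _).trans (hh 0)
  refine ⟨1 / (4 * π) * ∫ y, g y * ((y 0 ^ 2 + y 1 ^ 2) * nl l y ^ 3), fun x hx => ?_⟩
  have eV : VV f (t, x) = ∫ y, g y • BR 0 (x - y) (JL y) := by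
    unfold VV Kop
    rw [← integral_sub_left_eq_self _ _ x]
    simp only [sub_sub_cancel, Gx, map_smul, hg]
  have iV : Integrable (fun y => g y • BR 0 (x - y) (JL y)) := by
    have := (Kop_integrable (BR_meas 0) (BR_le 0) zero_le_one (G := Gx f) (hf.smul (JL.continuous.comp continuous_snd))
      (Gx_SC hs) (t, x)).comp_sub_left x
    simpa only [sub_sub_cancel, Gx, map_smul] using this
  have hPc : Continuous (fun y => PK (nl l y) x y) := by
    unfold PK ip
    simp only [← crossL_apply]
    fun_prop
  have iP : Integrable (fun y => g y • PK (nl l y) x y) :=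
    (hgc.smul hPc).integrable_of_hasCompactSupport hcs.smul_right
  have eP : ∫ y, g y • PK (nl l y) x y = mk3 (-(stn l g / 2 * x 0)) (-(stn l g / 2 * x 1))
      (1 / (4 * π) * (∫ y, g y * ((y 0 ^ 2 + y 1 ^ 2) * nl l y ^ 3)) + stn l g * x 2) := by
    have hcoord : ∀ i, Continuous (fun y => PK (nl l y) x y i) := fun i =>
      (EuclideanSpace.proj (𝕜 := ℝ) i).continuous.comp hPc
    have hst : ∀ c, -(stn l g / 2 * c) = ∫ y, (-(3 / (4 * π) / 2 * c)) * (g y * ((y 0 ^ 2 + y 1 ^ 2) * y 2 * nl l y ^ 5)) :=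
      fun c => by rw [integral_const_mul, stn]; ring
    apply ext3 <;> rw [int_coord iP] <;> simp only [PiLp.smul_apply, smul_eq_mul, mk3_0, mk3_1, mk3_2] <;>
      rw [avg4 hgc hcs (hcoord _) hr]
    · rw [hst]
      congr 1; funext y
      simp only [hni]; simp only [PK, ip, cross3, JL_apply, A4_apply, PiLp.sub_apply, PiLp.smul_apply, smul_eq_mul, mk3_0, mk3_1, mk3_2]
      ring
    · rw [hst]
      congr 1; funext y
      simp only [hni]; simp only [PK, ip, cross3, JL_apply, A4_apply, PiLp.sub_apply, PiLp.smul_apply, smul_eq_mul, mk3_0, mk3_1, mk3_2]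
      ring
    · have i1 : Integrable (fun y : E3 => 1 / (4 * π) * (g y * ((y 0 ^ 2 + y 1 ^ 2) * nl l y ^ 3))) :=
        Integrable.const_mul ((hgc.mul (by fun_prop)).integrable_of_hasCompactSupport hcs.mul_right) _
      have i2 : Integrable (fun y : E3 => 3 / (4 * π) * (g y * ((y 0 ^ 2 + y 1 ^ 2) * y 2 * nl l y ^ 5)) * x 2) :=
        (Integrable.const_mul ((hgc.mul (by fun_prop)).integrable_of_hasCompactSupport hcs.mul_right) _).mul_const _
      rw [stn, ← integral_const_mul, ← integral_const_mul, ← integral_mul_const, ← integral_add i1 i2]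
      congr 1; funext y
      simp only [hni]; simp only [PK, ip, cross3, JL_apply, A4_apply, PiLp.sub_apply, PiLp.smul_apply, smul_eq_mul, mk3_0, mk3_1, mk3_2]
      ring
  rw [← eP, eV, ← integral_sub iV iP]
  set K := h * (170 * ‖x‖ ^ 2 * (l ^ 3)⁻¹) with hK
  have hK0 : 0 ≤ K := by positivity
  have hvol : ∫ y, (Metric.closedBall (0 : E3) L).indicator (fun _ => K) y = K * (L ^ 3 * (κ / 3)) := by
    rw [integral_indicator Metric.isClosed_closedBall.measurableSet, setIntegral_const, vol_cball hL, smul_eq_mul, mul_comm]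
  rw [← hvol]
  refine norm_integral_le_of_norm_le ((integrable_indicator_iff Metric.isClosed_closedBall.measurableSet).2
    (integrableOn_const (hs := measure_closedBall_lt_top.ne))) (ae_of_all _ fun y => ?_)
  by_cases hy : g y = 0
  · simp only [hy, zero_smul, sub_zero, norm_zero]
    exact indicator_nonneg (fun _ _ => hK0) _
  · obtain ⟨a1, a2⟩ := hsup y hy
    have hy0 : 0 < ‖y‖ := hl.trans_le a1
    rw [indicator_of_mem (by simpa using a2), ← smul_sub, norm_smul, nl, max_eq_left a1]
    refine (mul_le_mul (hh y) (PK_le hy0 (hx.trans a1)) (norm_nonneg _) h0).trans ?_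
    rw [hK]; gcongr

end Far

section Velo

def sg : E3 ≃ₗᵢ[ℝ] E3 := At 1 0 (-1) (by norm_num) (by norm_num)

theorem sg_apply (x : E3) : sg x = mk3 (x 0) (x 1) (-(x 2)) := by
  rw [sg, At_apply]; apply ext3 <;> simp [mk3_0, mk3_1, mk3_2]

theorem sg_sy : Sy sg (-1) := At_Sy _ _

theorem sg_sg (x : E3) : sg (sg x) = x := by
  apply ext3 <;> simp [sg_apply, mk3_0, mk3_1, mk3_2]

def GG (f : PP → ℝ) (p : PP) : E3 := VV (fun q => f (q.1, sg q.2)) p - VV f p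

theorem GG_eq (f : PP → ℝ) (t : ℝ) (x : E3) : GG f (t, x) = -(sg (VV f (t, sg x)) + VV f (t, x)) := by
  have h := congrArg sg (sg_sy.VVe f t x)
  rw [sg_sg] at h
  rw [GG, h, neg_one_smul, map_neg]; abel

theorem GG_far {f : PP → ℝ} {t h l L : ℝ} (hf : Continuous f) (hs : SC f) (hr : ∀ y, f (t, A4 y) = f (t, y))
    (hl : 0 < l) (hL : 0 < L) (hh : ∀ y, |f (t, y)| ≤ h) (hsup : ∀ y, f (t, y) ≠ 0 → l ≤ ‖y‖ ∧ ‖y‖ ≤ L)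
    {x : E3} (hx : 2 * ‖x‖ ≤ l) : ‖GG f (t, x) - stn l (fun y => f (t, y)) • mk3 (x 0) (x 1) (-2 * x 2)‖ ≤
      2 * (h * (170 * ‖x‖ ^ 2 * (l ^ 3)⁻¹) * (L ^ 3 * (κ / 3))) := by
  obtain ⟨c, hc⟩ := far hf hs hr hl hL hh hsup
  have h1 := hc x hx
  have h2 := hc (sg x) (by rwa [sg.norm_map])
  rw [← sg.norm_map, sg.norm_map x] at h2
  refine le_trans ?_ ((add_le_add h2 h1).trans (two_mul _).ge)
  refine le_trans (le_of_eq ?_) (norm_add_le _ _)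
  rw [← norm_neg, GG_eq]
  congr 1
  rw [map_sub]
  apply ext3 <;> simp [sg_apply, mk3_0, mk3_1, mk3_2] <;> ring

theorem GG_near {f : PP → ℝ} {t h L : ℝ} (hL : 0 < L) (hh : ∀ y, |f (t, y)| ≤ h) (hsup : ∀ y, f (t, y) ≠ 0 → ‖y‖ ≤ L)
    (x : E3) : ‖GG f (t, x)‖ ≤ 2 * (1 * (h * L) * (κ * 3 * L)) := by
  have key : ∀ x, ‖VV f (t, x)‖ ≤ 1 * (h * L) * (κ * 3 * L) := fun x => by
    refine Kop_le (p := (t, x)) (BR_le 0) zero_le_one hL (fun y => ?_) (fun y hy => ?_)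
    · by_cases h0 : f (t, y) = 0
      · rw [Gx, h0, zero_smul, norm_zero]; exact mul_nonneg ((abs_nonneg _).trans (hh 0)) hL.le
      · rw [Gx, norm_smul]
        exact mul_le_mul (hh y) ((JL_norm y).trans (hsup y h0)) (norm_nonneg _) ((abs_nonneg _).trans (hh 0))
    · have : f (t, y) = 0 := by
        by_contra h0
        exact absurd (hsup y h0) (not_le.2 hy)
      rw [Gx, this, zero_smul]
  rw [GG_eq, norm_neg, two_mul]
  refine (norm_add_le _ _).trans (add_le_add ?_ (key x))
  rw [sg.norm_map]; exact key _

theorem stn_nn {l : ℝ} (hl : 0 < l) {f : E3 → ℝ} (h0 : ∀ y, 0 ≤ f y) (h : ∀ y, f y ≠ 0 → 0 ≤ y 2) : 0 ≤ stn l f := by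
  refine mul_nonneg (by positivity) (integral_nonneg fun y => ?_)
  by_cases hy : f y = 0
  · simp [hy]
  · have := h0 y
    have := h y hy
    have : 0 ≤ nl l y := inv_nonneg.2 (hl.le.trans (le_max_right _ _))
    simp only [Pi.zero_apply]
    positivity

theorem stn_lb {l L a b : ℝ} (hl : 0 < l) (hL : 0 < L) (ha : 0 ≤ a) (hb : 0 ≤ b) {f : E3 → ℝ} (hf : Continuous f)
    (hc : HasCompactSupport f) (h0 : ∀ y, 0 ≤ f y)
    (h : ∀ y, f y ≠ 0 → l ≤ ‖y‖ ∧ ‖y‖ ≤ L ∧ a ≤ rc y ∧ b ≤ y 2) :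
    3 / (4 * π) * (a ^ 2 * b * L⁻¹ ^ 5 * ∫ y, f y) ≤ stn l f := by
  refine mul_le_mul_of_nonneg_left ?_ (by positivity)
  rw [← integral_const_mul]
  have hn := nl_cont hl
  refine integral_mono ((hf.integrable_of_hasCompactSupport hc).const_mul _)
    ((hf.mul (by fun_prop)).integrable_of_hasCompactSupport hc.mul_right) fun y => ?_
  by_cases hy : f y = 0
  · simp [hy]
  · obtain ⟨h1, h2, h3, h4⟩ := h y hy
    have hp := hl.trans_le h1
    simp only
    rw [mul_comm, nl, max_eq_left h1, ← rc_sq]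
    refine mul_le_mul_of_nonneg_left ?_ (h0 y)
    have h5 : 0 ≤ rc y ^ 2 * y 2 := mul_nonneg (sq_nonneg _) (hb.trans h4)
    gcongr

def WW (B R : ℝ) : Set E3 := {x | R / 2 ≤ rc x ∧ rc x ≤ B * R ∧ R / B ^ 2 ≤ x 2 ∧ x 2 ≤ 4 * R}

theorem WW_n {B R : ℝ} (hB : 4 ≤ B) (hR : 0 < R) {x : E3} (h : x ∈ WW B R) : R / 2 ≤ ‖x‖ ∧ ‖x‖ ≤ 2 * B * R := by
  obtain ⟨h1, h2, h3, h4⟩ := h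
  refine ⟨h1.trans (rc_le x), ?_⟩
  have h5 : 0 < x 2 := lt_of_lt_of_le (by positivity) h3
  refine le_of_sq_le_sq ?_ (by positivity)
  rw [nsq, ← rc_sq]
  have a1 : rc x ^ 2 ≤ (B * R) ^ 2 := pow_le_pow_left₀ (rc_nn x) h2 2
  have a2 : x 2 ^ 2 ≤ (4 * R) ^ 2 := pow_le_pow_left₀ h5.le h4 2
  have a3 : (4 * R) ^ 2 ≤ (B * R) ^ 2 := pow_le_pow_left₀ (by positivity) (by gcongr) 2
  nlinarith

/-- snapshot of separated blobs -/
structure Snap (N : ℕ) (R : ℕ → ℝ) (B ε t : ℝ) (f : ℕ → PP → ℝ) : Prop where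
  B4 : 4 ≤ B
  ε0 : 0 ≤ ε
  R0 : ∀ k, 0 < R k
  R1 : ∀ k, 8 * B * R (k + 1) ≤ R k
  co : ∀ k, Continuous (f k)
  sc : ∀ k, SC (f k)
  ro : ∀ k y, f k (t, A4 y) = f k (t, y)
  nn : ∀ k y, 0 ≤ f k (t, y)
  ub : ∀ k y, f k (t, y) ≤ ε / R k
  su : ∀ k ≤ N, ∀ y, f k (t, y) ≠ 0 → y ∈ WW B (R k)

def Sst (R : ℕ → ℝ) (t : ℝ) (f : ℕ → PP → ℝ) (i : ℕ) : ℝ := ∑ j ∈ Finset.range i, stn (R j / 2) (fun y => f j (t, y))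

def EE (B ε : ℝ) : ℝ := 31000 * ε * κ * B ^ 5

variable {N : ℕ} {R : ℕ → ℝ} {B ε t : ℝ} {f : ℕ → PP → ℝ}

theorem Snap.vel (h : Snap N R B ε t f) {i : ℕ} (hi : i ≤ N) {x : E3} (hx : x ∈ WW B (R i)) :
    ‖∑ k ∈ Finset.range (N + 1), GG (f k) (t, x) - Sst R t f i • mk3 (x 0) (x 1) (-2 * x 2)‖ ≤ EE B ε * R i := by
  have hB := h.B4
  have hκ := κ_nn
  have hε := h.ε0
  have R0 := h.R0
  have R2 : ∀ k, 2 * R (k + 1) ≤ R k := fun k => by nlinarith [h.R1 k, R0 (k + 1)]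
  have hanti : Antitone R := antitone_nat_of_succ_le fun k => by linarith [R2 k, R0 (k + 1)]
  have habs : ∀ k y, |f k (t, y)| ≤ ε / R k := fun k y => by rw [abs_of_nonneg (h.nn k y)]; exact h.ub k y
  have hinv : ∀ i, ∑ j ∈ Finset.range i, (R j)⁻¹ ≤ (R i)⁻¹ := fun i => by
    induction i with
    | zero => simpa using (R0 0).le
    | succ n ih =>
      rw [Finset.sum_range_succ]
      have : (R n)⁻¹ ≤ (2 * R (n + 1))⁻¹ := inv_anti₀ (by linarith [R0 (n + 1)]) (R2 n)
      rw [mul_inv] at this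
      linarith
  have htail : ∀ n, i ≤ n → ∑ j ∈ Finset.Ico i n, R j ≤ 2 * R i - 2 * R n := fun n hn => by
    induction n, hn using Nat.le_induction with
    | base => simp
    | succ n hn ih => rw [Finset.sum_Ico_succ_top hn]; linarith [R2 n]
  obtain ⟨hx1, hx2⟩ := WW_n hB (R0 i) hx
  rw [← Finset.sum_range_add_sum_Ico _ (show i ≤ N + 1 by omega), add_sub_right_comm, Sst, Finset.sum_smul, ← Finset.sum_sub_distrib]
  refine (norm_add_le _ _).trans ?_
  have o1 : ‖∑ j ∈ Finset.range i, (GG (f j) (t, x) - stn (R j / 2) (fun y => f j (t, y)) • mk3 (x 0) (x 1) (-2 * x 2))‖ ≤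
      ∑ j ∈ Finset.range i, (7300 * ε * κ * B ^ 3 * ‖x‖ ^ 2) * (R j)⁻¹ := by
    refine norm_sum_le_of_le _ fun j hj => ?_
    have hj' := Finset.mem_range.1 hj
    have hRj := R0 j
    refine (GG_far (h.co j) (h.sc j) (h.ro j) (l := R j / 2) (L := 2 * B * R j) (by positivity) (by positivity) (habs j)
      (fun y hy => WW_n hB hRj (h.su j (by omega) y hy)) ?_).trans ?_
    · have := hanti (show j + 1 ≤ i by omega)
      have h8 := h.R1 j
      have : B * R i ≤ B * R (j + 1) := by gcongr
      linarith
    · have : 2 * (ε / R j * (170 * ‖x‖ ^ 2 * ((R j / 2) ^ 3)⁻¹) * ((2 * B * R j) ^ 3 * (κ / 3))) =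
        (21760 / 3 * (ε * κ * B ^ 3 * ‖x‖ ^ 2)) * (R j)⁻¹ := by field_simp; ring
      rw [this]
      have : 0 ≤ ε * κ * B ^ 3 * ‖x‖ ^ 2 := by positivity
      refine mul_le_mul_of_nonneg_right ?_ (inv_pos.2 hRj).le
      nlinarith
  have o2 : ‖∑ j ∈ Finset.Ico i (N + 1), GG (f j) (t, x)‖ ≤ ∑ j ∈ Finset.Ico i (N + 1), (24 * ε * κ * B ^ 2) * R j := by
    refine norm_sum_le_of_le _ fun j hj => ?_
    have hj' := (Finset.mem_Ico.1 hj).2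
    have hRj := R0 j
    refine (GG_near (L := 2 * B * R j) (by positivity) (habs j) (fun y hy => (WW_n hB hRj (h.su j (by omega) y hy)).2) x).trans
      (le_of_eq ?_)
    field_simp; ring
  rw [← Finset.mul_sum] at o1 o2
  have hRi := R0 i
  have o3 : 7300 * ε * κ * B ^ 3 * ‖x‖ ^ 2 * ∑ j ∈ Finset.range i, (R j)⁻¹ ≤ 7300 * ε * κ * B ^ 3 * (2 * B * R i) ^ 2 * (R i)⁻¹ := by
    have := hinv i
    have : 0 ≤ ∑ j ∈ Finset.range i, (R j)⁻¹ := Finset.sum_nonneg fun j _ => (inv_pos.2 (R0 j)).le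
    gcongr
  have o4 : 24 * ε * κ * B ^ 2 * ∑ j ∈ Finset.Ico i (N + 1), R j ≤ 24 * ε * κ * B ^ 2 * (2 * R i) := by
    have := htail (N + 1) (by omega)
    have := R0 (N + 1)
    gcongr; linarith
  have e3 : 7300 * ε * κ * B ^ 3 * (2 * B * R i) ^ 2 * (R i)⁻¹ = 29200 * (ε * κ * B ^ 5 * R i) := by field_simp; ring
  have e4 : 24 * ε * κ * B ^ 2 * (2 * R i) ≤ 48 * (ε * κ * B ^ 5 * R i) := by
    have : B ^ 2 ≤ B ^ 5 := pow_le_pow_right₀ (by linarith) (by norm_num)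
    calc _ = 48 * (ε * κ * B ^ 2 * R i) := by ring
      _ ≤ _ := by gcongr
  have : 0 ≤ ε * κ * B ^ 5 * R i := by positivity
  rw [EE]
  nlinarith

theorem Snap.stn_nn (h : Snap N R B ε t f) {j : ℕ} (hj : j ≤ N) : 0 ≤ stn (R j / 2) (fun y => f j (t, y)) := by
  have hB := h.B4
  have hR := h.R0 j
  exact _root_.stn_nn (by linarith) (h.nn j) fun y hy => le_trans (by positivity) (h.su j hj y hy).2.2.1

theorem Snap.mono (h : Snap N R B ε t f) {i : ℕ} (hi : i ≤ N) : 0 ≤ Sst R t f i ∧ Sst R t f i ≤ Sst R t f N := by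
  constructor
  · exact Finset.sum_nonneg fun j hj => h.stn_nn (by have := Finset.mem_range.1 hj; omega)
  · exact Finset.sum_le_sum_of_subset_of_nonneg (Finset.range_mono hi) fun j hj _ => h.stn_nn (Finset.mem_range.1 hj).le

theorem Snap.low (h : Snap N R B ε t f) {m : ℝ} (hm : ∀ j < N, m * R j ^ 2 ≤ ∫ y, f j (t, y)) :
    N * (m * (B ^ 7)⁻¹ / 600) ≤ Sst R t f N := by
  have hB := h.B4
  rw [Sst, ← nsmul_eq_mul, ← Finset.card_range N, ← Finset.sum_const, Finset.card_range]
  refine Finset.sum_le_sum fun j hj => ?_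
  have hj' := Finset.mem_range.1 hj
  have hR := h.R0 j
  refine le_trans ?_ (stn_lb (l := R j / 2) (L := 2 * B * R j) (a := R j / 2) (b := R j / B ^ 2) (by positivity) (by positivity)
    (by positivity) (by positivity) ((h.co j).comp (by fun_prop)) (slice_cs (h.sc j) t) (h.nn j)
    fun y hy => by
      have := h.su j hj'.le y hy
      exact ⟨(WW_n hB hR this).1, (WW_n hB hR this).2, this.1, this.2.2.1⟩)
  have hI : 0 ≤ ∫ y, f j (t, y) := integral_nonneg fun y => h.nn j y
  have hπ := Real.pi_lt_four
  have e : 3 / (4 * π) * ((R j / 2) ^ 2 * (R j / B ^ 2) * (2 * B * R j)⁻¹ ^ 5 * ∫ y, f j (t, y)) =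
     3 / (4 * π) * ((B ^ 7)⁻¹ / 128 * ((∫ y, f j (t, y)) / R j ^ 2)) := by
    field_simp; ring
  rw [e]
  have h1 : m ≤ (∫ y, f j (t, y)) / R j ^ 2 := by rw [le_div_iff₀ (by positivity)]; exact hm j hj'
  have h2 : 0 ≤ (∫ y, f j (t, y)) / R j ^ 2 := by positivity
  have h3 : 128 / 600 ≤ 3 / (4 * π) := by rw [div_le_div_iff₀ (by norm_num) (by positivity)]; nlinarith [Real.pi_lt_d2]
  calc m * (B ^ 7)⁻¹ / 600 ≤ ((∫ y, f j (t, y)) / R j ^ 2) * (B ^ 7)⁻¹ / 600 := by gcongr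
    _ = 128 / 600 * ((B ^ 7)⁻¹ / 128 * ((∫ y, f j (t, y)) / R j ^ 2)) := by ring
    _ ≤ _ := by gcongr

end Velo

section Boot

def W0 (R : ℝ) : Set E3 := {x | R ≤ rc x ∧ rc x ≤ 2 * R ∧ R ≤ x 2 ∧ x 2 ≤ 2 * R}

structure Cfg (N : ℕ) (R : ℕ → ℝ) (B ε : ℝ) (U : PP → E3) (f : ℕ → PP → ℝ) : Prop where
  fld : Fld U
  dvz : ∀ p, dv U p = 0
  B4 : 4 ≤ B
  ε0 : 0 ≤ ε
  R0 : ∀ k, 0 < R k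
  R1 : ∀ k, 8 * B * R (k + 1) ≤ R k
  sm : ∀ k, Sm (f k)
  sc : ∀ k, SC (f k)
  tr : ∀ k p, fderiv ℝ (f k) p (1, U p) = 0
  ro : ∀ k t y, f k (t, A4 y) = f k (t, y)
  nn : ∀ k p, 0 ≤ f k p
  ub : ∀ k p, f k p ≤ ε / R k
  s0 : ∀ k y, f k (0, y) ≠ 0 → y ∈ W0 (R k)
  Ueq : ∀ p, U p = ∑ k ∈ Finset.range (N + 1), GG (f k) p

def Good (N : ℕ) (R : ℕ → ℝ) (B T : ℝ) (U : PP → E3) (t : ℝ) : Prop :=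
  ∀ k ≤ N, ∀ γ, IsChar U T γ → γ 0 ∈ W0 (R k) → ∀ s ∈ Icc 0 t, γ s ∈ WW B (R k)

theorem mvb {g : ℝ → ℝ} {t c : ℝ} (ht : 0 ≤ t) (h : ∀ s ∈ Icc 0 t, ∃ d, HasDerivAt g d s ∧ c ≤ d) : c * t ≤ g t - g 0 := by
  have := (convex_Icc 0 t).mul_sub_le_image_sub_of_le_deriv (f := g) (C := c)
    (fun s hs => (h s hs).choose_spec.1.continuousAt.continuousWithinAt)
    (fun s hs => (h s (interior_subset hs)).choose_spec.1.differentiableAt.differentiableWithinAt)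
    (fun s hs => by obtain ⟨d, h1, h2⟩ := h s (interior_subset hs); rwa [h1.deriv]) 0 ⟨le_rfl, ht⟩ t ⟨ht, le_rfl⟩ ht
  simpa using this

def Lr (γ : ℝ → E3) (s : ℝ) : ℝ := Real.log (rc (γ s) ^ 2) / 2
def Lz (γ : ℝ → E3) (s : ℝ) : ℝ := Real.log (γ s 2)

variable {N : ℕ} {R : ℕ → ℝ} {B ε t T τ Q : ℝ} {f : ℕ → PP → ℝ} {U : PP → E3} {γ : ℝ → E3}

theorem Cfg.snap (h : Cfg N R B ε U f) (hg : Good N R B T U t) (hT : t < T) {s : ℝ} (hs : s ∈ Icc 0 t) : Snap N R B ε s f where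
  B4 := h.B4
  ε0 := h.ε0
  R0 := h.R0
  R1 := h.R1
  co k := (h.sm k).continuous
  sc := h.sc
  ro k := h.ro k s
  nn k y := h.nn k (s, y)
  ub k y := h.ub k (s, y)
  su k hk y hy := by
    have hsT : |s| < T := by rw [abs_of_nonneg hs.1]; linarith [hs.2]
    obtain ⟨γ, h1, h2⟩ := exists_char h.fld hsT y
    have h3 := along (h.sm k).diff (h.tr k) h2 hsT
    rw [h1] at h3
    rw [h3] at hy
    rw [← h1]
    exact hg k hk γ h2 (h.s0 k _ hy) s hs

theorem Cfg.ode (h : Cfg N R B ε U f) (hs : Snap N R B ε t f) (hγ : IsChar U T γ) (ht : t ∈ Ioo (-T) T) {i : ℕ} (hi : i ≤ N)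
    (hx : γ t ∈ WW B (R i)) : (∃ d, HasDerivAt (Lr γ) d t ∧ |d - Sst R t f i| ≤ 2 * EE B ε) ∧
      ∃ d, HasDerivAt (Lz γ) d t ∧ |d + 2 * Sst R t f i| ≤ EE B ε * B ^ 2 := by
  have hB := h.B4
  have hR := h.R0 i
  have hE : 0 ≤ EE B ε := by have := κ_nn; have := h.ε0; unfold EE; positivity
  have hv := hs.vel hi hx
  rw [← h.Ueq] at hv
  have hd := hγ t ht
  have hc : ∀ j : Fin 3, HasDerivAt (fun s => γ s j) (U (t, γ t) j) t := fun j =>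
    (EuclideanSpace.proj j : E3 →L[ℝ] ℝ).hasFDerivAt.comp_hasDerivAt t hd
  set x := γ t with hxd
  set u := U (t, x) with hu
  set S := Sst R t f i with hS
  set w := u - S • mk3 (x 0) (x 1) (-2 * x 2) with hw
  have w0 : u 0 = S * x 0 + w 0 := by simp [hw, mk3_0]
  have w1 : u 1 = S * x 1 + w 1 := by simp [hw, mk3_1]
  have w2 : u 2 = -2 * S * x 2 + w 2 := by simp [hw, mk3_2]; ring
  obtain ⟨x1, x2, x3, x4⟩ := hx
  have hr : 0 < rc x := by linarith
  have hz : 0 < x 2 := lt_of_lt_of_le (by positivity) x3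
  constructor
  · have e : Lr γ = fun s => Real.log (γ s 0 ^ 2 + γ s 1 ^ 2) / 2 := by funext s; rw [Lr, rc_sq]
    have hp : x 0 ^ 2 + x 1 ^ 2 ≠ 0 := by rw [← rc_sq]; positivity
    refine ⟨_, by rw [e]; exact ((((hc 0).pow 2).add ((hc 1).pow 2)).log hp).div_const 2, ?_⟩
    have e2 : (((2 : ℕ) : ℝ) * x 0 ^ (2 - 1) * u 0 + ((2 : ℕ) : ℝ) * x 1 ^ (2 - 1) * u 1) / (x 0 ^ 2 + x 1 ^ 2) / 2 - S =
      (x 0 * w 0 + x 1 * w 1) / (x 0 ^ 2 + x 1 ^ 2) := by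
      rw [w0, w1]; field_simp; push_cast; ring
    have e3 : |x 0 * w 0 + x 1 * w 1| ≤ rc x * ‖w‖ := by
      refine abs_le_of_sq_le_sq ?_ (by positivity)
      rw [mul_pow, rc_sq, nsq]
      nlinarith [sq_nonneg (x 0 * w 1 - x 1 * w 0), mul_nonneg (add_nonneg (sq_nonneg (x 0)) (sq_nonneg (x 1))) (sq_nonneg (w 2))]
    have e4 : |(x 0 * w 0 + x 1 * w 1) / (x 0 ^ 2 + x 1 ^ 2)| ≤ 2 * EE B ε := by
      rw [← rc_sq, abs_div, abs_of_pos (show 0 < rc x ^ 2 by positivity), div_le_iff₀ (by positivity)]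
      refine e3.trans ?_
      have : ‖w‖ ≤ EE B ε * (2 * rc x) := hv.trans (by gcongr; linarith)
      nlinarith
    rw [← e2] at e4
    simpa using e4
  · refine ⟨_, (hc 2).log hz.ne', ?_⟩
    have e2 : u 2 / x 2 + 2 * S = w 2 / x 2 := by rw [w2]; field_simp; ring
    rw [e2, abs_div, abs_of_pos hz, div_le_iff₀ hz]
    refine ((coord_le w 2).trans hv).trans ?_
    have : R i ≤ B ^ 2 * x 2 := by rw [div_le_iff₀ (by positivity)] at x3; linarith
    calc _ ≤ EE B ε * (B ^ 2 * x 2) := by gcongr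
      _ = _ := by ring

theorem lg10 {a b : ℝ} (ha : 0 < a) (hb : 0 < b) (h : Real.log a ≤ Real.log b + 1 / 10) : 9 / 10 * a ≤ b := by
  have h1 : a ≤ b * Real.exp (1 / 10) := by
    rw [← Real.log_le_log_iff ha (by positivity), Real.log_mul hb.ne' (by positivity), Real.log_exp]; exact h
  have h2 := Real.add_one_le_exp (-(1 / 10) : ℝ)
  have h3 : Real.exp (1 / 10) * Real.exp (-(1 / 10)) = 1 := by rw [← Real.exp_add]; norm_num
  calc 9 / 10 * a ≤ Real.exp (-(1 / 10)) * a := by gcongr; linarith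
    _ ≤ Real.exp (-(1 / 10)) * (b * Real.exp (1 / 10)) := by gcongr
    _ = b := by linear_combination b * h3

theorem Lr_eq (γ : ℝ → E3) (s : ℝ) : Lr γ s = Real.log (rc (γ s)) := by rw [Lr, Real.log_pow]; push_cast; ring

structure Ctl (N : ℕ) (R : ℕ → ℝ) (B ε Q T τ : ℝ) (U : PP → E3) (p : ℝ → E3) : Prop where
  Q1 : 1 ≤ Q
  hB : B = 4 * Q
  hT : τ < T
  τ0 : 0 ≤ τ
  hτ : (4 * EE B ε + EE B ε * B ^ 2) * τ ≤ 1 / 10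
  hp : IsChar U T p
  p0 : p 0 ∈ W0 (R N)
  hc : ∀ s ∈ Icc 0 τ, rc (p s) ≤ Q * R N

theorem Cfg.improve (h : Cfg N R B ε U f) {p : ℝ → E3} (c : Ctl N R B ε Q T τ U p) (ht : t ≤ τ) (hg : Good N R B T U t)
    {k : ℕ} (hk : k ≤ N) (hγ : IsChar U T γ) (γ0 : γ 0 ∈ W0 (R k)) {s : ℝ} (hs : s ∈ Icc 0 t) :
    9 / 10 * R k ≤ rc (γ s) ∧ rc (γ s) ≤ 3 * Q * R k ∧ R k / (10 * Q ^ 2) ≤ γ s 2 ∧ γ s 2 ≤ 3 * R k := by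
  have hQ := c.Q1
  have hB := h.B4
  have hR := h.R0 k
  have hRN := h.R0 N
  have hE : 0 ≤ EE B ε := by have := κ_nn; have := h.ε0; unfold EE; positivity
  have key : ∀ r ∈ Icc 0 s, ∃ a b a' : ℝ, HasDerivAt (Lr γ) a r ∧ HasDerivAt (Lz γ) b r ∧ HasDerivAt (Lr p) a' r ∧
      -(2 * EE B ε) ≤ a ∧ -(4 * EE B ε) ≤ a' - a ∧ b ≤ EE B ε * B ^ 2 ∧ -(4 * EE B ε + EE B ε * B ^ 2) ≤ 2 * a + b := fun r hr => by
    have hrt : r ∈ Icc 0 t := ⟨hr.1, hr.2.trans hs.2⟩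
    have hr' : r ∈ Ioo (-T) T := ⟨by linarith [hr.1, c.hT, c.τ0], by linarith [hrt.2, c.hT]⟩
    have sn := h.snap hg (ht.trans_lt c.hT) hrt
    obtain ⟨⟨a, ha, ha'⟩, b, hb, hb'⟩ := h.ode sn hγ hr' hk (hg k hk γ hγ γ0 r hrt)
    obtain ⟨⟨a', hc, hc'⟩, -⟩ := h.ode sn c.hp hr' le_rfl (hg N le_rfl p c.hp c.p0 r hrt)
    obtain ⟨m0, m1⟩ := sn.mono hk
    rw [abs_le] at ha' hb' hc'
    exact ⟨a, b, a', ha, hb, hc, by linarith, by linarith, by linarith, by linarith⟩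
  have hs' : (4 * EE B ε + EE B ε * B ^ 2) * s ≤ 1 / 10 := le_trans (by gcongr; exact hs.2.trans ht) c.hτ
  have hs1 : 0 ≤ EE B ε * s := mul_nonneg hE hs.1
  have hs2 : 0 ≤ EE B ε * B ^ 2 * s := mul_nonneg (by positivity) hs.1
  have b1 := mvb (g := Lr γ) hs.1 fun r hr => by
    obtain ⟨a, b, a', h1, h2, h3, h4, h5, h6, h7⟩ := key r hr
    exact ⟨a, h1, h4⟩
  have b2 := mvb (g := fun s => Lr p s - Lr γ s) hs.1 fun r hr => by
    obtain ⟨a, b, a', h1, h2, h3, h4, h5, h6, h7⟩ := key r hr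
    exact ⟨_, h3.sub h1, h5⟩
  have b3 := mvb (g := fun s => -Lz γ s) hs.1 fun r hr => by
    obtain ⟨a, b, a', h1, h2, h3, h4, h5, h6, h7⟩ := key r hr
    exact ⟨_, h2.neg, neg_le_neg h6⟩
  have b4 := mvb (g := fun s => 2 * Lr γ s + Lz γ s) hs.1 fun r hr => by
    obtain ⟨a, b, a', h1, h2, h3, h4, h5, h6, h7⟩ := key r hr
    exact ⟨_, (h1.const_mul 2).add h2, h7⟩
  simp only [Lr_eq, Lz] at b1 b2 b3 b4
  obtain ⟨x1, x2, x3, x4⟩ := γ0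
  obtain ⟨y1, y2, y3, y4⟩ := c.p0
  have hw := hg k hk γ hγ ⟨x1, x2, x3, x4⟩ s hs
  have hwp := hg N le_rfl p c.hp c.p0 s hs
  have r0 : 0 < rc (γ 0) := by linarith
  have r1 : 0 < rc (γ s) := by linarith [hw.1]
  have q0 : 0 < rc (p 0) := by linarith
  have q1 : 0 < rc (p s) := by linarith [hwp.1]
  have z0 : 0 < γ 0 2 := by linarith
  have z1 : 0 < γ s 2 := lt_of_lt_of_le (by positivity) hw.2.2.1
  have i1 := lg10 r0 r1 (by linarith)
  have i2 : 9 / 10 * (rc (γ s) * rc (p 0)) ≤ rc (γ 0) * rc (p s) := lg10 (by positivity) (by positivity) (by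
    rw [Real.log_mul r1.ne' q0.ne', Real.log_mul r0.ne' q1.ne']; linarith)
  have i3 := lg10 z1 z0 (by linarith)
  have i4 : 9 / 10 * (rc (γ 0) ^ 2 * γ 0 2) ≤ rc (γ s) ^ 2 * γ s 2 := lg10 (by positivity) (by positivity) (by
    rw [Real.log_mul (by positivity) z0.ne', Real.log_mul (by positivity) z1.ne', Real.log_pow, Real.log_pow]; push_cast; linarith)
  have j2 : 9 / 10 * rc (γ s) ≤ 2 * R k * Q := by
    have hcs := c.hc s ⟨hs.1, hs.2.trans ht⟩
    have : 9 / 10 * rc (γ s) * R N ≤ 2 * R k * Q * R N := calc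
      _ ≤ 9 / 10 * rc (γ s) * rc (p 0) := by gcongr
      _ ≤ rc (γ 0) * rc (p s) := by linarith
      _ ≤ (2 * R k) * (Q * R N) := by gcongr
      _ = _ := by ring
    exact le_of_mul_le_mul_right this hRN
  have hQR : 0 < Q * R k := by positivity
  refine ⟨by linarith, by linarith, ?_, by linarith⟩
  rw [div_le_iff₀ (by positivity)]
  have k1 : rc (γ s) ^ 2 ≤ (20 / 9 * (Q * R k)) ^ 2 := by gcongr; linarith
  have k2 : R k ^ 2 * R k ≤ rc (γ 0) ^ 2 * γ 0 2 := by gcongr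
  have k3 : R k * R k ^ 2 ≤ (γ s 2 * (10 * Q ^ 2)) * R k ^ 2 := by
    have : rc (γ s) ^ 2 * γ s 2 ≤ (20 / 9 * (Q * R k)) ^ 2 * γ s 2 := by gcongr
    have k4 : 0 < γ s 2 * Q ^ 2 * R k ^ 2 := by positivity
    nlinarith
  exact le_of_mul_le_mul_right k3 (by positivity)

theorem Cfg.boot (h : Cfg N R B ε U f) {p : ℝ → E3} (c : Ctl N R B ε Q T τ U p) : Good N R B T U τ := by
  have hQ := c.Q1
  have hT := c.hT
  have hτ := c.τ0
  have hanti : ∀ k ≤ N, R N ≤ R k := fun k hk => antitone_nat_of_succ_le (fun k => by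
    nlinarith [h.R1 k, h.R0 (k + 1), h.B4]) hk
  have hRN := h.R0 N
  obtain ⟨C, hC⟩ := h.fld.bd τ
  have hC0 : 0 ≤ C := (norm_nonneg _).trans (hC (0, 0) (by simpa using hτ))
  obtain ⟨e, he, heC⟩ : ∃ e > 0, C * e ≤ R N / (40 * Q ^ 2) := by
    refine ⟨R N / (40 * Q ^ 2) / (C + 1), by positivity, ?_⟩
    rw [mul_div_assoc', div_le_iff₀ (by positivity)]
    have : 0 ≤ R N / (40 * Q ^ 2) := by positivity
    nlinarith
  have step : ∀ γ, IsChar U T γ → ∀ a ∈ Icc 0 τ, ∀ b ∈ Icc 0 τ, ‖γ b - γ a‖ ≤ C * ‖b - a‖ := fun γ hγ a ha b hb =>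
    (convex_Icc 0 τ).norm_image_sub_le_of_norm_hasDerivWithin_le
      (fun x hx => (hγ x ⟨by linarith [hx.1], by linarith [hx.2]⟩).hasDerivWithinAt)
      (fun x hx => hC _ (by simpa [abs_of_nonneg hx.1] using hx.2)) ha hb
  -- points close to an initial or improved point stay in the big window
  have ext : ∀ k ≤ N, ∀ x y : E3, (9 / 10 * R k ≤ rc x ∧ rc x ≤ 3 * Q * R k ∧ R k / (10 * Q ^ 2) ≤ x 2 ∧ x 2 ≤ 3 * R k) →
      ‖y - x‖ ≤ R N / (40 * Q ^ 2) → y ∈ WW B (R k) := fun k hk x y hx hxy => by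
    have hR := h.R0 k
    have a1 := abs_le.1 ((rc_sub y x).trans hxy)
    have a2 := abs_le.1 ((coord_le (y - x) 2).trans hxy)
    simp only [PiLp.sub_apply] at a2
    have a3 : R N / (40 * Q ^ 2) ≤ R k / (40 * Q ^ 2) := by gcongr; exact hanti k hk
    have a4 : R k / (40 * Q ^ 2) ≤ R k / 40 := by
      gcongr; nlinarith
    have a5 : R k ≤ Q * R k := by nlinarith
    have a6 : R k / B ^ 2 ≤ R k / (10 * Q ^ 2) - R k / (40 * Q ^ 2) := by
      rw [c.hB]
      have : 0 < R k / Q ^ 2 := by positivity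
      have e1 : R k / (4 * Q) ^ 2 = R k / Q ^ 2 / 16 := by field_simp; norm_num
      have e2 : R k / (10 * Q ^ 2) = R k / Q ^ 2 / 10 := by field_simp
      have e3 : R k / (40 * Q ^ 2) = R k / Q ^ 2 / 40 := by field_simp
      rw [e1, e2, e3]; linarith
    refine ⟨by linarith, ?_, by linarith, by linarith⟩
    rw [c.hB]; linarith
  have ind : ∀ n : ℕ, Good N R B T U (min (n * e) τ) := fun n => by
    induction n with
    | zero =>
      intro k hk γ hγ γ0 s hs
      have : s = 0 := le_antisymm (by simpa [hτ] using hs.2) hs.1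
      rw [this]
      have hR := h.R0 k
      obtain ⟨x1, x2, x3, x4⟩ := γ0
      refine ext k hk (γ 0) _ ⟨by linarith, by nlinarith, ?_, by linarith⟩ (by simp; positivity)
      exact (div_le_self hR.le (by nlinarith)).trans x3
    | succ n ih =>
      intro k hk γ hγ γ0 s hs
      set t := min (n * e) τ with ht
      have ht0 : 0 ≤ t := le_min (by positivity) hτ
      by_cases hst : s ≤ t
      · exact ih k hk γ hγ γ0 s ⟨hs.1, hst⟩
      push Not at hst
      have hsτ : s ≤ τ := hs.2.trans (min_le_right _ _)
      have hse : s ≤ (n + 1) * e := by simpa using hs.2.trans (min_le_left _ _)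
      have htn : t = n * e := by
        rcases min_choice (n * e) τ with h1 | h1
        · exact h1
        · rw [← ht] at h1; linarith
      refine ext k hk _ _ (h.improve c (min_le_right _ _) ih hk hγ γ0 ⟨ht0, le_rfl⟩) ?_
      refine (step γ hγ t ⟨ht0, min_le_right _ _⟩ s ⟨hs.1, hsτ⟩).trans (le_trans ?_ heC)
      rw [Real.norm_eq_abs, abs_of_pos (by linarith)]
      gcongr; linarith
  obtain ⟨n, hn⟩ := exists_nat_ge (τ / e)
  have := ind n
  rwa [min_eq_right ((div_le_iff₀ he).1 hn)] at this

theorem Cfg.final (h : Cfg N R B ε U f) {p : ℝ → E3} (c : Ctl N R B ε Q T τ U p) {m : ℝ}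
    (hm : ∀ j < N, m * R j ^ 2 ≤ ∫ y, f j (0, y)) : N * (m * (B ^ 7)⁻¹ / 600) * τ ≤ Real.log Q + 1 := by
  have hg := h.boot c
  have hB := h.B4
  have hE : 0 ≤ EE B ε := by have := κ_nn; have := h.ε0; unfold EE; positivity
  have b := mvb (g := Lr p) (c := N * (m * (B ^ 7)⁻¹ / 600) - 2 * EE B ε) c.τ0 fun r hr => by
    have hr' : r ∈ Ioo (-T) T := ⟨by linarith [hr.1, c.hT, c.τ0], by linarith [hr.2, c.hT]⟩
    have sn := h.snap hg c.hT hr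
    obtain ⟨⟨a, ha, ha'⟩, -⟩ := h.ode sn c.hp hr' le_rfl (hg N le_rfl p c.hp c.p0 r hr)
    have := sn.low (m := m) fun j hj => by rw [int_conserved (h.sm j) (h.sc j) h.fld.sm h.dvz (h.tr j)]; exact hm j hj
    rw [abs_le] at ha'
    exact ⟨a, ha, by linarith⟩
  simp only [Lr_eq] at b
  have hRN := h.R0 N
  have hτ' : τ ∈ Icc 0 τ := ⟨c.τ0, le_rfl⟩
  have h1 := c.hc τ hτ'
  have h2 := c.p0.1
  have h3 : 0 < rc (p τ) := by linarith [(hg N le_rfl p c.hp c.p0 τ hτ').1]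
  have h4 := Real.log_le_log h3 h1
  have h5 := Real.log_le_log hRN h2
  rw [Real.log_mul (by linarith [c.Q1]) hRN.ne'] at h4
  have h6 := c.hτ
  have : 0 ≤ EE B ε * τ := mul_nonneg hE c.τ0
  have : 0 ≤ EE B ε * B ^ 2 * τ := mul_nonneg (by positivity) c.τ0
  nlinarith

end Boot

section Data

structure Dat (R : ℕ → ℝ) (B ε : ℝ) (g : ℕ → E3 → ℝ) : Prop where
  B4 : 4 ≤ B
  ε0 : 0 ≤ ε
  R0 : ∀ k, 0 < R k
  Rz : R 0 = 1
  R1 : ∀ k, 8 * B * R (k + 1) ≤ R k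
  sm : ∀ k, Sm (g k)
  ro : ∀ k c s (h1 : c ^ 2 + s ^ 2 = 1) x, g k (At c s 1 h1 (by norm_num) x) = g k x
  nn : ∀ k x, 0 ≤ g k x
  ub : ∀ k x, g k x ≤ ε / R k
  su : ∀ k x, g k x ≠ 0 → x ∈ W0 (R k)

def xi0 (N : ℕ) (g : ℕ → E3 → ℝ) (x : E3) : ℝ := ∑ k ∈ Finset.range (N + 1), (g k (sg x) - g k x)

theorem W0_n {R : ℝ} (hR : 0 < R) {x : E3} (h : x ∈ W0 R) : ‖x‖ ≤ 3 * R := by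
  obtain ⟨h1, h2, h3, h4⟩ := h
  refine le_of_sq_le_sq ?_ (by positivity)
  rw [nsq, ← rc_sq]
  nlinarith [rc_nn x]

theorem rc_At {c s e : ℝ} (h1 : c ^ 2 + s ^ 2 = 1) (h2 : e ^ 2 = 1) (x : E3) : rc (At c s e h1 h2 x) = rc x := by
  rw [rc, rc, At_apply, mk3_0, mk3_1]; congr 1; linear_combination (x 0 ^ 2 + x 1 ^ 2) * h1

theorem rc_sg (x : E3) : rc (sg x) = rc x := rc_At _ _ _

variable {N : ℕ} {R : ℕ → ℝ} {B ε : ℝ} {g : ℕ → E3 → ℝ}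

theorem Dat.anti (h : Dat R B ε g) : Antitone R := antitone_nat_of_succ_le fun k => by
  nlinarith [h.R1 k, h.R0 (k + 1), h.B4]

theorem Dat.far (h : Dat R B ε g) (k : ℕ) (x : E3) (hx : 3 < ‖x‖) : g k x = 0 := by
  by_contra h0
  have := W0_n (h.R0 k) (h.su k x h0)
  have := h.anti (Nat.zero_le k)
  rw [h.Rz] at this
  linarith

theorem Dat.xsm (h : Dat R B ε g) : Sm (xi0 N g) :=
  ContDiff.sum fun k _ => ((h.sm k).comp sg.contDiff).sub (h.sm k)

theorem Dat.xfar (h : Dat R B ε g) (x : E3) (hx : 3 < ‖x‖) : xi0 N g x = 0 :=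
  Finset.sum_eq_zero fun k _ => by rw [h.far k x hx, h.far k (sg x) (by simpa using hx), sub_zero]

theorem Dat.xro (h : Dat R B ε g) (c s : ℝ) (h1 : c ^ 2 + s ^ 2 = 1) (x : E3) :
    xi0 N g (At c s 1 h1 (by norm_num) x) = xi0 N g x :=
  Finset.sum_congr rfl fun k _ => by
    have : sg (At c s 1 h1 (by norm_num) x) = At c s 1 h1 (by norm_num) (sg x) := by
      apply ext3 <;> simp [sg_apply, At_apply, mk3_0, mk3_1, mk3_2]
    rw [this, h.ro, h.ro]

theorem xsg (x : E3) : -1 * xi0 N g (sg x) = xi0 N g x := by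
  rw [xi0, xi0, Finset.mul_sum]; exact Finset.sum_congr rfl fun k _ => by rw [sg_sg]; ring

theorem Dat.xax (h : Dat R B ε g) (x : E3) (hx : rc x < R N) : xi0 N g x = 0 :=
  Finset.sum_eq_zero fun k hk => by
    have hR := h.anti (show k ≤ N by have := Finset.mem_range.1 hk; omega)
    have : ∀ y, rc y = rc x → g k y = 0 := fun y hy => by
      by_contra h0
      have := (h.su k y h0).1
      linarith
    rw [this _ (rc_sg x), this x rfl, sub_zero]

theorem VV_ssum {f : ℕ → PP → ℝ} (hf : ∀ k, Sm (f k)) (hs : ∀ k, SC (f k)) (n : ℕ) :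
    (Sm (fun p : PP => ∑ k ∈ Finset.range n, (f k (p.1, sg p.2) - f k p)) ∧
    SC (fun p : PP => ∑ k ∈ Finset.range n, (f k (p.1, sg p.2) - f k p))) ∧
      ∀ p, VV (fun p : PP => ∑ k ∈ Finset.range n, (f k (p.1, sg p.2) - f k p)) p = ∑ k ∈ Finset.range n, GG (f k) p := by
  induction n with
  | zero =>
    refine ⟨⟨contDiff_const, fun T => ⟨1, one_pos, fun p _ _ => by simp⟩⟩, fun p => ?_⟩
    have := VV_smul 0 (fun _ => 0) p
    simpa using this
  | succ n ih =>
    obtain ⟨⟨a, b⟩, c⟩ := ih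
    have h1 : Sm (fun p : PP => f n (p.1, sg p.2)) := by simpa using (hf n).compA (A := sg) 1
    have h2 : SC (fun p : PP => f n (p.1, sg p.2)) := by simpa using (hs n).compA (A := sg) 1
    have e : (fun p : PP => ∑ k ∈ Finset.range (n + 1), (f k (p.1, sg p.2) - f k p)) =
        fun p => ∑ k ∈ Finset.range n, (f k (p.1, sg p.2) - f k p) - (f n p - f n (p.1, sg p.2)) := by
      funext p; rw [Finset.sum_range_succ]; ring
    have h3 : Sm (fun p : PP => f n p - f n (p.1, sg p.2)) := (hf n).sub h1
    have h4 := (hs n).sub h2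
    rw [e]
    refine ⟨⟨a.sub h3, b.sub h4⟩, fun p => ?_⟩
    rw [← VV_sub a.continuous b h3.continuous h4, c, ← VV_sub (hf n).continuous (hs n) h1.continuous h2, Finset.sum_range_succ, GG]
    abel

theorem Dat.cfg (h : Dat R B ε g) : ∃ ξ f, Sol (xi0 N g) ξ ∧ Cfg N R B ε (VV ξ) f ∧ ∀ k x, f k (0, x) = g k x := by
  obtain ⟨ξ, hξ⟩ := exists_Sol (h.xsm (N := N)) (R := 3) (by norm_num) h.xfar
  have hU := VV_fld hξ.sm hξ.sc
  choose f hf f0 ft using fun k => transport_exists hU (h.sm k)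
  have hs : ∀ k, SC (f k) := fun k => supp_SC hU (hf k).diff (ft k) (R := 3) (by norm_num) fun x hx => by rw [f0, h.far k x hx]
  have hsU := fun t x => hξ.symU sg_sy xsg t x
  have hval : ∀ k p, ∃ x, f k p = g k x := fun k p => by
    obtain ⟨γ, h1, h2⟩ := exists_char hU (lt_add_one |p.1|) p.2
    have h3 := along (hf k).diff (ft k) h2 (lt_add_one |p.1|)
    rw [h1, f0] at h3
    exact ⟨_, h3⟩
  have hcs : ∀ k, Sm (fun p : PP => f k (p.1, sg p.2)) := fun k => by simpa using (hf k).compA (A := sg) 1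
  have tcs : ∀ k p, fderiv ℝ (fun p : PP => f k (p.1, sg p.2)) p (1, VV ξ p) = 0 := fun k p => by
    have := fd_A (A := sg) (hf k) p.1 p.2 (VV ξ p) 1
    simp only [one_mul] at this
    rw [this, hsU, ft]
  obtain ⟨⟨a, b⟩, c⟩ := VV_ssum hf hs (N + 1)
  have he : ξ = fun p : PP => ∑ k ∈ Finset.range (N + 1), (f k (p.1, sg p.2) - f k p) := by
    funext p
    refine tr_unique hU hξ.sm a (fun x => by simp only [hξ.ini, f0, xi0]) hξ.tr (fun p => ?_) p
    have e : HasFDerivAt (fun p : PP => ∑ k ∈ Finset.range (N + 1), (f k (p.1, sg p.2) - f k p)) _ p :=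
      HasFDerivAt.fun_sum fun k _ => ((hcs k).diff p).hasFDerivAt.sub ((hf k).diff p).hasFDerivAt
    rw [e.fderiv, ContinuousLinearMap.sum_apply]
    exact Finset.sum_eq_zero fun k _ => by rw [sub_apply, tcs, ft, sub_zero]
  refine ⟨ξ, f, hξ, ⟨hU, VV_dv hξ.sm hξ.sc, h.B4, h.ε0, h.R0, h.R1, hf, hs, ft, fun k t y => ?_, fun k p => ?_, fun k p => ?_,
    fun k y hy => h.su k y (by rwa [f0] at hy), fun p => ?_⟩, f0⟩
  · have h1 : Sm (fun p : PP => f k (p.1, A4 p.2)) := by simpa using (hf k).compA (A := A4) 1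
    refine tr_unique hU h1 (hf k) (fun x => ?_) (fun p => ?_) (ft k) (t, y)
    · simp only [f0]; exact h.ro k _ _ _ x
    · have := fd_A (A := A4) (hf k) p.1 p.2 (VV ξ p) 1
      simp only [one_mul] at this
      have e : A4 (VV ξ p) = VV ξ (p.1, A4 p.2) := hξ.rotU h.xro _ p.1 p.2
      rw [this, e, ft]
  · obtain ⟨x, hx⟩ := hval k p; rw [hx]; exact h.nn k x
  · obtain ⟨x, hx⟩ := hval k p; rw [hx]; exact h.ub k x
  · rw [← c p]; exact congrArg (fun ξ => VV ξ p) he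

end Data

section Norms

variable {N : ℕ} {R α : ℕ → ℝ} {B ε q : ℝ} {g : ℕ → E3 → ℝ}

theorem Dat.uniq (h : Dat R B ε g) {x : E3} {k j : ℕ} (hk : x ∈ W0 (R k)) (hj : x ∈ W0 (R j)) : k = j := by
  have key : ∀ {k j}, x ∈ W0 (R k) → x ∈ W0 (R j) → ¬ k < j := fun {k j} hk hj hl => by
    have h1 := h.anti (show k + 1 ≤ j from hl)
    nlinarith [h.R1 k, h.R0 (k + 1), h.B4, hk.2.2.1, hj.2.2.2]
  exact le_antisymm (not_lt.1 (key hj hk)) (not_lt.1 (key hk hj))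

theorem Dat.sum1 (h : Dat R B ε g) {x : E3} {i : ℕ} (hi : i ≤ N) (hx : x ∈ W0 (R i)) :
    ∑ k ∈ Finset.range (N + 1), g k x = g i x :=
  Finset.sum_eq_single_of_mem i (Finset.mem_range.2 (by omega)) fun k _ hk => by
    by_contra h0; exact hk (h.uniq (h.su k x h0) hx)

theorem Dat.xi (h : Dat R B ε g) {x : E3} {i : ℕ} (hi : i ≤ N) (hx : x ∈ W0 (R i)) : xi0 N g x = -g i x := by
  rw [xi0, Finset.sum_sub_distrib, h.sum1 hi hx, Finset.sum_eq_zero, zero_sub]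
  intro k _
  by_contra h0
  have := (h.su k _ h0).2.2.1
  rw [sg_apply, mk3_2] at this
  linarith [hx.2.2.1, h.R0 i, h.R0 k]

theorem Dat.pt (h : Dat R B ε g) (x : E3) : xi0 N g x = 0 ∨
    ∃ k ≤ N, ∃ y, |xi0 N g x| = g k y ∧ g k y ≠ 0 ∧ rc y = rc x ∧ ‖y‖ = ‖x‖ := by
  by_cases h0 : xi0 N g x = 0
  · exact Or.inl h0
  obtain ⟨k, hk, hk'⟩ := Finset.exists_ne_zero_of_sum_ne_zero h0
  have hkN : k ≤ N := by have := Finset.mem_range.1 hk; omega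
  right
  by_cases h1 : g k x = 0
  · have h2 : g k (sg x) ≠ 0 := fun h2 => hk' (by rw [h1, h2, sub_zero])
    refine ⟨k, hkN, sg x, ?_, h2, rc_sg x, by simp⟩
    rw [← xsg, h.xi hkN (h.su k _ h2)]; simp [abs_of_nonneg (h.nn k _)]
  · refine ⟨k, hkN, x, ?_, h1, rfl, rfl⟩
    rw [h.xi hkN (h.su k _ h1), abs_neg, abs_of_nonneg (h.nn k _)]

theorem pow_int (hq : 1 < q) {b : ℝ} (hb : 0 ≤ b) : ∫⁻ l in Ioc 0 b, ENNReal.ofReal (l ^ (q - 1)) = ENNReal.ofReal (b ^ q / q) := by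
  have hi : IntervalIntegrable (fun l : ℝ => l ^ (q - 1)) volume 0 b := intervalIntegral.intervalIntegrable_rpow' (by linarith)
  rw [← ofReal_integral_eq_lintegral_ofReal ((intervalIntegrable_iff_integrableOn_Ioc_of_le hb).1 hi)
    (ae_restrict_of_forall_mem measurableSet_Ioc fun l hl => Real.rpow_nonneg hl.1.le _), ← intervalIntegral.integral_of_le hb,
    integral_rpow (Or.inl (by linarith)), sub_add_cancel, Real.zero_rpow (by linarith), sub_zero]

theorem lor_bd (hq : 1 < q) (R0 : ∀ k, 0 < R k) (anti : Antitone R) (α0 : ∀ k, 0 ≤ α k) {f : E3 → ℝ}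
    (H : ∀ x l, 0 < l → l < |f x| → ∃ k ≤ N, l ≤ α k / R k ∧ ‖x‖ ≤ 3 * R k) :
    lorentz3q q f ≤ ENNReal.ofReal ((3 * ((9 * κ) ^ (q / 3) / q * ∑ k ∈ Finset.range (N + 1), α k ^ q)) ^ (1 / q)) := by
  have hκ := κ_nn
  set C := (9 * κ) ^ (q / 3) with hC
  have hC0 : 0 ≤ C := by positivity
  have key : ∀ l ∈ Ioi (0 : ℝ), ENNReal.ofReal (l ^ (q - 1)) * (volume {x : E3 | l < |f x|}) ^ (q / 3) ≤
      ∑ k ∈ Finset.range (N + 1), (Ioc 0 (α k / R k)).indicator (fun l => ENNReal.ofReal (C * R k ^ q) * ENNReal.ofReal (l ^ (q - 1))) l := by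
    intro l hl
    by_cases hk : ∃ k, k ≤ N ∧ l ≤ α k / R k
    · classical
      obtain ⟨h1, h2⟩ := Nat.find_spec hk
      set k := Nat.find hk with hkd
      have hR := R0 k
      refine le_trans ?_ (Finset.single_le_sum (fun _ _ => zero_le) (Finset.mem_range.2 (Nat.lt_succ_of_le h1)))
      rw [indicator_of_mem (show l ∈ Ioc 0 (α k / R k) from ⟨hl, h2⟩), mul_comm]
      gcongr
      have hv : volume {x : E3 | l < |f x|} ≤ ENNReal.ofReal ((3 * R k) ^ 3 * (κ / 3)) := by
        rw [← vol_cball (x := 0) (by positivity), ofReal_measureReal measure_closedBall_lt_top.ne]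
        refine measure_mono fun x hx => ?_
        obtain ⟨j, hj, hj1, hj2⟩ := H x l hl hx
        have := anti (Nat.find_min' hk ⟨hj, hj1⟩)
        rw [mem_closedBall_zero_iff]; linarith
      refine (ENNReal.rpow_le_rpow hv (by positivity)).trans (le_of_eq ?_)
      rw [ENNReal.ofReal_rpow_of_nonneg (by positivity) (by positivity), show (3 * R k) ^ 3 * (κ / 3) = (9 * κ) * R k ^ 3 by ring,
        Real.mul_rpow (by positivity) (by positivity), ← Real.rpow_natCast, ← Real.rpow_mul hR.le]
      congr 3; push_cast; ring
    · have : {x : E3 | l < |f x|} = ∅ := by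
        ext x
        simp only [mem_setOf_eq, mem_empty_iff_false, iff_false]
        intro hx
        obtain ⟨j, hj, hj1, -⟩ := H x l hl hx
        exact hk ⟨j, hj, hj1⟩
      rw [this, measure_empty, ENNReal.zero_rpow_of_pos (by positivity), mul_zero]
      exact zero_le
  have hint : ∫⁻ l in Ioi (0 : ℝ), ENNReal.ofReal (l ^ (q - 1)) * (volume {x : E3 | l < |f x|}) ^ (q / 3) ≤
      ENNReal.ofReal (C / q * ∑ k ∈ Finset.range (N + 1), α k ^ q) := by
    refine ((setLIntegral_mono' measurableSet_Ioi key).trans (setLIntegral_le_lintegral _ _)).trans ?_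
    have hm : ∀ k, Measurable (fun l : ℝ => ENNReal.ofReal (C * R k ^ q) * ENNReal.ofReal (l ^ (q - 1))) := fun k => by fun_prop
    rw [lintegral_finsetSum _ fun k _ => (hm k).indicator measurableSet_Ioc, Finset.mul_sum,
      ENNReal.ofReal_sum_of_nonneg fun k _ => by have := α0 k; positivity]
    refine Finset.sum_le_sum fun k _ => ?_
    have hR := R0 k
    have := α0 k
    rw [lintegral_indicator measurableSet_Ioc, lintegral_const_mul _ (by fun_prop), pow_int hq (by positivity),
      ← ENNReal.ofReal_mul (by positivity), Real.div_rpow this hR.le]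
    refine ENNReal.ofReal_le_ofReal (le_of_eq ?_)
    field_simp
  have h3 : 0 ≤ C / q * ∑ k ∈ Finset.range (N + 1), α k ^ q :=
    mul_nonneg (by positivity) (Finset.sum_nonneg fun k _ => Real.rpow_nonneg (α0 k) _)
  rw [lorentz3q, ← ENNReal.ofReal_rpow_of_nonneg (by linarith) (by positivity), ENNReal.ofReal_mul (by norm_num)]
  refine ENNReal.rpow_le_rpow ?_ (by positivity)
  rw [show ENNReal.ofReal 3 = 3 by simp]
  gcongr

theorem Dat.norms (h : Dat R B ε g) (hq : 1 < q) (α0 : ∀ k, 0 ≤ α k) (ha : ∀ k x, g k x ≤ α k / R k)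
    (hs : ∑ k ∈ Finset.range (N + 1), α k ^ q ≤ 2 * ε ^ q) :
    eLpNorm (fun x => rc x * xi0 N g x) ∞ volume + eLpNorm (fun x => rc x * xi0 N g x) 1 volume +
      lorentz3q q (fun x => rc x * xi0 N g x / rc x) ≤
    ENNReal.ofReal ((2 + 18 * κ + (3 * ((9 * κ) ^ (q / 3) / q * 2)) ^ (1 / q)) * ε) := by
  have hκ := κ_nn
  have hε := h.ε0
  have hb : ∀ x, ‖rc x * xi0 N g x‖ ≤ 2 * ε := fun x => by
    rw [norm_mul, Real.norm_eq_abs, Real.norm_eq_abs, abs_of_nonneg (rc_nn x)]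
    rcases h.pt (N := N) x with h0 | ⟨k, hk, y, h1, h2, h3, h4⟩
    · rw [h0]; simp; exact hε
    · have hR := h.R0 k
      have := (h.su k y h2).2.1
      rw [h3] at this
      rw [h1]
      calc _ ≤ (2 * R k) * (ε / R k) := mul_le_mul this (h.ub k y) (h.nn k y) (by positivity)
        _ = _ := by field_simp
  have n1 : eLpNorm (fun x => rc x * xi0 N g x) ∞ volume ≤ ENNReal.ofReal (2 * ε) := by
    rw [eLpNorm_exponent_top]; exact eLpNormEssSup_le_of_ae_bound (ae_of_all _ hb)
  have n2 : eLpNorm (fun x => rc x * xi0 N g x) 1 volume ≤ ENNReal.ofReal (18 * κ * ε) := by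
    rw [eLpNorm_one_eq_lintegral_enorm]
    calc _ ≤ ∫⁻ x, (Metric.closedBall (0 : E3) 3).indicator (fun _ => ENNReal.ofReal (2 * ε)) x := by
          refine lintegral_mono fun x => ?_
          by_cases hx : x ∈ Metric.closedBall (0 : E3) 3
          · rw [indicator_of_mem hx, ← ofReal_norm_eq_enorm]; exact ENNReal.ofReal_le_ofReal (hb x)
          · rw [indicator_of_notMem hx, h.xfar x (by simpa using hx)]; simp
      _ = _ := by
        rw [lintegral_indicator Metric.isClosed_closedBall.measurableSet, setLIntegral_const,
          ← ofReal_measureReal measure_closedBall_lt_top.ne, vol_cball (by norm_num), ← ENNReal.ofReal_mul (by positivity)]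
        congr 1; ring
  have n3 : lorentz3q q (fun x => rc x * xi0 N g x / rc x) ≤ ENNReal.ofReal ((3 * ((9 * κ) ^ (q / 3) / q * 2)) ^ (1 / q) * ε) := by
    refine (lor_bd (N := N) hq h.R0 h.anti α0 fun x l hl hx => ?_).trans (ENNReal.ofReal_le_ofReal ?_)
    · have hx' : l < |xi0 N g x| := by
        by_cases hr : rc x = 0
        · rw [hr, div_zero, abs_zero] at hx; linarith
        · rwa [mul_div_cancel_left₀ _ hr] at hx
      rcases h.pt (N := N) x with h0 | ⟨k, hk, y, h1, h2, h3, h4⟩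
      · rw [h0, abs_zero] at hx'; linarith
      · exact ⟨k, hk, (hx'.trans_le (h1.trans_le (ha k y))).le, h4 ▸ W0_n (h.R0 k) (h.su k y h2)⟩
    · have e : ε = (ε ^ q) ^ (1 / q) := by rw [← Real.rpow_mul hε, mul_one_div_cancel (by linarith), Real.rpow_one]
      have h0 : 0 ≤ ∑ k ∈ Finset.range (N + 1), α k ^ q := Finset.sum_nonneg fun k _ => Real.rpow_nonneg (α0 k) _
      have hC : 0 ≤ (9 * κ) ^ (q / 3) / q := by positivity
      conv_rhs => rw [e]
      rw [← Real.mul_rpow (by positivity) (by positivity)]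
      refine Real.rpow_le_rpow (by positivity) ?_ (by positivity)
      nlinarith [mul_le_mul_of_nonneg_left hs hC]
  refine (add_le_add (add_le_add n1 n2) n3).trans (le_of_eq ?_)
  rw [← ENNReal.ofReal_add (by positivity) (by positivity), ← ENNReal.ofReal_add (by positivity) (by positivity)]
  congr 1; ring

end Norms

section Prof

def bmp1 : ContDiffBump (5 / 2 : ℝ) := ⟨1 / 2, 1, by norm_num, by norm_num⟩
def bmp2 : ContDiffBump (3 / 2 : ℝ) := ⟨1 / 4, 1 / 2, by norm_num, by norm_num⟩
def phi (x : E3) : ℝ := bmp1 (x 0 ^ 2 + x 1 ^ 2) * bmp2 (x 2)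

theorem phi_sm : Sm phi := by
  have h1 : Sm (fun x : E3 => x 0 ^ 2 + x 1 ^ 2) := by unfold Sm; fun_prop
  have h2 : Sm (fun x : E3 => x 2) := by unfold Sm; fun_prop
  exact (bmp1.contDiff.comp h1).mul (bmp2.contDiff.comp h2)

theorem phi_nn (x : E3) : 0 ≤ phi x := mul_nonneg bmp1.nonneg bmp2.nonneg

theorem phi_le (x : E3) : phi x ≤ 1 := mul_le_one₀ bmp1.le_one bmp2.nonneg bmp2.le_one

theorem phi_su {x : E3} (h : phi x ≠ 0) : x ∈ W0 1 := by
  have h1 : x 0 ^ 2 + x 1 ^ 2 ∈ Function.support bmp1 := left_ne_zero_of_mul h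
  have h2 : x 2 ∈ Function.support bmp2 := right_ne_zero_of_mul h
  rw [ContDiffBump.support_eq, Metric.mem_ball, Real.dist_eq, abs_lt] at h1 h2
  rw [← rc_sq] at h1
  simp only [bmp1, bmp2] at h1 h2
  have := rc_nn x
  exact ⟨by nlinarith, by nlinarith, by linarith, by linarith⟩

theorem phi_one : phi (mk3 (3 / 2) 0 (3 / 2)) = 1 := by
  rw [phi, mk3_0, mk3_1, mk3_2, bmp1.one_of_mem_closedBall, bmp2.one_of_mem_closedBall, one_mul]
  · simp [bmp2]
  · rw [Metric.mem_closedBall, Real.dist_eq, abs_le]; simp only [bmp1]; norm_num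

theorem phi_cs : HasCompactSupport phi := HasCompactSupport.intro (isCompact_closedBall 0 3) fun x hx => by
  by_contra h
  have := W0_n one_pos (phi_su h)
  simp at hx; linarith

theorem phi_int : 0 < ∫ x, phi x :=
  phi_sm.continuous.integral_pos_of_hasCompactSupport_nonneg_nonzero phi_cs phi_nn (x := mk3 (3 / 2) 0 (3 / 2)) (by rw [phi_one]; norm_num)

theorem rc_smul {c : ℝ} (hc : 0 ≤ c) (x : E3) : rc (c • x) = c * rc x := by
  rw [rc, rc, ← Real.sqrt_sq hc, ← Real.sqrt_mul (sq_nonneg _)]; congr 1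
  simp only [PiLp.smul_apply, smul_eq_mul, Real.sqrt_sq hc]; ring

def gg (α R : ℕ → ℝ) (k : ℕ) (x : E3) : ℝ := α k / R k * phi ((R k)⁻¹ • x)

variable {R α : ℕ → ℝ} {B ε : ℝ}

theorem gg_le (R0 : ∀ k, 0 < R k) (α0 : ∀ k, 0 ≤ α k) (k : ℕ) (x : E3) : gg α R k x ≤ α k / R k :=
  mul_le_of_le_one_right (div_nonneg (α0 k) (R0 k).le) (phi_le _)

theorem gg_dat (B4 : 4 ≤ B) (ε0 : 0 ≤ ε) (R0 : ∀ k, 0 < R k) (Rz : R 0 = 1) (R1 : ∀ k, 8 * B * R (k + 1) ≤ R k)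
    (α0 : ∀ k, 0 ≤ α k) (α1 : ∀ k, α k ≤ ε) : Dat R B ε (gg α R) where
  B4 := B4
  ε0 := ε0
  R0 := R0
  Rz := Rz
  R1 := R1
  sm k := contDiff_const.mul (phi_sm.comp (contDiff_const_smul _))
  ro k c s h1 x := by
    rw [gg, gg, ← map_smul]
    congr 1
    simp only [phi, At_apply, mk3_0, mk3_1, mk3_2, one_mul]
    congr 2
    linear_combination (((R k)⁻¹ • x) 0 ^ 2 + ((R k)⁻¹ • x) 1 ^ 2) * h1
  nn k x := mul_nonneg (div_nonneg (α0 k) (R0 k).le) (phi_nn _)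
  ub k x := (gg_le R0 α0 k x).trans (div_le_div_of_nonneg_right (α1 k) (R0 k).le)
  su k x h := by
    have hR := R0 k
    obtain ⟨h1, h2, h3, h4⟩ := phi_su (right_ne_zero_of_mul h)
    rw [rc_smul (by positivity), inv_mul_eq_div] at h1 h2
    rw [PiLp.smul_apply, smul_eq_mul, inv_mul_eq_div] at h3 h4
    rw [le_div_iff₀ hR, one_mul] at h1 h3
    rw [div_le_iff₀ hR, mul_one] at h2 h4
    exact ⟨h1, h2, h3, h4⟩

theorem gg_int (R0 : ∀ k, 0 < R k) (k : ℕ) : ∫ x, gg α R k x = α k * (∫ x, phi x) * R k ^ 2 := by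
  have hR := R0 k
  simp only [gg]
  rw [integral_const_mul, Measure.integral_comp_inv_smul, abs_of_pos (by positivity)]
  simp only [finrank_euclideanSpace, Fintype.card_fin, smul_eq_mul]
  field_simp

theorem sup_pt {f : E3 → ℝ} (hf : Continuous f) {A : ℝ} (hA : 0 ≤ A) (h : eLpNorm f ∞ volume ≤ ENNReal.ofReal A) (x : E3) : |f x| ≤ A := by
  have h1 : ∀ᵐ x, |f x| ≤ A := by
    filter_upwards [ae_le_eLpNormEssSup (f := f) (μ := volume)] with x hx
    rw [← eLpNorm_exponent_top] at hx
    have := hx.trans h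
    rwa [← ofReal_norm, ENNReal.ofReal_le_ofReal_iff hA] at this
  have h2 := (Measure.dense_of_ae h1).closure_eq
  rw [(isClosed_le hf.abs continuous_const).closure_eq] at h2
  exact (Set.eq_univ_iff_forall.1 h2) x

end Prof

end Shortcuts

/-- norm inflation for the 3D axisymmetric Euler equations.
Fix `q > 1`.  For every `ε̃, δ, A > 0` there exist an axisymmetric `ω₀ ∈ C_c^∞(ℝ³)`
vanishing on the axis, and smooth `ω : ℝ³ × [0,∞) → ℝ`, `u : ℝ³ × [0,∞) → ℝ³` such that:
(i) `‖ω₀‖_∞ + ‖ω₀‖_1 + ‖ω₀/r‖_{L^{3,q}} ≤ ε̃`;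
(ii) `ω(·,0) = ω₀`, each `ω(·,t)` is axisymmetric with compact support, and `u(·,t)` is
the Biot–Savart velocity of `ω(·,t)`;
(iii) `Ω(x,t) = ω(x,t) e_θ(x)` solves `∂_t Ω + (u·∇)Ω = (Ω·∇)u` pointwise on
`ℝ³ × [0,∞)` (time derivative within `[0,∞)`);
(iv) `sup_{0 ≤ t ≤ δ} ‖ω(·,t)‖_∞ ≥ A`. -/
theorem norm_inflation_axisymmetric_euler (q : ℝ) (hq : 1 < q) :
    ∀ εt δ A : ℝ, 0 < εt → 0 < δ → 0 < A →
      ∃ (ω₀ : E3 → ℝ) (ω : E3 → ℝ → ℝ) (u : E3 → ℝ → E3) (Dt : E3 → ℝ → E3),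
        -- ω₀ ∈ C_c^∞, axisymmetric, vanishing on the axis
        ContDiff ℝ (⊤ : ℕ∞) ω₀ ∧ HasCompactSupport ω₀ ∧ Axisym ω₀ ∧
        (∀ x : E3, rc x = 0 → ω₀ x = 0) ∧
        -- (i) smallness of the initial data
        eLpNorm ω₀ ∞ volume + eLpNorm ω₀ 1 volume +
            lorentz3q q (fun x => ω₀ x / rc x) ≤ ENNReal.ofReal εt ∧
        -- (ii) initial condition, axisymmetry, compact support, Biot–Savart law
        (∀ x : E3, ω x 0 = ω₀ x) ∧
        (∀ t : ℝ, 0 ≤ t → Axisym (fun x => ω x t) ∧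
          HasCompactSupport (fun x => ω x t) ∧
          (∀ x : E3, u x t = biotSavart (fun y => ω y t) x)) ∧
        -- smoothness of ω and u on ℝ³ × [0,∞)
        ContDiffOn ℝ (⊤ : ℕ∞) (fun p : E3 × ℝ => ω p.1 p.2) (univ ×ˢ Ici (0 : ℝ)) ∧
        ContDiffOn ℝ (⊤ : ℕ∞) (fun p : E3 × ℝ => u p.1 p.2) (univ ×ˢ Ici (0 : ℝ)) ∧
        -- (iii) the vorticity equation, pointwise on ℝ³ × [0,∞)
        (∀ x : E3, ∀ t : ℝ, 0 ≤ t →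
          HasDerivWithinAt (fun s => ω x s • eTheta x) (Dt x t) (Ici (0 : ℝ)) t ∧
          DifferentiableAt ℝ (fun y => ω y t • eTheta y) x ∧
          DifferentiableAt ℝ (fun y => u y t) x ∧
          Dt x t + fderiv ℝ (fun y => ω y t • eTheta y) x (u x t)
            = fderiv ℝ (fun y => u y t) x (ω x t • eTheta x)) ∧
        -- (iv) norm inflation
        ENNReal.ofReal A ≤ ⨆ t ∈ Icc (0 : ℝ) δ, eLpNorm (fun x => ω x t) ∞ volume := by
  intro εt δ A hεt hδ hA
  have hκ := κ_nn
  obtain ⟨K, hK⟩ : ∃ K, K = 2 + 18 * κ + (3 * ((9 * κ) ^ (q / 3) / q * 2)) ^ (1 / q) := ⟨_, rfl⟩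
  have hK0 : 0 < K := by rw [hK]; positivity
  obtain ⟨ε, hε, hKε⟩ : ∃ ε : ℝ, 0 < ε ∧ K * ε = εt := ⟨εt / K, by positivity, by field_simp⟩
  obtain ⟨Q, hQ1, hQA⟩ : ∃ Q : ℝ, 1 ≤ Q ∧ A ≤ Q * ε := ⟨max 1 (A / ε), le_max_left _ _, by
    rw [← div_le_iff₀ hε]; exact le_max_right _ _⟩
  obtain ⟨B, hB⟩ : ∃ B, B = 4 * Q := ⟨_, rfl⟩
  have hB4 : 4 ≤ B := by linarith
  have hE : 0 ≤ EE B ε := by unfold EE; positivity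
  obtain ⟨τ, hτ0, hτδ, hτ⟩ : ∃ τ : ℝ, 0 < τ ∧ τ ≤ δ ∧ (4 * EE B ε + EE B ε * B ^ 2) * τ ≤ 1 / 10 := by
    have hD : 0 ≤ 4 * EE B ε + EE B ε * B ^ 2 := by positivity
    refine ⟨min δ (1 / 10 / (4 * EE B ε + EE B ε * B ^ 2 + 1)), by positivity, min_le_left _ _, ?_⟩
    refine (mul_le_mul_of_nonneg_left (min_le_right _ _) hD).trans ?_
    rw [mul_div_assoc', div_le_iff₀ (by positivity)]; linarith
  have hI := phi_int
  obtain ⟨N, hN1, hN⟩ : ∃ N : ℕ, 1 ≤ N ∧ Real.log Q + 1 < (N : ℝ) ^ (1 - 1 / q) * (ε * (∫ x, phi x) * (B ^ 7)⁻¹ / 600 * τ) := by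
    have hp : 0 < 1 - 1 / q := by rw [sub_pos, div_lt_one (by linarith)]; exact hq
    have h1 := ((tendsto_rpow_atTop hp).comp tendsto_natCast_atTop_atTop).atTop_mul_const
      (show 0 < ε * (∫ x, phi x) * (B ^ 7)⁻¹ / 600 * τ by positivity)
    obtain ⟨N, h2, h3⟩ := ((h1.eventually_gt_atTop (Real.log Q + 1)).and (eventually_ge_atTop 1)).exists
    exact ⟨N, h3, h2⟩
  have hN0 : (0 : ℝ) < N := by exact_mod_cast hN1
  obtain ⟨a, ha⟩ : ∃ a, a = ε * (N : ℝ) ^ (-(1 / q)) := ⟨_, rfl⟩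
  have ha0 : 0 ≤ a := by rw [ha]; positivity
  have haε : a ≤ ε := by
    rw [ha]; refine mul_le_of_le_one_right hε.le (Real.rpow_le_one_of_one_le_of_nonpos (by exact_mod_cast hN1) ?_)
    rw [neg_nonpos]; positivity
  obtain ⟨α, hα⟩ : ∃ α : ℕ → ℝ, α = fun k => if k < N then a else ε := ⟨_, rfl⟩
  have α0 : ∀ k, 0 ≤ α k := fun k => by rw [hα]; dsimp only; split_ifs <;> linarith
  have α1 : ∀ k, α k ≤ ε := fun k => by rw [hα]; dsimp only; split_ifs <;> linarith
  have αN : α N = ε := by simp [hα]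
  have αl : ∀ k < N, α k = a := fun k hk => by simp [hα, hk]
  obtain ⟨R, hR⟩ : ∃ R : ℕ → ℝ, R = fun k => (8 * B)⁻¹ ^ k := ⟨_, rfl⟩
  have R0 : ∀ k, 0 < R k := fun k => by rw [hR]; positivity
  have D : Dat R B ε (gg α R) := gg_dat hB4 hε.le R0 (by simp [hR]) (fun k => by
    rw [hR]; dsimp only; rw [pow_succ]; exact le_of_eq (by field_simp)) α0 α1
  have hsum : ∑ k ∈ Finset.range (N + 1), α k ^ q ≤ 2 * ε ^ q := by
    rw [Finset.sum_range_succ, αN, Finset.sum_congr rfl fun k hk => by rw [αl k (Finset.mem_range.1 hk)], Finset.sum_const,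
      Finset.card_range, nsmul_eq_mul, ha, Real.mul_rpow hε.le (by positivity), ← Real.rpow_mul hN0.le,
      show -(1 / q) * q = -1 by field_simp, Real.rpow_neg_one]
    exact le_of_eq (by field_simp; ring)
  obtain ⟨ξ, f, hξ, C, f0⟩ := D.cfg (N := N)
  have hr := D.xro (N := N)
  have hom : Sm (fun p : PP => rc p.2 * ξ p) := hξ.om_sm hr (R0 N) fun x hx => D.xax x hx
  have hini : (fun x => rc x * ξ (0, x)) = fun x => rc x * xi0 N (gg α R) x := by funext x; rw [hξ.ini]
  have hsw : Sm (fun p : E3 × ℝ => (p.2, p.1)) := contDiff_snd.prodMk contDiff_fst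
  refine ⟨fun x => rc x * xi0 N (gg α R) x, fun x t => rc x * ξ (t, x), fun x t => VV ξ (t, x),
    fun x t => fderiv ℝ ξ (t, x) (1, 0) • JL x, ?_, ?_, ?_, ?_, ?_, ?_, ?_, ?_, ?_, ?_, ?_⟩
  · rw [← hini]; exact slice_sm hom 0
  · rw [← hini]; exact (slice_cs hξ.sc 0).mul_left
  · rw [← hini]; exact hξ.axisym hr 0
  · intro x hx; simp [hx]
  · refine (D.norms hq α0 (gg_le R0 α0) hsum).trans (le_of_eq ?_)
    rw [← hK, hKε]
  · intro x; simp only [hξ.ini]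
  · refine fun t _ => ⟨hξ.axisym hr t, (slice_cs hξ.sc t).mul_left, fun x => ?_⟩
    simp only [VV_bs, mul_comm]
  · exact (hom.comp hsw).contDiffOn
  · exact ((VV_sm hξ.sm hξ.sc).comp hsw).contDiffOn
  · exact fun x t _ => hξ.eqn hr x t
  · by_contra hcon
    push Not at hcon
    have hb : ∀ t ∈ Icc (0 : ℝ) δ, ∀ x, |rc x * ξ (t, x)| ≤ A := fun t ht x =>
      sup_pt (f := fun x => rc x * ξ (t, x)) (slice_sm hom t).continuous hA.le
        ((le_iSup₂_of_le t ht le_rfl).trans hcon.le) x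
    have hRN := R0 N
    have gN : gg α R N (R N • mk3 (3 / 2) 0 (3 / 2)) = ε / R N := by
      rw [gg, smul_smul, inv_mul_cancel₀ hRN.ne', one_smul, phi_one, αN, mul_one]
    obtain ⟨p, hp0, hp⟩ := exists_char C.fld (show |(0 : ℝ)| < τ + 1 by rw [abs_zero]; linarith) (R N • mk3 (3 / 2) 0 (3 / 2))
    have pW : p 0 ∈ W0 (R N) := D.su N _ (by rw [hp0, gN]; positivity)
    have c : Ctl N R B ε Q (τ + 1) τ (VV ξ) p := by
      refine ⟨hQ1, hB, by linarith, hτ0.le, hτ, hp, pW, fun s hs => ?_⟩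
      have h1 := along hξ.sm.diff hξ.tr hp (show |s| < τ + 1 by rw [abs_of_nonneg hs.1]; linarith [hs.2])
      have h2 := hb s ⟨hs.1, hs.2.trans hτδ⟩ (p s)
      rw [h1, hξ.ini, D.xi le_rfl pW, hp0, gN, mul_neg, abs_neg, abs_of_nonneg (mul_nonneg (rc_nn _) (by positivity)),
        ← mul_div_assoc, div_le_iff₀ hRN] at h2
      have h3 : rc (p s) * ε ≤ (Q * R N) * ε := by nlinarith
      exact le_of_mul_le_mul_right h3 hε
    have := C.final c (m := a * ∫ x, phi x) fun j hj => by
      simp only [f0]; rw [gg_int R0, αl j hj]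
    have e : (N : ℝ) * (a * (∫ x, phi x) * (B ^ 7)⁻¹ / 600) * τ =
        (N : ℝ) ^ (1 - 1 / q) * (ε * (∫ x, phi x) * (B ^ 7)⁻¹ / 600 * τ) := by
      rw [ha, sub_eq_add_neg, Real.rpow_add hN0, Real.rpow_one]; ring
    rw [e] at this
    linarith
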